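/- For every σ ∈ (0,1] there is k₀ ∈ ℕ such that for every integer k ≥ k₀, all ε, μ ∈ (0,1] and every C₀ ≥ 1 there is C > 0 such that for every c > 0 there is n₀ ∈ ℕ with the following property for all n ≥ n₀. Let d ∈ [n] with d ≥ C·log n and dn even, let m be an integer with ε·d·n/2 ≤ m ≤ binom(n,2) − dn/2, set δ = 2m/n and suppose δ ≥ n^σ; set p = m·(binom(n,2) − dn/2)^{−1} and η = C₀·μ/log n. Let K ~ G_d(n), form E by including each element of [n]^(2)∖E(K) independently with probability p, and let F = K + E. Then with probability at least 1 − c·n^{−10}: for every pair of distinct x, y ∈ [n] and every Z ⊆ [n] with |Z| ≤ 4k, the number of (F∖K, K)-alternating x,y-paths of length 2k with no internal vertex in Z lies between (1−η)·δ^k·d^k/n and (1+η)·δ^k·d^k/n. (Lemma 8.1.) -/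

import Mathlib

open scoped Classical ENNReal

noncomputable section

namespace Sandwich

variable {n : ℕ}

/-- The degree of the vertex `v` in the graph `G`. -/
def deg (G : SimpleGraph (Fin n)) (v : Fin n) : ℕ := Nat.card (G.neighborSet v)

/-- `G` is a `d`-regular graph. -/
def IsRegularGraph (G : SimpleGraph (Fin n)) (d : ℕ) : Prop := ∀ v, deg G v = d

/-- The number of edges of `G`. -/
def edgeCount (G : SimpleGraph (Fin n)) : ℕ := G.edgeSet.ncard

/-- The probability of the event `P` under the probability mass function `μ`. -/
def prEvent {α : Type*} (μ : PMF α) (P : α → Prop) : ℝ≥0∞ := ∑' a, if P a then μ a else 0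

/-- `μ` is the uniform distribution on the set `S`. -/
def IsUniformOn {α : Type*} (μ : PMF α) (S : Set α) : Prop :=
  ∀ a, μ a = if a ∈ S then (S.ncard : ℝ≥0∞)⁻¹ else 0

/-- `P` lists the `k+1` vertices of a `(G₁,G₂)`-alternating path of length `k`: the vertices
are distinct and consecutive vertices are joined by an edge of `G₁` (for steps of even index)
or of `G₂` (for steps of odd index). -/
def IsAltSeq (G₁ G₂ : SimpleGraph (Fin n)) (k : ℕ) (P : Fin (k + 1) → Fin n) : Prop :=
  Function.Injective P ∧
    ∀ i : Fin k, if (i : ℕ) % 2 = 0 then G₁.Adj (P i.castSucc) (P i.succ)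
      else G₂.Adj (P i.castSucc) (P i.succ)

/-- The number of `(G₁,G₂)`-alternating `x,y`-paths of length `k` with no internal vertex
in `Z`. -/
def altPathCount (G₁ G₂ : SimpleGraph (Fin n)) (k : ℕ) (x y : Fin n) (Z : Set (Fin n)) : ℕ :=
  Nat.card {P : Fin (k + 1) → Fin n // IsAltSeq G₁ G₂ k P ∧ P 0 = x ∧ P (Fin.last k) = y ∧
    ∀ i : Fin (k + 1), i ≠ 0 → i ≠ Fin.last k → P i ∉ Z}

/-- The number of `(G₁,G₂)`-alternating paths of length `k` starting at `x`. -/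
def altStartCount (G₁ G₂ : SimpleGraph (Fin n)) (k : ℕ) (x : Fin n) : ℕ :=
  Nat.card {P : Fin (k + 1) → Fin n // IsAltSeq G₁ G₂ k P ∧ P 0 = x}

/-- The external neighbourhood `N_G(U)` of a set of vertices `U`. -/
def nbhd (G : SimpleGraph (Fin n)) (U : Set (Fin n)) : Set (Fin n) :=
  {v | v ∉ U ∧ ∃ u ∈ U, G.Adj u v}

/-- `e_G(U)`, the number of edges of `G` with both endpoints in `U`. -/
def edgesWithin (G : SimpleGraph (Fin n)) (U : Set (Fin n)) : ℕ :=
  {e ∈ G.edgeSet | ∀ v ∈ e, v ∈ U}.ncard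

/-- `e_G(U,V) = |{(u,v) : u ∈ U, v ∈ V, uv ∈ E(G)}|`. -/
def edgesBetween (G : SimpleGraph (Fin n)) (U V : Set (Fin n)) : ℕ :=
  {p : Fin n × Fin n | p.1 ∈ U ∧ p.2 ∈ V ∧ G.Adj p.1 p.2}.ncard

/-- `|E_{≥2,G}(U)|`, the number of edges `xy ∈ E(G)` with `x ∈ U`, `y ∉ U` such that some
`x' ∈ U ∖ {x}` also satisfies `x'y ∈ E(G)`. -/
def E2count (G : SimpleGraph (Fin n)) (U : Set (Fin n)) : ℕ :=
  {e : Sym2 (Fin n) | e ∈ G.edgeSet ∧ ∃ x y, e = s(x, y) ∧ x ∈ U ∧ y ∉ U ∧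
    ∃ x' ∈ U, x' ≠ x ∧ G.Adj x' y}.ncard

/-- `Σ_{u ∈ N_{F∖K}(v)} Σ_{u' ∈ N_K(u)} d_{F∖K}(u')`. -/
def doubleDegSum (F K : SimpleGraph (Fin n)) (v : Fin n) : ℝ :=
  ∑ u : Fin n, if (F \ K).Adj v u then
    ∑ u' : Fin n, if K.Adj u u' then (deg (F \ K) u' : ℝ) else 0
  else 0

/-- `μ` is the law of the binomial random graph `G(n,p)`. -/
def IsGnp (μ : PMF (SimpleGraph (Fin n))) (p : ℝ) : Prop :=
  ∀ G, μ G = ENNReal.ofReal (p ^ edgeCount G * (1 - p) ^ (n.choose 2 - edgeCount G))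

/-- `μ` is the law of `G(n,p)`, where `p` is truncated to `[0,1]` (so that `G(n,p)` is the
empty graph for `p ≤ 0` and the complete graph for `p ≥ 1`). -/
def IsGnpLaw (μ : PMF (SimpleGraph (Fin n))) (p : ℝ) : Prop :=
  IsGnp μ (max 0 (min p 1))

/-- `μ` is the law of `K + E`, where `E` includes each pair not in `E(K)` independently with
probability `p`. -/
def IsAddGnp (μ : PMF (SimpleGraph (Fin n))) (K : SimpleGraph (Fin n)) (p : ℝ) : Prop :=
  ∀ F, μ F = if K ≤ F then
      ENNReal.ofReal (p ^ (edgeCount F - edgeCount K) * (1 - p) ^ (n.choose 2 - edgeCount F))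
    else 0

/-- `ν` is the joint law of `(K, F)` where `K ~ G_d(n)` is a uniformly random `d`-regular graph
and `F = K + E`, `E` including each pair not in `E(K)` independently with probability `p`. -/
def IsRegAddGnp (ν : PMF (SimpleGraph (Fin n) × SimpleGraph (Fin n))) (d : ℕ) (p : ℝ) : Prop :=
  ∀ w, ν w = if IsRegularGraph w.1 d ∧ w.1 ≤ w.2 then
      ({G : SimpleGraph (Fin n) | IsRegularGraph G d}.ncard : ℝ≥0∞)⁻¹ *
        ENNReal.ofReal (p ^ (edgeCount w.2 - edgeCount w.1) *
          (1 - p) ^ (n.choose 2 - edgeCount w.2))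
    else 0

/-- `ν` is the joint law of an independent pair `(K, F)` with `K ~ G_d(n)` and `F ~ G(n,q)`. -/
def IsRegIndepGnp (ν : PMF (SimpleGraph (Fin n) × SimpleGraph (Fin n))) (d : ℕ) (q : ℝ) :
    Prop :=
  ∀ w, ν w = (if IsRegularGraph w.1 d then
      ({G : SimpleGraph (Fin n) | IsRegularGraph G d}.ncard : ℝ≥0∞)⁻¹ else 0) *
      ENNReal.ofReal (q ^ edgeCount w.2 * (1 - q) ^ (n.choose 2 - edgeCount w.2))

set_option linter.unusedSectionVars false

section OperatorNorm

open scoped Matrix.Norms.L2Operator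
open Matrix

variable {V : Type*} [Fintype V] [DecidableEq V]

lemma sum_sq_mulVec_le (M : Matrix V V ℝ) (x : V → ℝ) :
    ∑ i, (M *ᵥ x) i ^ 2 ≤ ‖M‖ ^ 2 * ∑ i, x i ^ 2 := by
  have h := Matrix.l2_opNorm_mulVec M (WithLp.toLp 2 x)
  have h2 := pow_le_pow_left₀ (norm_nonneg _) h 2
  rw [mul_pow, EuclideanSpace.real_norm_sq_eq, EuclideanSpace.real_norm_sq_eq] at h2
  simpa using h2

lemma l2_opNorm_le_of_sum_sq (M : Matrix V V ℝ) {c : ℝ} (hc : 0 ≤ c)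
    (h : ∀ x : V → ℝ, ∑ i, (M *ᵥ x) i ^ 2 ≤ c ^ 2 * ∑ i, x i ^ 2) : ‖M‖ ≤ c := by
  rw [Matrix.cstar_norm_def]
  refine ContinuousLinearMap.opNorm_le_bound _ hc fun x => ?_
  refine le_of_sq_le_sq ?_ (by positivity)
  rw [mul_pow, EuclideanSpace.real_norm_sq_eq, EuclideanSpace.real_norm_sq_eq]
  simpa using h x

lemma abs_entry_le_l2_opNorm (M : Matrix V V ℝ) (i j : V) : |M i j| ≤ ‖M‖ := by
  have h := sum_sq_mulVec_le M (Pi.single j 1)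
  have h1 : ∑ l, (Pi.single j (1 : ℝ) : V → ℝ) l ^ 2 = 1 := by
    rw [Finset.sum_eq_single j] <;> simp +contextual
  rw [h1, mul_one] at h
  have h2 : M i j ^ 2 ≤ ∑ l, (M *ᵥ Pi.single j 1) l ^ 2 := by
    have := Finset.single_le_sum (f := fun l => (M *ᵥ Pi.single j 1) l ^ 2)
      (fun l _ => sq_nonneg _) (Finset.mem_univ i)
    simpa using this
  exact abs_le_of_sq_le_sq (h2.trans h) (norm_nonneg _)

lemma l2_opNorm_sq_le_frobenius (M : Matrix V V ℝ) : ‖M‖ ^ 2 ≤ ∑ i, ∑ j, M i j ^ 2 := by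
  have h0 : 0 ≤ ∑ i, ∑ j, M i j ^ 2 := by positivity
  have : ‖M‖ ≤ Real.sqrt (∑ i, ∑ j, M i j ^ 2) := by
    refine l2_opNorm_le_of_sum_sq M (Real.sqrt_nonneg _) fun x => ?_
    rw [Real.sq_sqrt h0, Finset.sum_mul]
    refine Finset.sum_le_sum fun i _ => ?_
    exact Finset.sum_mul_sq_le_sq_mul_sq _ _ _
  calc ‖M‖ ^ 2 ≤ Real.sqrt (∑ i, ∑ j, M i j ^ 2) ^ 2 := pow_le_pow_left₀ (norm_nonneg _) this 2
    _ = _ := Real.sq_sqrt h0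

lemma isSelfAdjoint_of_isSymm {M : Matrix V V ℝ} (hM : M.IsSymm) : IsSelfAdjoint M := by
  rw [IsSelfAdjoint, Matrix.star_eq_conjTranspose, Matrix.conjTranspose_eq_transpose_of_trivial]
  exact hM

lemma l2_opNorm_pow_le_trace {M : Matrix V V ℝ} (hM : M.IsSymm) (j : ℕ) :
    ‖M‖ ^ (2 * 2 ^ j) ≤ (M ^ (2 * 2 ^ j)).trace := by
  have h := l2_opNorm_sq_le_frobenius (M ^ 2 ^ j)
  rw [(isSelfAdjoint_of_isSymm hM).norm_pow_two_pow j] at h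
  have hs : (M ^ 2 ^ j).IsSymm := hM.pow _
  calc ‖M‖ ^ (2 * 2 ^ j) = (‖M‖ ^ 2 ^ j) ^ 2 := by rw [← pow_mul, mul_comm]
    _ ≤ _ := h
    _ = _ := by
      rw [two_mul, pow_add, Matrix.trace]
      refine Finset.sum_congr rfl fun i _ => ?_
      rw [Matrix.diag_apply, Matrix.mul_apply]
      refine Finset.sum_congr rfl fun l _ => ?_
      rw [hs.apply i l, sq]

lemma l2_opNorm_le_of_sum_le {M : Matrix V V ℝ} (h0 : ∀ i j, 0 ≤ M i j) {c : ℝ} (hc : 0 ≤ c)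
    (hr : ∀ i, ∑ j, M i j ≤ c) (hl : ∀ j, ∑ i, M i j ≤ c) : ‖M‖ ≤ c := by
  refine l2_opNorm_le_of_sum_sq M hc fun x => ?_
  have key : ∀ i, (M *ᵥ x) i ^ 2 ≤ c * ∑ j, M i j * x j ^ 2 := fun i => by
    have h1 := Finset.sum_mul_sq_le_sq_mul_sq Finset.univ (fun j => Real.sqrt (M i j))
      (fun j => Real.sqrt (M i j) * x j)
    have e1 : ∀ j, Real.sqrt (M i j) * (Real.sqrt (M i j) * x j) = M i j * x j := fun j => by
      rw [← mul_assoc, Real.mul_self_sqrt (h0 i j)]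
    simp only [e1, mul_pow, Real.sq_sqrt (h0 i _)] at h1
    refine le_trans h1 ?_
    exact mul_le_mul_of_nonneg_right (hr i)
      (Finset.sum_nonneg fun j _ => mul_nonneg (h0 i j) (sq_nonneg _))
  calc ∑ i, (M *ᵥ x) i ^ 2 ≤ ∑ i, c * ∑ j, M i j * x j ^ 2 := Finset.sum_le_sum fun i _ => key i
    _ = c * ∑ j, (∑ i, M i j) * x j ^ 2 := by
      rw [← Finset.mul_sum, Finset.sum_comm]; simp only [Finset.sum_mul]
    _ ≤ c * ∑ j, c * x j ^ 2 := by
      refine mul_le_mul_of_nonneg_left (Finset.sum_le_sum fun j _ => ?_) hc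
      exact mul_le_mul_of_nonneg_right (hl j) (sq_nonneg _)
    _ = c ^ 2 * ∑ i, x i ^ 2 := by rw [← Finset.mul_sum]; ring

/-- A bilinear form that is small on all pairs of indicator vectors is small on the unit cube. -/
lemma abs_bilin_le_of_cut {M : Matrix V V ℝ} {t : ℝ}
    (h : ∀ U W : Finset V, |∑ u ∈ U, ∑ w ∈ W, M u w| ≤ t) (f g : V → ℝ)
    (hf : ∀ v, |f v| ≤ 1) (hg : ∀ v, |g v| ≤ 1) : |∑ u, ∑ w, f u * M u w * g w| ≤ 4 * t := by
  have aux : ∀ (s : ℝ) (φ f : V → ℝ), (∀ v, |f v| ≤ 1) →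
      (∀ U : Finset V, |∑ u ∈ U, φ u| ≤ s) → |∑ u, f u * φ u| ≤ 2 * s := by
    intro s φ f hf hs
    have h1 : |∑ u, f u * φ u| ≤ ∑ u, |φ u| := by
      refine (Finset.abs_sum_le_sum_abs _ _).trans (Finset.sum_le_sum fun u _ => ?_)
      rw [abs_mul]
      exact mul_le_of_le_one_left (abs_nonneg _) (hf u)
    have h2 : ∑ u, |φ u| = ∑ u with 0 ≤ φ u, φ u - ∑ u with ¬ 0 ≤ φ u, φ u := by
      rw [← Finset.sum_filter_add_sum_filter_not Finset.univ (fun u => 0 ≤ φ u), sub_eq_add_neg,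
        ← Finset.sum_neg_distrib]
      congr 1
      · exact Finset.sum_congr rfl fun u hu => abs_of_nonneg (Finset.mem_filter.1 hu).2
      · exact Finset.sum_congr rfl fun u hu =>
          abs_of_neg (not_le.1 (Finset.mem_filter.1 hu).2)
    have h3 := abs_le.1 (hs (Finset.univ.filter fun u => 0 ≤ φ u))
    have h4 := abs_le.1 (hs (Finset.univ.filter fun u => ¬ 0 ≤ φ u))
    linarith [h3.2, h4.1]
  have h1 : ∀ U : Finset V, |∑ u ∈ U, ∑ w, M u w * g w| ≤ 2 * t := fun U => by
    have := aux t (fun w => ∑ u ∈ U, M u w) g hg (fun W => by rw [Finset.sum_comm]; exact h U W)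
    rw [Finset.sum_comm]
    convert this using 3 with w
    rw [Finset.mul_sum]
    exact Finset.sum_congr rfl fun u _ => mul_comm _ _
  have := aux (2 * t) (fun u => ∑ w, M u w * g w) f hf h1
  simp only [Finset.mul_sum, ← mul_assoc] at this ⊢
  linarith

lemma l2_opNorm_pow_four_le_of_cut {M : Matrix V V ℝ} (hM : M.IsSymm) (h1 : ∀ i j, |M i j| ≤ 1)
    {t : ℝ} (h : ∀ U W : Finset V, |∑ u ∈ U, ∑ w ∈ W, M u w| ≤ t) :
    ‖M‖ ^ 4 ≤ (Fintype.card V : ℝ) ^ 2 * (4 * t) := by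
  have h2 := l2_opNorm_pow_le_trace hM 1
  norm_num at h2
  refine h2.trans ?_
  have e : (M ^ 4).trace = ∑ j, ∑ l, M j l * ∑ i, ∑ k, M j i * M i k * M k l := by
    rw [show M ^ 4 = M * M * M * M by noncomm_ring, Matrix.trace]
    refine Finset.sum_congr rfl fun j _ => ?_
    rw [Matrix.diag_apply, Matrix.mul_apply]
    refine Finset.sum_congr rfl fun l _ => ?_
    rw [hM.apply j l, mul_comm, Matrix.mul_apply]
    congr 1
    simp only [Matrix.mul_apply, Finset.sum_mul]
    rw [Finset.sum_comm]
  rw [e]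
  calc ∑ j, ∑ l, M j l * ∑ i, ∑ k, M j i * M i k * M k l ≤ ∑ j : V, ∑ l : V, 4 * t := by
        refine Finset.sum_le_sum fun j _ => Finset.sum_le_sum fun l _ => ?_
        refine (le_abs_self _).trans ?_
        rw [abs_mul]
        refine (mul_le_of_le_one_left (abs_nonneg _) (h1 j l)).trans ?_
        exact abs_bilin_le_of_cut h (fun i => M j i) (fun k => M k l) (fun i => h1 _ _)
          (fun k => h1 _ _)
    _ = _ := by simp; ring

/-- Powers of a nonnegative matrix that is nearly doubly stochastic and close in operator norm to
the averaging matrix have nearly uniform entries. -/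
lemma abs_pow_entry_sub_le {N : Matrix V V ℝ} {θ : ℝ} (hθ : θ ≤ 1)
    (h0 : ∀ i j, 0 ≤ N i j) (hr : ∀ i, |∑ j, N i j - 1| ≤ θ) (hl : ∀ j, |∑ i, N i j - 1| ≤ θ)
    (hS : ‖N - Matrix.of fun _ _ => (Fintype.card V : ℝ)⁻¹‖ ≤ θ) (k : ℕ) (hk : 1 ≤ k)
    (hkθ : θ ^ k ≤ θ / Fintype.card V) (x y : V) :
    |(N ^ k) x y - (Fintype.card V : ℝ)⁻¹| ≤ (k * 8 ^ k * θ) / Fintype.card V := by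
  set n : ℝ := (Fintype.card V : ℝ) with hn
  have hnpos : 0 < n := by
    rw [hn]; exact_mod_cast Fintype.card_pos_iff.2 ⟨x⟩
  set P : Matrix V V ℝ := Matrix.of fun _ _ => n⁻¹ with hP
  set S := N - P with hSdef
  have hθ0 : 0 ≤ θ := (norm_nonneg _).trans hS
  have hNPS : N = P + S := by rw [hSdef]; abel
  have expand : ∀ k : ℕ, N ^ k = ∑ i ∈ Finset.range k, S ^ i * (P * N ^ (k - 1 - i)) + S ^ k := by
    intro k
    induction k with
    | zero => simp
    | succ k ih =>
      have e : N ^ (k + 1) = P * N ^ k + S * N ^ k := by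
        rw [pow_succ', ← add_mul, ← hNPS]
      rw [e]
      conv_lhs => rw [add_comm]; arg 1; rw [ih]
      rw [Finset.sum_range_succ', mul_add, Finset.mul_sum, pow_succ' S k]
      simp only [pow_zero, one_mul, Nat.add_sub_cancel, Nat.sub_zero]
      rw [add_right_comm]
      congr 2
      refine Finset.sum_congr rfl fun i hi => ?_
      rw [pow_succ', mul_assoc]
      congr 4
      omega
  have colsum : ∀ m : ℕ, ∀ y, |∑ i, (N ^ m) i y - 1| ≤ m * 2 ^ m * θ ∧ 0 ≤ ∑ i, (N ^ m) i y ∧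
      ∑ i, (N ^ m) i y ≤ 2 ^ m := by
    intro m
    induction m with
    | zero => intro y; simp [Matrix.one_apply]
    | succ m ih =>
      intro y
      have e : ∑ i, (N ^ (m + 1)) i y = ∑ j, (∑ i, (N ^ m) i j) * N j y := by
        simp only [pow_succ, Matrix.mul_apply, Finset.sum_mul]
        rw [Finset.sum_comm]
      have hsum0 : 0 ≤ ∑ i, N i y := Finset.sum_nonneg fun i _ => h0 i y
      have hsum2 : ∑ i, N i y ≤ 2 := by linarith [(abs_le.1 (hl y)).2]
      refine ⟨?_, ?_, ?_⟩
      · have e2 : ∑ i, (N ^ (m + 1)) i y - 1 =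
            ∑ j, (∑ i, (N ^ m) i j - 1) * N j y + (∑ j, N j y - 1) := by
          rw [e]; simp only [sub_mul, Finset.sum_sub_distrib, one_mul]; ring
        rw [e2]
        have h1 : |∑ j, (∑ i, (N ^ m) i j - 1) * N j y| ≤ m * 2 ^ m * θ * 2 := by
          refine (Finset.abs_sum_le_sum_abs _ _).trans ?_
          calc ∑ j, |(∑ i, (N ^ m) i j - 1) * N j y| ≤ ∑ j, m * 2 ^ m * θ * N j y := by
                refine Finset.sum_le_sum fun j _ => ?_
                rw [abs_mul, abs_of_nonneg (h0 j y)]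
                exact mul_le_mul_of_nonneg_right (ih j).1 (h0 j y)
            _ = m * 2 ^ m * θ * ∑ j, N j y := by rw [Finset.mul_sum]
            _ ≤ _ := mul_le_mul_of_nonneg_left hsum2 (by positivity)
        refine (abs_add_le _ _).trans ?_
        have h3 := hl y
        have h4 : θ ≤ 2 ^ (m + 1) * θ := le_mul_of_one_le_left hθ0 (one_le_pow₀ (by norm_num))
        push_cast
        calc _ ≤ m * 2 ^ m * θ * 2 + 2 ^ (m + 1) * θ := by linarith
          _ = _ := by ring
      · rw [e]
        exact Finset.sum_nonneg fun j _ => mul_nonneg (ih j).2.1 (h0 j y)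
      · rw [e]
        calc ∑ j, (∑ i, (N ^ m) i j) * N j y ≤ ∑ j, 2 ^ m * N j y :=
              Finset.sum_le_sum fun j _ => mul_le_mul_of_nonneg_right (ih j).2.2 (h0 j y)
          _ = 2 ^ m * ∑ j, N j y := by rw [Finset.mul_sum]
          _ ≤ 2 ^ m * 2 := mul_le_mul_of_nonneg_left hsum2 (by positivity)
          _ = _ := by ring
  have hP1 : ∀ i, ∑ j, P i j = 1 := fun i => by
    simp only [hP, Matrix.of_apply, Finset.sum_const, Finset.card_univ, nsmul_eq_mul]
    rw [← hn]; field_simp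
  have rowS : ∀ m : ℕ, ∀ x, |∑ j, (S ^ (m + 1)) x j| ≤ 3 ^ m * θ := by
    intro m
    induction m with
    | zero =>
      intro x
      have : ∑ j, (S ^ (0 + 1)) x j = ∑ j, N x j - 1 := by
        simp [hSdef, Matrix.sub_apply, Finset.sum_sub_distrib, hP1]
      rw [this]; simpa using hr x
    | succ m ih =>
      intro x
      have e : ∑ j, (S ^ (m + 1 + 1)) x j = ∑ l, S x l * ∑ j, (S ^ (m + 1)) l j := by
        simp only [pow_succ' S (m + 1), Matrix.mul_apply, Finset.mul_sum]
        rw [Finset.sum_comm]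
      rw [e]
      have hSabs : ∑ l, |S x l| ≤ 3 := by
        calc ∑ l, |S x l| ≤ ∑ l, (N x l + P x l) := by
              refine Finset.sum_le_sum fun l _ => ?_
              rw [hSdef, Matrix.sub_apply]
              have : 0 ≤ P x l := by simp only [hP, Matrix.of_apply]; positivity
              rw [abs_le]; constructor <;> linarith [h0 x l]
          _ = ∑ l, N x l + 1 := by rw [Finset.sum_add_distrib, hP1]
          _ ≤ 3 := by linarith [(abs_le.1 (hr x)).2]
      calc |∑ l, S x l * ∑ j, (S ^ (m + 1)) l j| ≤ ∑ l, |S x l| * (3 ^ m * θ) := by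
            refine (Finset.abs_sum_le_sum_abs _ _).trans (Finset.sum_le_sum fun l _ => ?_)
            rw [abs_mul]
            exact mul_le_mul_of_nonneg_left (ih l) (abs_nonneg _)
        _ = (∑ l, |S x l|) * (3 ^ m * θ) := by rw [Finset.sum_mul]
        _ ≤ 3 * (3 ^ m * θ) := mul_le_mul_of_nonneg_right hSabs (by positivity)
        _ = _ := by ring
  have entryP : ∀ (T Q : Matrix V V ℝ), (T * (P * Q)) x y =
      (∑ j, T x j) * (n⁻¹ * ∑ i, Q i y) := by
    intro T Q
    rw [Matrix.mul_apply, Finset.sum_mul]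
    refine Finset.sum_congr rfl fun j _ => ?_
    congr 1
    rw [Matrix.mul_apply, Finset.mul_sum]
    rfl
  obtain ⟨k, rfl⟩ : ∃ j, k = j + 1 := ⟨k - 1, by omega⟩
  have hSk : |(S ^ (k + 1)) x y| ≤ θ / n := by
    refine (abs_entry_le_l2_opNorm _ _ _).trans (le_trans ?_ hkθ)
    refine (norm_pow_le' _ (by omega)).trans (pow_le_pow_left₀ (norm_nonneg _) hS _)
  rw [expand (k + 1), Matrix.add_apply, Finset.sum_range_succ', Matrix.add_apply, Matrix.sum_apply]
  rw [entryP (S ^ 0)]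
  have hone : ∑ j, (S ^ 0) x j = 1 := by simp [Matrix.one_apply]
  rw [hone, one_mul]
  have hA : |∑ i ∈ Finset.range k, (S ^ (i + 1) * (P * N ^ (k + 1 - 1 - (i + 1)))) x y| ≤
      k * (6 ^ k * θ / n) := by
    refine (Finset.abs_sum_le_sum_abs _ _).trans ?_
    rw [show (k : ℝ) * (6 ^ k * θ / n) = ∑ i ∈ Finset.range k, (6 ^ k * θ / n) by simp]
    refine Finset.sum_le_sum fun i hi => ?_
    have hik : i < k := Finset.mem_range.1 hi
    rw [entryP, abs_mul, abs_mul, abs_of_nonneg (colsum _ y).2.1, abs_of_pos (inv_pos.2 hnpos)]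
    have c1 : ∑ j, (N ^ (k + 1 - 1 - (i + 1))) j y ≤ 2 ^ k :=
      (colsum _ y).2.2.trans (pow_le_pow_right₀ (by norm_num) (by omega))
    have c2 : |∑ j, (S ^ (i + 1)) x j| ≤ 3 ^ k * θ :=
      (rowS i x).trans (mul_le_mul_of_nonneg_right
        (pow_le_pow_right₀ (by norm_num) hik.le) hθ0)
    calc _ ≤ (3 ^ k * θ) * (n⁻¹ * 2 ^ k) := by gcongr; exact mul_nonneg (by positivity) (colsum _ y).2.1
      _ = _ := by rw [show (6 : ℝ) = 3 * 2 by norm_num, mul_pow]; ring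
  have hB : |n⁻¹ * ∑ i, (N ^ (k + 1 - 1 - 0)) i y - n⁻¹| ≤ k * 2 ^ k * θ / n := by
    rw [← mul_sub_one, abs_mul, abs_of_pos (inv_pos.2 hnpos)]
    have := (colsum (k + 1 - 1 - 0) y).1
    simp only [Nat.add_sub_cancel, Nat.sub_zero] at this ⊢
    calc _ ≤ n⁻¹ * (k * 2 ^ k * θ) := by gcongr
      _ = _ := by ring
  have fin : k * (6 ^ k * θ / n) + k * 2 ^ k * θ / n + θ / n ≤
      ((k + 1 : ℕ) : ℝ) * 8 ^ (k + 1) * θ / n := by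
    rw [show k * (6 ^ k * θ / n) + k * 2 ^ k * θ / n + θ / n =
      (k * 6 ^ k + k * 2 ^ k + 1) * θ / n by ring]
    have a1 : (6 : ℝ) ^ k ≤ 8 ^ k := pow_le_pow_left₀ (by norm_num) (by norm_num) _
    have a2 : (2 : ℝ) ^ k ≤ 8 ^ k := pow_le_pow_left₀ (by norm_num) (by norm_num) _
    have a3 : (1 : ℝ) ≤ 8 ^ k := one_le_pow₀ (by norm_num)
    gcongr
    push_cast
    rw [pow_succ]
    nlinarith [mul_le_mul_of_nonneg_left a1 (Nat.cast_nonneg (α := ℝ) k),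
      mul_le_mul_of_nonneg_left a2 (Nat.cast_nonneg (α := ℝ) k),
      mul_nonneg (Nat.cast_nonneg (α := ℝ) k) (by positivity : (0 : ℝ) ≤ 8 ^ k)]
  refine le_trans ?_ fin
  rw [abs_le] at hA hB hSk ⊢
  constructor <;> linarith [hA.1, hA.2, hB.1, hB.2, hSk.1, hSk.2]

end OperatorNorm

section Walks

open Matrix

variable {V : Type*} [Fintype V] [DecidableEq V]

/-- The product `B 0 * B 1 * ⋯ * B (m - 1)`. -/
def walkProd (B : ℕ → Matrix V V ℝ) : ℕ → Matrix V V ℝ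
  | 0 => 1
  | m + 1 => walkProd B m * B m

lemma walkProd_add (B : ℕ → Matrix V V ℝ) (a b : ℕ) :
    walkProd B (a + b) = walkProd B a * walkProd (fun i => B (a + i)) b := by
  induction b with
  | zero => simp [walkProd]
  | succ b ih => rw [← add_assoc, walkProd, ih, mul_assoc, ← walkProd]

lemma walkProd_congr {B C : ℕ → Matrix V V ℝ} {m : ℕ} (h : ∀ i < m, B i = C i) :
    walkProd B m = walkProd C m := by
  induction m with
  | zero => rfl
  | succ m ih => rw [walkProd, walkProd, ih fun i hi => h i (by omega), h m (by omega)]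

lemma walkProd_head {B C : ℕ → Matrix V V ℝ} {D : Matrix V V ℝ} {m : ℕ} (hm : 1 ≤ m)
    (h0 : C 0 = D * B 0) (h : ∀ i, 1 ≤ i → i < m → C i = B i) :
    walkProd C m = D * walkProd B m := by
  obtain ⟨r, rfl⟩ : ∃ r, m = 1 + r := ⟨m - 1, by omega⟩
  have h1 : walkProd (fun i => C (1 + i)) r = walkProd (fun i => B (1 + i)) r :=
    walkProd_congr fun i hi => h _ (by omega) (by omega)
  have h2 : walkProd C 1 = D * walkProd B 1 := by simp [walkProd, h0]
  rw [walkProd_add, walkProd_add, h1, h2, mul_assoc]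

lemma walkProd_apply (B : ℕ → Matrix V V ℝ) (m : ℕ) (x y : V) :
    walkProd B m x y = ∑ w : Fin (m + 1) → V, if w 0 = x ∧ w (Fin.last m) = y then
      ∏ i : Fin m, B i (w i.castSucc) (w i.succ) else 0 := by
  induction m generalizing y with
  | zero =>
    rw [walkProd, Matrix.one_apply, Fintype.sum_equiv (Equiv.funUnique (Fin 1) V) _
      (fun v => if v = x ∧ v = y then 1 else 0) (fun w => by simp)]
    by_cases h : x = y
    · subst h; simp
    · rw [if_neg h]; symm
      exact Finset.sum_eq_zero fun v _ => if_neg fun hv => h (hv.1.symm.trans hv.2)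
  | succ m ih =>
    rw [← Equiv.sum_comp (Fin.snocEquiv fun _ => V), Fintype.sum_prod_type]
    have e : ∀ v : V, ∑ w : Fin (m + 1) → V,
        (if (Fin.snocEquiv fun _ => V) (v, w) 0 = x ∧
            (Fin.snocEquiv fun _ => V) (v, w) (Fin.last (m + 1)) = y then
          ∏ i : Fin (m + 1), B i ((Fin.snocEquiv fun _ => V) (v, w) i.castSucc)
            ((Fin.snocEquiv fun _ => V) (v, w) i.succ) else 0) =
        if v = y then ∑ w : Fin (m + 1) → V, (if w 0 = x then
          (∏ i : Fin m, B i (w i.castSucc) (w i.succ)) * B m (w (Fin.last m)) y else 0) else 0 := by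
      intro v
      by_cases hv : v = y
      · rw [if_pos hv]
        refine Finset.sum_congr rfl fun w _ => ?_
        have h0 : (Fin.snoc w v : Fin (m + 2) → V) 0 = w 0 :=
          Fin.snoc_castSucc (α := fun _ => V) v w 0
        have hs : ∀ i : Fin m, (Fin.snoc w v : Fin (m + 2) → V) i.castSucc.succ = w i.succ :=
          fun i => Fin.snoc_castSucc (α := fun _ => V) v w i.succ
        simp only [Fin.snocEquiv_apply, Fin.prod_univ_castSucc, Fin.snoc_last, hv,
          Fin.snoc_castSucc, and_true, Fin.succ_last, Fin.val_castSucc, Fin.val_last]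
        subst hv
        simp [hs]
      · rw [if_neg hv]
        refine Finset.sum_eq_zero fun w _ => if_neg fun h => hv ?_
        simpa using h.2
    rw [Finset.sum_congr rfl fun v _ => e v, Finset.sum_ite_eq' Finset.univ y,
      if_pos (Finset.mem_univ y), walkProd, Matrix.mul_apply]
    simp only [ih, Finset.sum_mul]
    rw [Finset.sum_comm]
    refine Finset.sum_congr rfl fun w _ => ?_
    rw [Finset.sum_eq_single (w (Fin.last m))]
    · by_cases h : w 0 = x <;> simp [h]
    · intro u _ hu
      rw [if_neg fun h => hu h.2.symm, zero_mul]
    · simp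

/-- Step matrices that are nonnegative, with row and column sums at most `2` and entries at
most `κ`. -/
structure BoundedSteps (B : ℕ → Matrix V V ℝ) (κ : ℝ) : Prop where
  nonneg : ∀ i u v, 0 ≤ B i u v
  row : ∀ i u, ∑ v, B i u v ≤ 2
  col : ∀ i v, ∑ u, B i u v ≤ 2
  entry : ∀ i u v, B i u v ≤ κ

namespace BoundedSteps

variable {B : ℕ → Matrix V V ℝ} {κ : ℝ}

lemma shift (h : BoundedSteps B κ) (a : ℕ) : BoundedSteps (fun i => B (a + i)) κ :=
  ⟨fun _ => h.nonneg _, fun _ => h.row _, fun _ => h.col _, fun _ => h.entry _⟩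

lemma walk_nonneg (h : BoundedSteps B κ) (m : ℕ) (u v : V) : 0 ≤ walkProd B m u v := by
  induction m generalizing v with
  | zero => rw [walkProd, Matrix.one_apply]; split_ifs <;> norm_num
  | succ m ih =>
    rw [walkProd, Matrix.mul_apply]
    exact Finset.sum_nonneg fun w _ => mul_nonneg (ih w) (h.nonneg _ _ _)

lemma walk_row (h : BoundedSteps B κ) (m : ℕ) (u : V) : ∑ v, walkProd B m u v ≤ 2 ^ m := by
  induction m with
  | zero => simp [walkProd, Matrix.one_apply]
  | succ m ih =>
    simp only [walkProd, Matrix.mul_apply]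
    rw [Finset.sum_comm]
    simp only [← Finset.mul_sum]
    calc ∑ w, walkProd B m u w * ∑ v, B m w v ≤ ∑ w, walkProd B m u w * 2 :=
          Finset.sum_le_sum fun w _ => mul_le_mul_of_nonneg_left (h.row _ _) (h.walk_nonneg _ _ _)
      _ = (∑ w, walkProd B m u w) * 2 := by rw [Finset.sum_mul]
      _ ≤ _ := by rw [pow_succ]; linarith

lemma walk_col (h : BoundedSteps B κ) (m : ℕ) (v : V) : ∑ u, walkProd B m u v ≤ 2 ^ m := by
  induction m generalizing v with
  | zero => simp [walkProd, Matrix.one_apply]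
  | succ m ih =>
    simp only [walkProd, Matrix.mul_apply]
    rw [Finset.sum_comm]
    simp only [← Finset.sum_mul]
    calc ∑ w, (∑ u, walkProd B m u w) * B m w v ≤ ∑ w, 2 ^ m * B m w v :=
          Finset.sum_le_sum fun w _ => mul_le_mul_of_nonneg_right (ih w) (h.nonneg _ _ _)
      _ = 2 ^ m * ∑ w, B m w v := by rw [Finset.mul_sum]
      _ ≤ 2 ^ m * 2 := mul_le_mul_of_nonneg_left (h.col _ _) (by positivity)
      _ = _ := (pow_succ _ _).symm

lemma walk_entry (h : BoundedSteps B κ) {m : ℕ} (hm : 1 ≤ m) (u v : V) :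
    walkProd B m u v ≤ 2 ^ m * κ := by
  obtain ⟨m, rfl⟩ : ∃ r, m = r + 1 := ⟨m - 1, by omega⟩
  have hκ : 0 ≤ κ := (h.nonneg 0 u v).trans (h.entry 0 u v)
  rw [walkProd, Matrix.mul_apply]
  calc ∑ w, walkProd B m u w * B m w v ≤ ∑ w, walkProd B m u w * κ :=
        Finset.sum_le_sum fun w _ => mul_le_mul_of_nonneg_left (h.entry _ _ _) (h.walk_nonneg _ _ _)
    _ = (∑ w, walkProd B m u w) * κ := by rw [Finset.sum_mul]
    _ ≤ 2 ^ m * κ := mul_le_mul_of_nonneg_right (h.walk_row m u) hκ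
    _ ≤ 2 ^ (m + 1) * κ := by rw [pow_succ]; nlinarith [pow_pos (two_pos : (0 : ℝ) < 2) m]

/-- A bound for walks of one fixed length and parity propagates to all longer walks. -/
lemma walk_entry_of_middle (h : BoundedSteps B κ) {a r b : ℕ} {G : ℝ} (hG : 0 ≤ G)
    (hr : ∀ u v, walkProd (fun i => B (a + i)) r u v ≤ G) (u v : V) :
    walkProd B (a + r + b) u v ≤ 2 ^ (a + b) * G := by
  have h1 : ∀ w, walkProd B (a + r) u w ≤ 2 ^ a * G := fun w => by
    rw [walkProd_add, Matrix.mul_apply]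
    calc _ ≤ ∑ z, walkProd B a u z * G :=
          Finset.sum_le_sum fun z _ => mul_le_mul_of_nonneg_left (hr _ _) (h.walk_nonneg _ _ _)
      _ = (∑ z, walkProd B a u z) * G := by rw [Finset.sum_mul]
      _ ≤ _ := mul_le_mul_of_nonneg_right (h.walk_row a u) hG
  rw [walkProd_add, Matrix.mul_apply]
  calc _ ≤ ∑ w, 2 ^ a * G * walkProd (fun i => B (a + r + i)) b w v :=
        Finset.sum_le_sum fun z _ =>
          mul_le_mul_of_nonneg_right (h1 _) ((h.shift _).walk_nonneg _ _ _)
    _ = 2 ^ a * G * ∑ w, walkProd (fun i => B (a + r + i)) b w v := by rw [Finset.mul_sum]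
    _ ≤ 2 ^ a * G * 2 ^ b :=
        mul_le_mul_of_nonneg_left ((h.shift (a + r)).walk_col b v) (by positivity)
    _ = _ := by rw [pow_add]; ring

variable {L m : ℕ} {G : ℝ}

lemma walk_through_le (h : BoundedSteps B κ) (hG0 : 0 ≤ G)
    (hG : ∀ a r, L ≤ r → r ≤ m → ∀ u v, walkProd (fun i => B (a + i)) r u v ≤ G)
    (hL : 2 * L ≤ m) {i : ℕ} (hi : 1 ≤ i) (him : i < m) (x z y : V) :
    walkProd B i x z * walkProd (fun l => B (i + l)) (m - i) z y ≤ 4 ^ m * (κ * G) := by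
  have hκ : 0 ≤ κ := (h.nonneg 0 x x).trans (h.entry 0 x x)
  have hpow : ∀ r ≤ m, (2 : ℝ) ^ r * (κ * G) ≤ 4 ^ m * (κ * G) := fun r hr =>
    mul_le_mul_of_nonneg_right
      ((pow_le_pow_right₀ (by norm_num) hr).trans (pow_le_pow_left₀ (by norm_num) (by norm_num) _))
      (by positivity)
  rcases le_or_gt L i with hLi | hLi
  · have h1 : walkProd B i x z ≤ G := by simpa using hG 0 i hLi him.le x z
    have h2 := (h.shift i).walk_entry (m := m - i) (by omega) z y
    calc _ ≤ G * (2 ^ (m - i) * κ) := mul_le_mul h1 h2 ((h.shift i).walk_nonneg _ _ _) hG0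
      _ = 2 ^ (m - i) * (κ * G) := by ring
      _ ≤ _ := hpow _ (by omega)
  · have h1 := h.walk_entry hi x z
    have h2 := hG i (m - i) (by omega) (by omega) z y
    calc _ ≤ (2 ^ i * κ) * G :=
          mul_le_mul h1 h2 ((h.shift i).walk_nonneg _ _ _) (by positivity)
      _ = 2 ^ i * (κ * G) := by ring
      _ ≤ _ := hpow _ (by omega)

lemma sum_walk_return_le (h : BoundedSteps B κ) (hG0 : 0 ≤ G)
    (hG : ∀ a r, L ≤ r → r ≤ m → ∀ u v, walkProd (fun i => B (a + i)) r u v ≤ G)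
    (hL : 3 * L ≤ m) {i j : ℕ} (hi : 1 ≤ i) (hij : i < j) (hjm : j < m) (x y : V) :
    ∑ v, walkProd B i x v * (walkProd (fun l => B (i + l)) (j - i) v v *
      walkProd (fun l => B (j + l)) (m - j) v y) ≤ 4 ^ m * (κ * G) := by
  have hκ : 0 ≤ κ := (h.nonneg 0 x x).trans (h.entry 0 x x)
  have n1 := h.walk_nonneg i x
  have n2 := (h.shift i).walk_nonneg (j - i)
  have n3 := fun v => (h.shift j).walk_nonneg (m - j) v y
  have e1 := h.walk_entry hi x
  have e2 := (h.shift i).walk_entry (m := j - i) (by omega)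
  have hpow : ∀ r ≤ m, (2 : ℝ) ^ r * (κ * G) ≤ 4 ^ m * (κ * G) := fun r hr =>
    mul_le_mul_of_nonneg_right
      ((pow_le_pow_right₀ (by norm_num) hr).trans (pow_le_pow_left₀ (by norm_num) (by norm_num) _))
      (by positivity)
  have s3 := (h.shift j).walk_col (m - j) y
  have s1 := h.walk_row i x
  by_cases hLi : L ≤ i
  · have g1 : ∀ v, walkProd B i x v ≤ G := fun v => by simpa using hG 0 i hLi (by omega) x v
    calc _ ≤ ∑ v, G * ((2 ^ (j - i) * κ) * walkProd (fun l => B (j + l)) (m - j) v y) := by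
          refine Finset.sum_le_sum fun v _ => ?_
          exact mul_le_mul (g1 v) (mul_le_mul_of_nonneg_right (e2 v v) (n3 v))
            (mul_nonneg (n2 v v) (n3 v)) hG0
      _ = G * ((2 ^ (j - i) * κ) * ∑ v, walkProd (fun l => B (j + l)) (m - j) v y) := by
          rw [← Finset.mul_sum, ← Finset.mul_sum]
      _ ≤ G * ((2 ^ (j - i) * κ) * 2 ^ (m - j)) := by gcongr
      _ = 2 ^ (j - i + (m - j)) * (κ * G) := by rw [pow_add]; ring
      _ ≤ _ := hpow _ (by omega)
  by_cases hLj : L ≤ j - i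
  · have g2 := hG i (j - i) hLj (by omega)
    calc _ ≤ ∑ v, (2 ^ i * κ) * (G * walkProd (fun l => B (j + l)) (m - j) v y) := by
          refine Finset.sum_le_sum fun v _ => ?_
          exact mul_le_mul (e1 v) (mul_le_mul_of_nonneg_right (g2 v v) (n3 v))
            (mul_nonneg (n2 v v) (n3 v)) (by positivity)
      _ = (2 ^ i * κ) * (G * ∑ v, walkProd (fun l => B (j + l)) (m - j) v y) := by
          rw [← Finset.mul_sum, ← Finset.mul_sum]
      _ ≤ (2 ^ i * κ) * (G * 2 ^ (m - j)) := by gcongr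
      _ = 2 ^ (i + (m - j)) * (κ * G) := by rw [pow_add]; ring
      _ ≤ _ := hpow _ (by omega)
  · have g3 := fun v => hG j (m - j) (by omega) (by omega) v y
    calc _ ≤ ∑ v, walkProd B i x v * ((2 ^ (j - i) * κ) * G) := by
          refine Finset.sum_le_sum fun v _ => ?_
          refine mul_le_mul_of_nonneg_left ?_ (n1 v)
          exact mul_le_mul (e2 v v) (g3 v) (n3 v) (by positivity)
      _ = (∑ v, walkProd B i x v) * ((2 ^ (j - i) * κ) * G) := by rw [Finset.sum_mul]
      _ ≤ 2 ^ i * ((2 ^ (j - i) * κ) * G) := by gcongr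
      _ = 2 ^ (i + (j - i)) * (κ * G) := by rw [pow_add]; ring
      _ ≤ _ := hpow _ (by omega)

end BoundedSteps

/-- Summing over walks with vertex weights. -/
lemma walkProd_diagonal_apply (B : ℕ → Matrix V V ℝ) (φ : ℕ → V → ℝ) (m : ℕ) (x y : V) :
    walkProd (fun l => diagonal (φ l) * B l) m x y =
      ∑ w : Fin (m + 1) → V, if w 0 = x ∧ w (Fin.last m) = y then
        (∏ i : Fin m, φ i (w i.castSucc)) * ∏ i : Fin m, B i (w i.castSucc) (w i.succ) else 0 := by
  rw [walkProd_apply]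
  refine Finset.sum_congr rfl fun w _ => ?_
  simp only [Matrix.diagonal_mul, Finset.prod_mul_distrib]

lemma sum_walks_through (B : ℕ → Matrix V V ℝ) {m : ℕ} (i : Fin m) (x y : V) (T : Finset V) :
    (∑ w : Fin (m + 1) → V, if w 0 = x ∧ w (Fin.last m) = y then
        (if w i.castSucc ∈ T then 1 else 0) * ∏ l : Fin m, B l (w l.castSucc) (w l.succ) else 0) =
      ∑ z ∈ T, walkProd B i x z * walkProd (fun l => B (i + l)) (m - i) z y := by
  set φ : ℕ → V → ℝ := fun l u => if l = i then (if u ∈ T then 1 else 0) else 1 with hφ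
  have h1 := walkProd_diagonal_apply B φ m x y
  have h2 : ∀ w : Fin (m + 1) → V, ∏ l : Fin m, φ l (w l.castSucc) =
      if w i.castSucc ∈ T then 1 else 0 := fun w => by
    rw [Finset.prod_eq_single i]
    · simp [hφ]
    · intro l _ hl
      have : (l : ℕ) ≠ i := fun h => hl (Fin.ext h)
      simp [hφ, this]
    · simp
  simp only [h2] at h1
  rw [← h1]
  have h3 : walkProd (fun l => diagonal (φ l) * B l) (i + (m - i)) =
      walkProd B i * (diagonal (φ i) * walkProd (fun l => B (i + l)) (m - i)) := by
    rw [walkProd_add]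
    congr 1
    · refine walkProd_congr fun l hl => ?_
      have : φ l = fun _ => 1 := by ext u; simp [hφ, hl.ne]
      rw [this, diagonal_one, one_mul]
    · refine walkProd_head (by omega) rfl fun l hl _ => ?_
      have : φ (i + l) = fun _ => 1 := by ext u; simp [hφ]; omega
      rw [this, diagonal_one, one_mul]
  rw [show (i : ℕ) + (m - i) = m by omega] at h3
  rw [h3, Matrix.mul_apply]
  simp only [Matrix.diagonal_mul]
  rw [← Finset.sum_filter_add_sum_filter_not Finset.univ (fun z => z ∈ T),
    Finset.filter_mem_eq_inter, Finset.univ_inter]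
  rw [Finset.sum_eq_zero (s := Finset.univ.filter fun z => z ∉ T), add_zero]
  · refine Finset.sum_congr rfl fun z hz => ?_
    simp [hφ, hz]
  · intro z hz
    have := (Finset.mem_filter.1 hz).2
    simp [hφ, this]

lemma sum_walks_return (B : ℕ → Matrix V V ℝ) {m : ℕ} (i j : Fin m) (hij : i < j) (x y : V) :
    (∑ w : Fin (m + 1) → V, if w 0 = x ∧ w (Fin.last m) = y then
        (if w i.castSucc = w j.castSucc then 1 else 0) *
          ∏ l : Fin m, B l (w l.castSucc) (w l.succ) else 0) =
      ∑ v, walkProd B i x v * (walkProd (fun l => B (i + l)) (j - i) v v *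
        walkProd (fun l => B (j + l)) (m - j) v y) := by
  have hij' : (i : ℕ) < j := hij
  have hjm : (j : ℕ) < m := j.2
  set φ : V → ℕ → V → ℝ := fun v l u => if l = i ∨ l = j then (if u = v then 1 else 0) else 1
    with hφ
  have h2 : ∀ v, ∀ w : Fin (m + 1) → V, ∏ l : Fin m, φ v l (w l.castSucc) =
      if w i.castSucc = v ∧ w j.castSucc = v then 1 else 0 := fun v w => by
    rw [Finset.prod_eq_mul i j hij.ne]
    · by_cases h1 : w i.castSucc = v <;> by_cases h2 : w j.castSucc = v <;> simp [hφ, h1, h2]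
    · intro l _ hl
      have h1 : (l : ℕ) ≠ i := fun h => hl.1 (Fin.ext h)
      have h2 : (l : ℕ) ≠ j := fun h => hl.2 (Fin.ext h)
      simp [hφ, h1, h2]
    · simp
    · simp
  have h3 : ∀ v, walkProd (fun l => diagonal (φ v l) * B l) (i + (j - i) + (m - j)) =
      walkProd B i * (diagonal (φ v i) * walkProd (fun l => B (i + l)) (j - i)) *
        (diagonal (φ v j) * walkProd (fun l => B (j + l)) (m - j)) := fun v => by
    have triv : ∀ l : ℕ, l ≠ i → l ≠ j → diagonal (φ v l) * B l = B l := fun l h1 h2 => by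
      have : φ v l = fun _ => 1 := by ext u; simp [hφ, h1, h2]
      rw [this, diagonal_one, one_mul]
    have ej : (i : ℕ) + (j - i) = j := by omega
    rw [walkProd_add, walkProd_add, ej]
    congr 1
    · congr 1
      · exact walkProd_congr fun l hl => triv l (by omega) (by omega)
      · exact walkProd_head (by omega) rfl fun l hl _ => triv _ (by omega) (by omega)
    · exact walkProd_head (by omega) rfl fun l hl _ => triv _ (by omega) (by omega)
  rw [show (i : ℕ) + (j - i) + (m - j) = m by omega] at h3
  have h4 : ∀ v, walkProd (fun l => diagonal (φ v l) * B l) m x y =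
      walkProd B i x v * (walkProd (fun l => B (i + l)) (j - i) v v *
        walkProd (fun l => B (j + l)) (m - j) v y) := fun v => by
    rw [h3, Matrix.mul_apply, Finset.sum_eq_single v]
    · rw [Matrix.mul_apply, Finset.sum_eq_single v]
      · simp [Matrix.diagonal_mul, hφ, mul_assoc]
      · intro u _ hu
        simp [Matrix.diagonal_mul, hφ, hu]
      · simp
    · intro u _ hu
      simp [Matrix.diagonal_mul, hφ, hu]
    · simp
  rw [← Finset.sum_congr rfl fun v _ => h4 v]
  simp only [walkProd_diagonal_apply, h2]
  rw [Finset.sum_comm]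
  refine Finset.sum_congr rfl fun w _ => ?_
  by_cases h : w 0 = x ∧ w (Fin.last m) = y
  · simp only [if_pos h]
    rw [← Finset.sum_mul]
    congr 1
    by_cases he : w i.castSucc = w j.castSucc
    · rw [if_pos he, Finset.sum_eq_single (w j.castSucc)]
      · simp [he]
      · intro v _ hv
        exact if_neg fun h => hv h.2.symm
      · simp
    · rw [if_neg he]
      exact (Finset.sum_eq_zero fun v _ => if_neg fun h => he (h.1.trans h.2.symm)).symm
  · simp [if_neg h]

/-- The weighted number of `x,y`-walks of length `m` that repeat a vertex or meet `Z` internally. -/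
lemma BoundedSteps.walk_sub_path_le {B : ℕ → Matrix V V ℝ} {κ : ℝ} (h : BoundedSteps B κ)
    {L m : ℕ} {G : ℝ} (hG0 : 0 ≤ G)
    (hG : ∀ a r, L ≤ r → r ≤ m → ∀ u v, walkProd (fun i => B (a + i)) r u v ≤ G)
    (hL : 3 * L ≤ m) {x y : V} (hxy : x ≠ y) (Z : Finset V) :
    walkProd B m x y - (∑ w : Fin (m + 1) → V, if w 0 = x ∧ w (Fin.last m) = y then
        (if Function.Injective w ∧ ∀ i, i ≠ 0 → i ≠ Fin.last m → w i ∉ Z then 1 else 0) *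
          ∏ l : Fin m, B l (w l.castSucc) (w l.succ) else 0) ≤
      (m * (Z.card + 2) + m * m) * (4 ^ m * (κ * G)) := by
  set T : Finset V := insert x (insert y Z) with hT
  have hTcard : (T.card : ℝ) ≤ Z.card + 2 := by
    have h1 := Finset.card_insert_le x (insert y Z)
    have h2 := Finset.card_insert_le y Z
    have : T.card ≤ Z.card + 2 := by rw [hT]; omega
    exact_mod_cast this
  have hc : 0 ≤ 4 ^ m * (κ * G) := by
    have hκ : 0 ≤ κ := (h.nonneg 0 x x).trans (h.entry 0 x x)
    positivity
  set Q : (Fin (m + 1) → V) → ℝ := fun w => ∏ l : Fin m, B l (w l.castSucc) (w l.succ) with hQ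
  have hQ0 : ∀ w, 0 ≤ Q w := fun w => Finset.prod_nonneg fun l _ => h.nonneg _ _ _
  have hmain : walkProd B m x y - (∑ w : Fin (m + 1) → V, if w 0 = x ∧ w (Fin.last m) = y then
        (if Function.Injective w ∧ ∀ i, i ≠ 0 → i ≠ Fin.last m → w i ∉ Z then 1 else 0) *
          Q w else 0) ≤
      ∑ i : Fin m, (if (0 : ℕ) < i then ∑ w : Fin (m + 1) → V,
        (if w 0 = x ∧ w (Fin.last m) = y then
          (if w i.castSucc ∈ T then 1 else 0) * Q w else 0) else 0) +
      ∑ i : Fin m, ∑ j : Fin m, (if (0 : ℕ) < i ∧ i < j then ∑ w : Fin (m + 1) → V,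
        (if w 0 = x ∧ w (Fin.last m) = y then
          (if w i.castSucc = w j.castSucc then 1 else 0) * Q w else 0) else 0) := by
    have ex1 : ∀ (p : Prop) [Decidable p] (f : (Fin (m + 1) → V) → ℝ),
        (if p then ∑ w, f w else 0) = ∑ w, if p then f w else 0 := fun p _ f => by
      split_ifs <;> simp
    rw [walkProd_apply, ← Finset.sum_sub_distrib]
    simp only [ex1]
    rw [Finset.sum_comm]
    have ex2 : ∀ f : Fin m → Fin m → (Fin (m + 1) → V) → ℝ,
        ∑ i, ∑ j, ∑ w, f i j w = ∑ w, ∑ i, ∑ j, f i j w := fun f => by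
      rw [Finset.sum_comm' (t' := Finset.univ) (s' := fun _ => Finset.univ) (by simp)]
      rw [Finset.sum_congr rfl fun j _ => Finset.sum_comm, Finset.sum_comm]
      exact Finset.sum_congr rfl fun w _ => Finset.sum_comm
    rw [ex2, ← Finset.sum_add_distrib]
    refine Finset.sum_le_sum fun w _ => ?_
    have t1 : ∀ i : Fin m, 0 ≤ (if (0 : ℕ) < i then (if w 0 = x ∧ w (Fin.last m) = y then
          (if w i.castSucc ∈ T then (1 : ℝ) else 0) * Q w else 0) else 0) := fun i => by
      have := hQ0 w
      split_ifs <;> simp [this]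
    have t2 : ∀ i j : Fin m, 0 ≤ (if (0 : ℕ) < i ∧ i < j then
        (if w 0 = x ∧ w (Fin.last m) = y then
          (if w i.castSucc = w j.castSucc then (1 : ℝ) else 0) * Q w else 0) else 0) :=
      fun i j => by
        have := hQ0 w
        split_ifs <;> simp [this]
    have t1' := Finset.sum_nonneg fun i (_ : i ∈ Finset.univ) => t1 i
    have t2' := Finset.sum_nonneg fun i (_ : i ∈ Finset.univ) =>
      Finset.sum_nonneg fun j (_ : j ∈ Finset.univ) => t2 i j
    by_cases hw : w 0 = x ∧ w (Fin.last m) = y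
    swap
    · rw [if_neg hw, if_neg hw, sub_zero]
      linarith
    by_cases hg : Function.Injective w ∧ ∀ i, i ≠ 0 → i ≠ Fin.last m → w i ∉ Z
    · rw [if_pos hw, if_pos hw, if_pos hg, one_mul]
      linarith
    rw [if_pos hw, if_pos hw, if_neg hg, zero_mul, sub_zero]
    have hex : (∃ i : Fin m, (0 : ℕ) < i ∧ w i.castSucc ∈ T) ∨
        ∃ i j : Fin m, ((0 : ℕ) < i ∧ i < j) ∧ w i.castSucc = w j.castSucc := by
      by_contra hcon
      push Not at hcon
      obtain ⟨c1, c2⟩ := hcon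
      have c1' : ∀ i : Fin (m + 1), i ≠ 0 → i ≠ Fin.last m → w i ∉ T := fun i h0 hl => by
        have hlt : (i : ℕ) < m := by
          have := i.2
          have : (i : ℕ) ≠ m := fun h => hl (Fin.ext h)
          omega
        have h0' : 0 < (i : ℕ) := Nat.pos_of_ne_zero fun h => h0 (Fin.ext h)
        exact c1 ⟨i, hlt⟩ h0'
      refine hg ⟨?_, fun i h0 hl hz => c1' i h0 hl (by simp [hT, hz])⟩
      have main : ∀ i j : Fin (m + 1), i < j → w i ≠ w j := by
        intro i j hij he
        have hij' : (i : ℕ) < j := hij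
        by_cases h0 : i = 0
        · by_cases hl : j = Fin.last m
          · rw [h0, hl, hw.1, hw.2] at he
            exact hxy he
          · refine c1' j (fun h => ?_) hl ?_
            · rw [h] at hij'; simp at hij'
            · rw [← he, h0, hw.1]; simp [hT]
        · by_cases hl : j = Fin.last m
          · refine c1' i h0 (fun h => ?_) ?_
            · rw [h, hl] at hij'; simp at hij'
            · rw [he, hl, hw.2]; simp [hT]
          · have hlt : (j : ℕ) < m := by
              have := j.2
              have : (j : ℕ) ≠ m := fun h => hl (Fin.ext h)
              omega
            have h0' : 0 < (i : ℕ) := Nat.pos_of_ne_zero fun h => h0 (Fin.ext h)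
            exact c2 ⟨i, by omega⟩ ⟨j, hlt⟩ ⟨h0', hij'⟩ he
      intro i j he
      rcases lt_trichotomy i j with h | h | h
      · exact absurd he (main i j h)
      · exact h
      · exact absurd he.symm (main j i h)
    rcases hex with ⟨i, h0, hi⟩ | ⟨i, j, hij, he⟩
    · have := Finset.single_le_sum (fun i _ => t1 i) (Finset.mem_univ i)
      rw [if_pos h0, if_pos hw, if_pos hi, one_mul] at this
      linarith
    · have h1 := Finset.single_le_sum (fun j _ => t2 i j) (Finset.mem_univ j)
      have h2 := Finset.single_le_sum
        (fun i _ => Finset.sum_nonneg fun j (_ : j ∈ Finset.univ) => t2 i j) (Finset.mem_univ i)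
      rw [if_pos hij, if_pos hw, if_pos he, one_mul] at h1
      linarith
  refine hmain.trans ?_
  rw [add_mul]
  refine add_le_add ?_ ?_
  · calc _ ≤ ∑ i : Fin m, (T.card : ℝ) * (4 ^ m * (κ * G)) := by
          refine Finset.sum_le_sum fun i _ => ?_
          split_ifs with h0
          · rw [sum_walks_through B i x y T, ← nsmul_eq_mul]
            exact Finset.sum_le_card_nsmul _ _ _ fun z _ =>
              h.walk_through_le hG0 hG (by omega) h0 i.2 x z y
          · positivity
      _ = m * T.card * (4 ^ m * (κ * G)) := by simp; ring
      _ ≤ _ := by gcongr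
  · calc _ ≤ ∑ i : Fin m, ∑ j : Fin m, (4 ^ m * (κ * G)) := by
          refine Finset.sum_le_sum fun i _ => Finset.sum_le_sum fun j _ => ?_
          split_ifs with h0
          · rw [sum_walks_return B i j h0.2 x y]
            exact h.sum_walk_return_le hG0 hG hL h0.1 h0.2 j.2 x y
          · exact hc
      _ = _ := by simp; ring

end Walks

section RandomSubset

variable {ι : Type*} [DecidableEq ι]

/-- Expectation of `f t` when `t` contains each element of `s` independently with
probability `p`. -/
def bernExp (s : Finset ι) (p : ℝ) (f : Finset ι → ℝ) : ℝ :=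
  ∑ t ∈ s.powerset, p ^ t.card * (1 - p) ^ (s.card - t.card) * f t

/-- Probability of `Q t` when `t` contains each element of `s` independently with
probability `p`. -/
def bernProb (s : Finset ι) (p : ℝ) (Q : Finset ι → Prop) : ℝ :=
  bernExp s p fun t => if Q t then 1 else 0

variable {s : Finset ι} {p : ℝ}

lemma bernExp_prod (s : Finset ι) (p : ℝ) (a b : ι → ℝ) :
    bernExp s p (fun t => ∏ e ∈ s, if e ∈ t then a e else b e) =
      ∏ e ∈ s, (p * a e + (1 - p) * b e) := by
  rw [Finset.prod_add, bernExp]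
  refine Finset.sum_congr rfl fun t ht => ?_
  have hts := Finset.mem_powerset.1 ht
  rw [Finset.prod_mul_distrib, Finset.prod_mul_distrib, Finset.prod_const, Finset.prod_const,
    Finset.card_sdiff_of_subset hts, ← Finset.prod_sdiff hts]
  have h1 : ∏ e ∈ s \ t, (if e ∈ t then a e else b e) = ∏ e ∈ s \ t, b e :=
    Finset.prod_congr rfl fun e he => if_neg (Finset.mem_sdiff.1 he).2
  have h2 : ∏ e ∈ t, (if e ∈ t then a e else b e) = ∏ e ∈ t, a e :=
    Finset.prod_congr rfl fun e he => if_pos he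
  rw [h1, h2]; ring

lemma bernExp_const (s : Finset ι) (p c : ℝ) : bernExp s p (fun _ => c) = c := by
  rw [bernExp, ← Finset.sum_mul, Finset.sum_pow_mul_eq_add_pow]; simp

lemma bernExp_sum {κ : Type*} (I : Finset κ) (f : κ → Finset ι → ℝ) :
    bernExp s p (fun t => ∑ i ∈ I, f i t) = ∑ i ∈ I, bernExp s p (f i) := by
  simp only [bernExp, Finset.mul_sum]
  rw [Finset.sum_comm]

lemma bernExp_mono (h0 : 0 ≤ p) (h1 : p ≤ 1) {f g : Finset ι → ℝ} (h : ∀ t ⊆ s, f t ≤ g t) :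
    bernExp s p f ≤ bernExp s p g := by
  have h1' : 0 ≤ 1 - p := by linarith
  exact Finset.sum_le_sum fun t ht =>
    mul_le_mul_of_nonneg_left (h t (Finset.mem_powerset.1 ht)) (by positivity)

lemma bernProb_le_bernExp (h0 : 0 ≤ p) (h1 : p ≤ 1) {Q : Finset ι → Prop} {f : Finset ι → ℝ}
    (hf : ∀ t ⊆ s, 0 ≤ f t) (hQ : ∀ t ⊆ s, Q t → 1 ≤ f t) : bernProb s p Q ≤ bernExp s p f :=
  bernExp_mono h0 h1 fun t ht => by
    split_ifs with h
    · exact hQ t ht h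
    · exact hf t ht

lemma bernProb_nonneg (h0 : 0 ≤ p) (h1 : p ≤ 1) (Q : Finset ι → Prop) : 0 ≤ bernProb s p Q := by
  rw [← bernExp_const s p 0]
  exact bernExp_mono h0 h1 fun t _ => by split_ifs <;> norm_num

lemma bernProb_le_one (h0 : 0 ≤ p) (h1 : p ≤ 1) (Q : Finset ι → Prop) : bernProb s p Q ≤ 1 := by
  rw [← bernExp_const s p 1]
  exact bernExp_mono h0 h1 fun t _ => by split_ifs <;> norm_num

lemma bernProb_mono (h0 : 0 ≤ p) (h1 : p ≤ 1) {Q R : Finset ι → Prop}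
    (h : ∀ t ⊆ s, Q t → R t) : bernProb s p Q ≤ bernProb s p R :=
  bernProb_le_bernExp h0 h1 (fun t _ => by split_ifs <;> norm_num)
    fun t ht hQ => by rw [if_pos (h t ht hQ)]

lemma bernProb_or_le (h0 : 0 ≤ p) (h1 : p ≤ 1) (Q R : Finset ι → Prop) :
    bernProb s p (fun t => Q t ∨ R t) ≤ bernProb s p Q + bernProb s p R := by
  have e : bernProb s p Q + bernProb s p R =
      bernExp s p fun t => (if Q t then 1 else 0) + if R t then 1 else 0 := by
    simp only [bernProb, bernExp, mul_add, Finset.sum_add_distrib]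
  rw [e]
  refine bernProb_le_bernExp h0 h1 (fun t _ => by split_ifs <;> norm_num) fun t _ h => ?_
  rcases h with h | h <;> rw [if_pos h] <;> split_ifs <;> norm_num

lemma bernProb_exists_le (h0 : 0 ≤ p) (h1 : p ≤ 1) {κ : Type*} [Fintype κ]
    (Q : κ → Finset ι → Prop) :
    bernProb s p (fun t => ∃ i, Q i t) ≤ ∑ i, bernProb s p (Q i) := by
  simp only [bernProb]
  rw [← bernExp_sum]
  refine bernProb_le_bernExp h0 h1
    (fun t _ => Finset.sum_nonneg fun i _ => by split_ifs <;> norm_num) fun t _ h => ?_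
  obtain ⟨i, hi⟩ := h
  have := Finset.single_le_sum (f := fun i => if Q i t then (1 : ℝ) else 0)
    (fun i _ => by split_ifs <;> norm_num) (Finset.mem_univ i)
  simpa [hi] using this

lemma bernProb_not (Q : Finset ι → Prop) :
    bernProb s p (fun t => ¬ Q t) = 1 - bernProb s p Q := by
  have e : bernProb s p (fun t => ¬ Q t) + bernProb s p Q = bernExp s p fun _ => 1 := by
    simp only [bernProb, bernExp, ← Finset.sum_add_distrib, ← mul_add]
    refine Finset.sum_congr rfl fun t _ => ?_
    by_cases h : Q t <;> simp [h]
  rw [bernExp_const] at e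
  linarith

lemma exp_bern_le (h0 : 0 ≤ p) {x : ℝ} (hx : |x| ≤ 1) :
    p * Real.exp (x * (1 - p)) + (1 - p) * Real.exp (x * (0 - p)) ≤ Real.exp (p * x ^ 2) := by
  have h1 := (abs_le.1 (Real.abs_exp_sub_one_sub_id_le hx)).2
  have e : p * Real.exp (x * (1 - p)) + (1 - p) * Real.exp (x * (0 - p)) =
      Real.exp (-(x * p)) * (1 + p * (Real.exp x - 1)) := by
    rw [show x * (1 - p) = -(x * p) + x by ring, Real.exp_add, show x * (0 - p) = -(x * p) by ring]
    ring
  rw [e]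
  calc _ ≤ Real.exp (-(x * p)) * (1 + p * (x + x ^ 2)) := by gcongr; linarith
    _ ≤ Real.exp (-(x * p)) * Real.exp (p * (x + x ^ 2)) := by
      gcongr; linarith [Real.add_one_le_exp (p * (x + x ^ 2))]
    _ = _ := by rw [← Real.exp_add]; ring_nf

lemma bernExp_exp_le (h0 : 0 ≤ p) (h1 : p ≤ 1) {a : ι → ℝ} (ha : ∀ e ∈ s, |a e| ≤ 1) :
    bernExp s p (fun t => Real.exp (∑ e ∈ s, a e * ((if e ∈ t then 1 else 0) - p))) ≤
      Real.exp (p * ∑ e ∈ s, a e ^ 2) := by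
  have e : ∀ t : Finset ι, Real.exp (∑ e ∈ s, a e * ((if e ∈ t then 1 else 0) - p)) =
      ∏ e ∈ s, if e ∈ t then Real.exp (a e * (1 - p)) else Real.exp (a e * (0 - p)) := fun t => by
    rw [Real.exp_sum]
    exact Finset.prod_congr rfl fun e _ => by split_ifs <;> rfl
  simp only [e]
  rw [bernExp_prod, Finset.mul_sum, Real.exp_sum]
  have h1' : 0 ≤ 1 - p := by linarith
  exact Finset.prod_le_prod (fun e _ => by positivity) fun e he => exp_bern_le h0 (ha e he)

lemma chernoff (h0 : 0 ≤ p) (h1 : p ≤ 1) (a : ι → ℝ) {l : ℝ} (ha : ∀ e ∈ s, |l * a e| ≤ 1)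
    (hl : 0 ≤ l) (T : ℝ) :
    bernProb s p (fun t => T ≤ |∑ e ∈ s, a e * ((if e ∈ t then 1 else 0) - p)|) ≤
      2 * Real.exp (-(l * T) + l ^ 2 * (p * ∑ e ∈ s, a e ^ 2)) := by
  have key : ∀ σ : ℝ, |σ| = 1 →
      bernProb s p (fun t => T ≤ σ * ∑ e ∈ s, a e * ((if e ∈ t then 1 else 0) - p)) ≤
        Real.exp (-(l * T) + l ^ 2 * (p * ∑ e ∈ s, a e ^ 2)) := by
    intro σ hσ
    have hb := bernExp_exp_le h0 h1 (s := s) (a := fun e => σ * (l * a e)) fun e he => by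
      rw [abs_mul, hσ, one_mul]; exact ha e he
    have e2 : p * ∑ e ∈ s, (σ * (l * a e)) ^ 2 = l ^ 2 * (p * ∑ e ∈ s, a e ^ 2) := by
      have : σ ^ 2 = 1 := by rw [← sq_abs, hσ]; norm_num
      simp only [mul_pow, this, one_mul, ← Finset.mul_sum]; ring
    rw [e2] at hb
    rw [Real.exp_add]
    refine le_trans ?_ (mul_le_mul_of_nonneg_left hb (Real.exp_pos _).le)
    rw [show Real.exp (-(l * T)) * bernExp s p (fun t => Real.exp (∑ e ∈ s, σ * (l * a e) *
        ((if e ∈ t then 1 else 0) - p))) = bernExp s p (fun t => Real.exp (-(l * T)) *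
        Real.exp (∑ e ∈ s, σ * (l * a e) * ((if e ∈ t then 1 else 0) - p))) by
      simp only [bernExp, Finset.mul_sum]
      exact Finset.sum_congr rfl fun t _ => by ring]
    refine bernProb_le_bernExp h0 h1 (fun t _ => by positivity) fun t _ ht => ?_
    rw [← Real.exp_add]
    refine Real.one_le_exp ?_
    have := mul_le_mul_of_nonneg_left ht hl
    have e3 : ∑ e ∈ s, σ * (l * a e) * ((if e ∈ t then 1 else 0) - p) =
        l * (σ * ∑ e ∈ s, a e * ((if e ∈ t then 1 else 0) - p)) := by
      simp only [Finset.mul_sum]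
      exact Finset.sum_congr rfl fun e _ => by ring
    linarith
  have k1 := key 1 (by norm_num)
  have k2 := key (-1) (by norm_num)
  rw [two_mul]
  refine le_trans ?_ (add_le_add k1 k2)
  refine le_trans (bernProb_mono h0 h1 fun t _ ht => ?_) (bernProb_or_le h0 h1 _ _)
  rw [one_mul, neg_one_mul]
  exact le_abs.1 ht

end RandomSubset

section TraceMoment

open Matrix

variable {V : Type*} [DecidableEq V]

lemma card_image_range_le (w : ℕ → V) (m : ℕ) :
    ((Finset.range (m + 1)).image w).card ≤
      ((Finset.range m).image fun i => s(w i, w (i + 1))).card + 1 := by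
  induction m with
  | zero => simp
  | succ m ih =>
    have e1 : (Finset.range (m + 1 + 1)).image w =
        insert (w (m + 1)) ((Finset.range (m + 1)).image w) := by
      rw [Finset.range_add_one (n := m + 1), Finset.image_insert]
    have e2 : ((Finset.range (m + 1)).image fun i => s(w i, w (i + 1))) =
        insert s(w m, w (m + 1)) ((Finset.range m).image fun i => s(w i, w (i + 1))) := by
      rw [Finset.range_add_one (n := m), Finset.image_insert]
    rw [e1, e2]
    by_cases h : w (m + 1) ∈ (Finset.range (m + 1)).image w
    · rw [Finset.insert_eq_of_mem h]
      exact ih.trans (Nat.succ_le_succ (Finset.card_le_card (Finset.subset_insert _ _)))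
    · rw [Finset.card_insert_of_notMem h, Finset.card_insert_of_notMem]
      · omega
      · intro hmem
        obtain ⟨i, hi, he⟩ := Finset.mem_image.1 hmem
        have hi' := Finset.mem_range.1 hi
        have hm : w (m + 1) ∈ s(w i, w (i + 1)) := he ▸ Sym2.mem_mk_right _ _
        rcases Sym2.mem_iff.1 hm with h1 | h1
        · exact h (Finset.mem_image.2 ⟨i, Finset.mem_range.2 (by omega), h1.symm⟩)
        · exact h (Finset.mem_image.2 ⟨i + 1, Finset.mem_range.2 (by omega), h1.symm⟩)

lemma card_image_walk_le {m : ℕ} (w : Fin (m + 1) → V) :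
    (Finset.univ.image w).card ≤
      (Finset.univ.image fun i : Fin m => s(w i.castSucc, w i.succ)).card + 1 := by
  have h := card_image_range_le (fun i => w (Fin.ofNat (m + 1) i)) m
  have e1 : (Finset.range (m + 1)).image (fun i => w (Fin.ofNat (m + 1) i)) =
      Finset.univ.image w := by
    ext v
    simp only [Finset.mem_image, Finset.mem_range, Finset.mem_univ, true_and]
    constructor
    · rintro ⟨i, _, rfl⟩; exact ⟨_, rfl⟩
    · rintro ⟨i, rfl⟩; exact ⟨i, i.2, by simp⟩
  have e2 : (Finset.range m).image (fun i => s(w (Fin.ofNat (m + 1) i), w (Fin.ofNat (m + 1) (i + 1))))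
      = Finset.univ.image fun i : Fin m => s(w i.castSucc, w i.succ) := by
    have c1 : ∀ i : Fin m, Fin.ofNat (m + 1) (i : ℕ) = i.castSucc := fun i =>
      Fin.ext (by simp)
    have c2 : ∀ i : Fin m, Fin.ofNat (m + 1) ((i : ℕ) + 1) = i.succ := fun i =>
      Fin.ext (by simp [Nat.mod_eq_of_lt (show (i : ℕ) + 1 < m + 1 by omega)])
    ext v
    simp only [Finset.mem_image, Finset.mem_range, Finset.mem_univ, true_and]
    constructor
    · rintro ⟨i, hi, rfl⟩
      refine ⟨⟨i, hi⟩, ?_⟩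
      rw [← c1 ⟨i, hi⟩, ← c2 ⟨i, hi⟩]
    · rintro ⟨i, rfl⟩
      exact ⟨i, i.2, by rw [c1, c2]⟩
  rw [e1, e2] at h
  exact h

/-- The centred adjacency matrix of the graph with edge set `t`, viewed as a random subset of `s`
with density `p`. -/
def devMatrix (s : Finset (Sym2 V)) (p : ℝ) (t : Finset (Sym2 V)) : Matrix V V ℝ :=
  Matrix.of fun u v => if s(u, v) ∈ s then (if s(u, v) ∈ t then 1 else 0) - p else 0

lemma devMatrix_isSymm (s : Finset (Sym2 V)) (p : ℝ) (t : Finset (Sym2 V)) :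
    (devMatrix s p t).IsSymm := by
  ext u v
  simp only [devMatrix, Matrix.transpose_apply, Matrix.of_apply, Sym2.eq_swap]

lemma abs_bern_moment_le {p : ℝ} (h0 : 0 ≤ p) (h1 : p ≤ 1) {c : ℕ} (hc : 2 ≤ c) :
    |p * (1 - p) ^ c + (1 - p) * (0 - p) ^ c| ≤ p := by
  have hq : 0 ≤ 1 - p := by linarith
  have a1 : (1 - p) ^ c ≤ (1 - p) ^ 2 := pow_le_pow_of_le_one hq (by linarith) hc
  have a2 : p ^ c ≤ p ^ 2 := pow_le_pow_of_le_one h0 h1 hc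
  refine (abs_add_le _ _).trans ?_
  rw [abs_mul, abs_mul, abs_pow, abs_pow, abs_of_nonneg h0, abs_of_nonneg hq, zero_sub, abs_neg,
    abs_of_nonneg h0]
  nlinarith [mul_le_mul_of_nonneg_left a1 h0, mul_le_mul_of_nonneg_left a2 hq, sq_nonneg p]

lemma bernExp_walk_le {s : Finset (Sym2 V)} {p : ℝ} (h0 : 0 ≤ p) (h1 : p ≤ 1) {m : ℕ}
    (w : Fin (m + 1) → V) :
    bernExp s p (fun t => ∏ i : Fin m, devMatrix s p t (w i.castSucc) (w i.succ)) ≤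
      if 2 * ((Finset.univ.image w).card - 1) ≤ m then p ^ ((Finset.univ.image w).card - 1)
        else 0 := by
  have hrhs : 0 ≤ if 2 * ((Finset.univ.image w).card - 1) ≤ m then
      p ^ ((Finset.univ.image w).card - 1) else 0 := by split_ifs <;> positivity
  set ed : Fin m → Sym2 V := fun i => s(w i.castSucc, w i.succ) with hed
  have hcard := card_image_walk_le w
  by_cases hs : ∀ i, ed i ∈ s
  swap
  · push Not at hs
    obtain ⟨i, hi⟩ := hs
    have : ∀ t, ∏ i : Fin m, devMatrix s p t (w i.castSucc) (w i.succ) = 0 := fun t =>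
      Finset.prod_eq_zero (Finset.mem_univ i) (if_neg hi)
    simp only [this, bernExp_const]
    exact hrhs
  set c : Sym2 V → ℕ := fun e => (Finset.univ.filter fun i => ed i = e).card with hc
  set g : ℕ → ℝ := fun c => p * (1 - p) ^ c + (1 - p) * (0 - p) ^ c with hg
  have e1 : ∀ t, ∏ i : Fin m, devMatrix s p t (w i.castSucc) (w i.succ) =
      ∏ e ∈ s, if e ∈ t then (1 - p) ^ c e else (0 - p) ^ c e := fun t => by
    rw [← Finset.prod_fiberwise_of_maps_to (g := ed) (t := s) fun i _ => hs i]
    refine Finset.prod_congr rfl fun e he => ?_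
    rw [Finset.prod_congr rfl (g := fun _ => if e ∈ t then 1 - p else 0 - p), Finset.prod_const]
    · split_ifs <;> rfl
    · intro i hi
      have hi' : s(w i.castSucc, w i.succ) = e := (Finset.mem_filter.1 hi).2
      simp only [devMatrix, Matrix.of_apply, hi', he, if_true]
      split_ifs <;> rfl
  simp only [e1]
  rw [bernExp_prod]
  set I := Finset.univ.image ed with hI
  have hIs : I ⊆ s := fun e he => by
    obtain ⟨i, _, rfl⟩ := Finset.mem_image.1 he
    exact hs i
  have e2 : ∏ e ∈ s, g (c e) = ∏ e ∈ I, g (c e) := by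
    refine (Finset.prod_subset hIs fun e _ he => ?_).symm
    have : c e = 0 := by
      rw [hc]
      refine Finset.card_eq_zero.2 (Finset.filter_eq_empty_iff.2 fun i _ hi => he ?_)
      exact Finset.mem_image.2 ⟨i, Finset.mem_univ _, hi⟩
    simp [hg, this]
  change ∏ e ∈ s, g (c e) ≤ _
  rw [e2]
  by_cases hone : ∃ e ∈ I, c e = 1
  · obtain ⟨e, he, hce⟩ := hone
    rw [Finset.prod_eq_zero he (by simp only [hg, hce]; ring)]
    exact hrhs
  push Not at hone
  have hc2 : ∀ e ∈ I, 2 ≤ c e := fun e he => by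
    obtain ⟨i, _, hi⟩ := Finset.mem_image.1 he
    have : 0 < c e := Finset.card_pos.2 ⟨i, Finset.mem_filter.2 ⟨Finset.mem_univ _, hi⟩⟩
    have := hone e he
    omega
  have hsum : ∑ e ∈ I, c e = m := by
    have := Finset.card_eq_sum_card_image ed (Finset.univ : Finset (Fin m))
    rw [Finset.card_univ, Fintype.card_fin] at this
    exact this.symm
  have h2I : 2 * I.card ≤ m := by
    rw [← hsum, mul_comm, ← smul_eq_mul]
    exact Finset.card_nsmul_le_sum _ _ _ hc2
  rw [if_pos (by omega)]
  calc ∏ e ∈ I, g (c e) ≤ |∏ e ∈ I, g (c e)| := le_abs_self _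
    _ = ∏ e ∈ I, |g (c e)| := Finset.abs_prod _ _
    _ ≤ ∏ _e ∈ I, p := Finset.prod_le_prod (fun _ _ => abs_nonneg _) fun e he =>
        abs_bern_moment_le h0 h1 (hc2 e he)
    _ = p ^ I.card := Finset.prod_const _
    _ ≤ _ := pow_le_pow_of_le_one h0 h1 (by omega)

lemma card_walks_image_le [Fintype V] (m v : ℕ) :
    (Finset.univ.filter fun w : Fin (m + 1) → V => (Finset.univ.image w).card = v).card ≤
      Fintype.card V ^ v * v ^ (m + 1) := by
  calc _ ≤ ((Finset.powersetCard v (Finset.univ : Finset V)).biUnion fun S =>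
          Fintype.piFinset fun _ : Fin (m + 1) => S).card := by
        refine Finset.card_le_card fun w hw => ?_
        rw [Finset.mem_biUnion]
        refine ⟨Finset.univ.image w, Finset.mem_powersetCard.2
          ⟨Finset.subset_univ _, (Finset.mem_filter.1 hw).2⟩, ?_⟩
        exact Fintype.mem_piFinset.2 fun i => Finset.mem_image_of_mem _ (Finset.mem_univ i)
    _ ≤ ∑ S ∈ Finset.powersetCard v (Finset.univ : Finset V),
          (Fintype.piFinset fun _ : Fin (m + 1) => S).card := Finset.card_biUnion_le
    _ = ∑ S ∈ Finset.powersetCard v (Finset.univ : Finset V), v ^ (m + 1) := by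
        refine Finset.sum_congr rfl fun S hS => ?_
        rw [Fintype.card_piFinset_const, (Finset.mem_powersetCard.1 hS).2]
    _ = (Fintype.card V).choose v * v ^ (m + 1) := by
        rw [Finset.sum_const, Finset.card_powersetCard, Finset.card_univ, smul_eq_mul]
    _ ≤ _ := Nat.mul_le_mul_right _ (Nat.choose_le_pow _ _)

/-- Even moments of the centred adjacency matrix of a random graph. -/
lemma bernExp_trace_le [Fintype V] [Nonempty V] {s : Finset (Sym2 V)} {p : ℝ} (h0 : 0 ≤ p)
    (h1 : p ≤ 1) (hp : 1 ≤ Fintype.card V * p) (r : ℕ) :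
    bernExp s p (fun t => (devMatrix s p t ^ (2 * r)).trace) ≤
      (2 * r + 1) ^ (2 * r + 2) * (Fintype.card V * (Fintype.card V * p) ^ r) := by
  set n := Fintype.card V with hn
  have hpow : ∀ (M : Matrix V V ℝ) (m : ℕ), M ^ m = walkProd (fun _ => M) m := fun M m => by
    induction m with
    | zero => rfl
    | succ m ih => rw [pow_succ, ih, walkProd]
  have e1 : ∀ t, (devMatrix s p t ^ (2 * r)).trace = ∑ w : Fin (2 * r + 1) → V,
      if w 0 = w (Fin.last (2 * r)) then
        ∏ i : Fin (2 * r), devMatrix s p t (w i.castSucc) (w i.succ) else 0 := fun t => by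
    simp only [hpow, Matrix.trace, Matrix.diag_apply, walkProd_apply]
    rw [Finset.sum_comm]
    refine Finset.sum_congr rfl fun w _ => ?_
    rw [Finset.sum_eq_single (w 0)]
    · simp [eq_comm]
    · intro x _ hx
      exact if_neg fun h => hx h.1.symm
    · simp
  simp only [e1]
  rw [bernExp_sum]
  have e2 : ∀ w : Fin (2 * r + 1) → V, bernExp s p (fun t => if w 0 = w (Fin.last (2 * r)) then
        ∏ i : Fin (2 * r), devMatrix s p t (w i.castSucc) (w i.succ) else 0) ≤
      ∑ v ∈ Finset.range (r + 1), if (Finset.univ.image w).card = v + 1 then p ^ v else 0 := by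
    intro w
    have hrhs : (if 2 * ((Finset.univ.image w).card - 1) ≤ 2 * r then
        p ^ ((Finset.univ.image w).card - 1) else 0) ≤
        ∑ v ∈ Finset.range (r + 1), if (Finset.univ.image w).card = v + 1 then p ^ v else 0 := by
      have hpos : 0 < (Finset.univ.image w).card :=
        Finset.card_pos.2 ⟨w 0, Finset.mem_image_of_mem _ (Finset.mem_univ _)⟩
      split_ifs with h
      · have := Finset.single_le_sum
          (f := fun v => if (Finset.univ.image w).card = v + 1 then p ^ v else 0)
          (s := Finset.range (r + 1)) (fun v _ => by split_ifs <;> positivity)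
          (Finset.mem_range.2 (by omega) : (Finset.univ.image w).card - 1 ∈ Finset.range (r + 1))
        refine le_trans (le_of_eq ?_) this
        rw [if_pos (by omega)]
      · exact Finset.sum_nonneg fun v _ => by split_ifs <;> positivity
    by_cases hw : w 0 = w (Fin.last (2 * r))
    · simp only [if_pos hw]
      exact (bernExp_walk_le h0 h1 w).trans hrhs
    · simp only [if_neg hw, bernExp_const]
      exact Finset.sum_nonneg fun v _ => by split_ifs <;> positivity
  refine (Finset.sum_le_sum fun w _ => e2 w).trans ?_
  rw [Finset.sum_comm]
  have e3 : ∀ v ∈ Finset.range (r + 1), ∑ w : Fin (2 * r + 1) → V,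
      (if (Finset.univ.image w).card = v + 1 then p ^ v else 0) ≤
        (2 * r + 1) ^ (2 * r + 1) * (n * (n * p) ^ r) := by
    intro v hv
    have hv' : v ≤ r := by have := Finset.mem_range.1 hv; omega
    rw [← Finset.sum_filter, Finset.sum_const, nsmul_eq_mul]
    have hc : ((Finset.univ.filter fun w : Fin (2 * r + 1) → V =>
        (Finset.univ.image w).card = v + 1).card : ℝ) ≤ (n : ℝ) ^ (v + 1) * (v + 1) ^ (2 * r + 1) :=
      by exact_mod_cast card_walks_image_le (V := V) (2 * r) (v + 1)
    have hvr : (v : ℝ) + 1 ≤ 2 * r + 1 := by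
      have : (v : ℝ) ≤ r := by exact_mod_cast hv'
      linarith [Nat.cast_nonneg (α := ℝ) r]
    calc _ ≤ (n : ℝ) ^ (v + 1) * (v + 1) ^ (2 * r + 1) * p ^ v := by gcongr
      _ = (v + 1) ^ (2 * r + 1) * (n * (n * p) ^ v) := by rw [mul_pow]; ring
      _ ≤ _ := by gcongr
  refine (Finset.sum_le_sum e3).trans ?_
  rw [Finset.sum_const, Finset.card_range, nsmul_eq_mul]
  push_cast
  rw [pow_succ _ (2 * r + 1), mul_comm ((2 * (r : ℝ) + 1) ^ (2 * r + 1)) (2 * (r : ℝ) + 1), mul_assoc]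
  gcongr
  linarith [Nat.cast_nonneg (α := ℝ) r]

end TraceMoment

section Deviations

open Matrix

variable {V : Type*} [Fintype V] [DecidableEq V] {s : Finset (Sym2 V)} {p : ℝ}

/-- The number of ways to write `e` as `s(u, w)` with `u ∈ U` and `w ∈ W`. -/
def pairMult (U W : Finset V) (e : Sym2 V) : ℕ :=
  ((U ×ˢ W).filter fun q => s(q.1, q.2) = e).card

lemma pairMult_le_two (U W : Finset V) (e : Sym2 V) : pairMult U W e ≤ 2 := by
  induction e with
  | _ x y =>
    refine (Finset.card_le_card (t := {(x, y), (y, x)}) fun q hq => ?_).trans Finset.card_le_two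
    have h := (Finset.mem_filter.1 hq).2
    rcases Sym2.eq_iff.1 h with ⟨h1, h2⟩ | ⟨h1, h2⟩
    · simp [← h1, ← h2]
    · simp [← h1, ← h2]

lemma pairMult_singleton_le_one (u : V) (W : Finset V) (e : Sym2 V) : pairMult {u} W e ≤ 1 := by
  refine Finset.card_le_one.2 fun a ha b hb => ?_
  simp only [Finset.mem_filter, Finset.mem_product, Finset.mem_singleton] at ha hb
  have h := ha.2.trans hb.2.symm
  rw [ha.1.1, hb.1.1, Sym2.congr_right] at h
  exact Prod.ext (ha.1.1.trans hb.1.1.symm) h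

lemma sum_pairs_eq (s : Finset (Sym2 V)) (U W : Finset V) (g : Sym2 V → ℝ) :
    ∑ u ∈ U, ∑ w ∈ W, (if s(u, w) ∈ s then g s(u, w) else 0) =
      ∑ e ∈ s, (pairMult U W e : ℝ) * g e := by
  rw [← Finset.sum_product' U W fun u w => if s(u, w) ∈ s then g s(u, w) else 0,
    ← Finset.sum_filter]
  rw [← Finset.sum_fiberwise_of_maps_to (g := fun q : V × V => s(q.1, q.2)) (t := s)
    fun q hq => (Finset.mem_filter.1 hq).2]
  refine Finset.sum_congr rfl fun e he => ?_
  rw [Finset.sum_congr rfl (g := fun _ => g e) fun q hq => by rw [(Finset.mem_filter.1 hq).2],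
    Finset.sum_const, nsmul_eq_mul, pairMult, Finset.filter_filter]
  congr 3
  refine Finset.filter_congr fun q _ => ⟨fun h => h.2, fun h => ⟨h ▸ he, h⟩⟩

lemma bernProb_cut_le (h0 : 0 ≤ p) (h1 : p ≤ 1) (U W : Finset V) {l B S : ℝ} (hB0 : 0 ≤ B)
    (hB : ∀ e, (pairMult U W e : ℝ) ≤ B) (hl : 0 ≤ l) (hlB : l * B ≤ 1)
    (hS : ∑ u ∈ U, ∑ w ∈ W, (if s(u, w) ∈ s then 1 else 0 : ℝ) ≤ S) (T : ℝ) :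
    bernProb s p (fun t => T ≤ |∑ u ∈ U, ∑ w ∈ W, devMatrix s p t u w|) ≤
      2 * Real.exp (-(l * T) + l ^ 2 * (p * (B * S))) := by
  have e (t : Finset (Sym2 V)) : ∑ u ∈ U, ∑ w ∈ W, devMatrix s p t u w =
      ∑ e ∈ s, (pairMult U W e : ℝ) * ((if e ∈ t then 1 else 0) - p) :=
    sum_pairs_eq s U W fun e => (if e ∈ t then 1 else 0) - p
  simp only [e]
  refine (chernoff h0 h1 (fun e => (pairMult U W e : ℝ)) (l := l) (fun e _ => ?_) hl T).trans ?_
  · rw [abs_of_nonneg (by positivity)]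
    exact (mul_le_mul_of_nonneg_left (hB e) hl).trans hlB
  · rw [sum_pairs_eq s U W fun _ => 1] at hS
    have : ∑ e ∈ s, (pairMult U W e : ℝ) ^ 2 ≤ B * S := by
      refine le_trans ?_ (mul_le_mul_of_nonneg_left hS hB0)
      rw [Finset.mul_sum]
      refine Finset.sum_le_sum fun e _ => ?_
      rw [sq, mul_one]
      exact mul_le_mul_of_nonneg_right (hB e) (Nat.cast_nonneg _)
    gcongr

open scoped Matrix.Norms.L2Operator in
lemma bernProb_norm_le [Nonempty V] (h0 : 0 ≤ p) (h1 : p ≤ 1) (hp : 1 ≤ Fintype.card V * p)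
    (j : ℕ) {T : ℝ} (hT : 0 < T) :
    bernProb s p (fun t => T ≤ ‖devMatrix s p t‖) ≤
      (2 * 2 ^ j + 1) ^ (2 * 2 ^ j + 2) *
        (Fintype.card V * (Fintype.card V * p) ^ 2 ^ j) / T ^ (2 * 2 ^ j) := by
  have hb := bernExp_trace_le (s := s) h0 h1 hp (2 ^ j)
  push_cast at hb
  refine le_trans ?_ (div_le_div_of_nonneg_right hb (by positivity))
  have e : bernExp s p (fun t => (devMatrix s p t ^ (2 * 2 ^ j)).trace) / T ^ (2 * 2 ^ j) =
      bernExp s p (fun t => (devMatrix s p t ^ (2 * 2 ^ j)).trace / T ^ (2 * 2 ^ j)) := by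
    simp only [bernExp, Finset.sum_div]
    exact Finset.sum_congr rfl fun t _ => by ring
  rw [e]
  have hk := fun t => l2_opNorm_pow_le_trace (devMatrix_isSymm s p t) j
  refine bernProb_le_bernExp h0 h1 (fun t _ => ?_) fun t _ ht => ?_
  · exact div_nonneg ((by positivity : (0 : ℝ) ≤ ‖devMatrix s p t‖ ^ (2 * 2 ^ j)).trans (hk t))
      (by positivity)
  · rw [one_le_div (by positivity)]
    exact (pow_le_pow_left₀ hT.le ht _).trans (hk t)

open scoped Matrix.Norms.L2Operator in
lemma bernProb_norm_le_of_cut (h0 : 0 ≤ p) (h1 : p ≤ 1) {T l : ℝ} (hl : 0 ≤ l) (hl1 : l * 2 ≤ 1) :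
    bernProb s p (fun t => ¬ ‖devMatrix s p t‖ ^ 4 ≤ (Fintype.card V : ℝ) ^ 2 * (4 * T)) ≤
      4 ^ Fintype.card V *
        (2 * Real.exp (-(l * T) + l ^ 2 * (p * (2 * (Fintype.card V : ℝ) ^ 2)))) := by
  have key : ∀ t ⊆ s, ¬ ‖devMatrix s p t‖ ^ 4 ≤ (Fintype.card V : ℝ) ^ 2 * (4 * T) →
      ∃ q : Finset V × Finset V, T ≤ |∑ u ∈ q.1, ∑ w ∈ q.2, devMatrix s p t u w| := by
    intro t _ ht
    by_contra! hc
    refine ht (l2_opNorm_pow_four_le_of_cut (devMatrix_isSymm s p t) (fun i j => ?_)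
      fun U W => (hc (U, W)).le)
    simp only [devMatrix, Matrix.of_apply]
    rw [abs_le]
    split_ifs <;> constructor <;> linarith
  refine (bernProb_mono h0 h1 key).trans ((bernProb_exists_le h0 h1 _).trans ?_)
  have : ∀ q : Finset V × Finset V, bernProb s p
      (fun t => T ≤ |∑ u ∈ q.1, ∑ w ∈ q.2, devMatrix s p t u w|) ≤
      2 * Real.exp (-(l * T) + l ^ 2 * (p * (2 * (Fintype.card V : ℝ) ^ 2))) := fun q => by
    refine bernProb_cut_le h0 h1 q.1 q.2 zero_le_two (fun e => by exact_mod_cast pairMult_le_two _ _ e) hl hl1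
      ?_ T
    calc _ ≤ ∑ u ∈ q.1, ∑ w ∈ q.2, (1 : ℝ) :=
          Finset.sum_le_sum fun u _ => Finset.sum_le_sum fun w _ => by split_ifs <;> norm_num
      _ = (q.1.card : ℝ) * q.2.card := by simp
      _ ≤ (Fintype.card V : ℝ) * Fintype.card V := by
        gcongr <;> exact Finset.card_le_univ _
      _ = _ := by ring
  refine (Finset.sum_le_sum fun q _ => this q).trans (le_of_eq ?_)
  rw [Finset.sum_const, Finset.card_univ, Fintype.card_prod, Fintype.card_finset, nsmul_eq_mul]
  push_cast
  rw [← mul_pow]; norm_num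

/-- The vertices joined to `u` by a pair in `t`. -/
def nbr (t : Finset (Sym2 V)) (u : V) : Finset V := Finset.univ.filter fun w => s(u, w) ∈ t

@[simp] lemma mem_nbr {t : Finset (Sym2 V)} {u w : V} : w ∈ nbr t u ↔ s(u, w) ∈ t := by
  simp [nbr]

lemma mem_nbr_comm {t : Finset (Sym2 V)} {u w : V} : w ∈ nbr t u ↔ u ∈ nbr t w := by
  rw [mem_nbr, mem_nbr, Sym2.eq_swap]

lemma sum_devMatrix {t : Finset (Sym2 V)} (ht : t ⊆ s) (u : V) :
    ∑ v, devMatrix s p t u v = (nbr t u).card - p * (nbr s u).card := by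
  have : ∀ v, devMatrix s p t u v =
      (if s(u, v) ∈ t then 1 else 0) - p * (if s(u, v) ∈ s then 1 else 0) := fun v => by
    simp only [devMatrix, Matrix.of_apply]
    by_cases h : s(u, v) ∈ s
    · simp [h]
    · simp [h, mt (@ht _) h]
  simp only [this, Finset.sum_sub_distrib, ← Finset.mul_sum, nbr, Finset.sum_boole]

/-- Concentration of all degrees of a random graph. -/
lemma bernProb_degree_le (h0 : 0 ≤ p) (h1 : p ≤ 1) {l S T : ℝ} (hl : 0 ≤ l) (hl1 : l ≤ 1)
    (hS : ∀ u, ((nbr s u).card : ℝ) ≤ S) :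
    bernProb s p (fun t => ∃ u, T ≤ |((nbr t u).card : ℝ) - p * (nbr s u).card|) ≤
      Fintype.card V * (2 * Real.exp (-(l * T) + l ^ 2 * (p * S))) := by
  refine (bernProb_exists_le h0 h1 _).trans ?_
  rw [← nsmul_eq_mul, ← Finset.card_univ]
  refine Finset.sum_le_card_nsmul _ _ _ fun u _ => ?_
  have h := bernProb_cut_le (s := s) h0 h1 {u} Finset.univ (l := l) (B := 1) (S := S) zero_le_one
    (fun e => by exact_mod_cast pairMult_singleton_le_one u _ e) hl (by linarith)
    (by simpa [nbr] using hS u) T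
  rw [one_mul] at h
  refine (bernProb_mono h0 h1 fun t ht hT => ?_).trans h
  rw [Finset.sum_singleton, sum_devMatrix ht]
  exact hT

end Deviations

section Repair

variable {V : Type*} [Fintype V] [DecidableEq V]

lemma card_nbr_eq_sum (t : Finset (Sym2 V)) (u : V) :
    ((nbr t u).card : ℤ) = ∑ e ∈ t, if u ∈ e then 1 else 0 := by
  rw [Finset.sum_boole]
  norm_cast
  refine Finset.card_bij (fun w _ => s(u, w)) (fun w hw => ?_) (fun a _ b _ h => ?_) fun e he => ?_
  · exact Finset.mem_filter.2 ⟨mem_nbr.1 hw, Sym2.mem_mk_left _ _⟩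
  · exact Sym2.congr_right.1 h
  · obtain ⟨he, w, rfl⟩ := Finset.mem_filter.1 he
    exact ⟨w, mem_nbr.2 he, rfl⟩

lemma sum_card_nbr {t : Finset (Sym2 V)} (ht : ∀ e ∈ t, ¬ e.IsDiag) :
    ∑ u, ((nbr t u).card : ℤ) = 2 * t.card := by
  simp only [card_nbr_eq_sum]
  rw [Finset.sum_comm, Finset.sum_congr rfl (g := fun _ => 2), Finset.sum_const, nsmul_eq_mul,
    mul_comm]
  intro e he
  have h := Sym2.card_toFinset_of_not_isDiag e (ht e he)
  rw [Finset.sum_boole]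
  rw [← Nat.cast_ofNat, ← h]
  congr 2
  ext x; simp

/-- The set of all unordered pairs of distinct vertices. -/
def pairs (V : Type*) [Fintype V] [DecidableEq V] : Finset (Sym2 V) :=
  Finset.univ.filter fun e => ¬ e.IsDiag

@[simp] lemma mem_pairs {e : Sym2 V} : e ∈ pairs V ↔ ¬ e.IsDiag := by simp [pairs]

lemma card_nbr_pairs (u : V) : (nbr (pairs V) u).card = Fintype.card V - 1 := by
  have : nbr (pairs V) u = Finset.univ.erase u := by
    ext w; simp [eq_comm]
  rw [this, Finset.card_erase_of_mem (Finset.mem_univ u), Finset.card_univ]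

/-- Total deviation of the degrees from `d`. -/
def degreeDefect (t : Finset (Sym2 V)) (d : ℕ) : ℤ := ∑ u, |((nbr t u).card : ℤ) - d|

lemma exists_common_exchange {t : Finset (Sym2 V)} {u v : V}
    (h : (nbr t v).card < (nbr t u).card) (ht : ∀ e ∈ t, ¬ e.IsDiag) :
    ∃ w, s(u, w) ∈ t ∧ s(v, w) ∉ t ∧ v ≠ w ∧ u ≠ w := by
  have huv : u ≠ v := fun h' => by simp [h'] at h
  have hc : ((nbr t v).erase u).card < ((nbr t u).erase v).card := by
    rw [Finset.card_erase_eq_ite, Finset.card_erase_eq_ite]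
    have hvu : v ∈ nbr t u ↔ u ∈ nbr t v := mem_nbr_comm
    by_cases h' : u ∈ nbr t v
    · have : 0 < (nbr t v).card := Finset.card_pos.2 ⟨u, h'⟩
      rw [if_pos h', if_pos (hvu.2 h')]
      omega
    · rwa [if_neg h', if_neg (mt hvu.1 h')]
  obtain ⟨w, hw, hw'⟩ := Finset.exists_mem_notMem_of_card_lt_card hc
  rw [Finset.mem_erase, mem_nbr] at hw
  have huw : u ≠ w := fun e => ht _ hw.2 (by simp [e])
  refine ⟨w, hw.2, fun h' => hw' (Finset.mem_erase.2 ⟨huw.symm, mem_nbr.2 h'⟩), hw.1.symm, huw⟩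

lemma card_symmDiff_triangle {α : Type*} [DecidableEq α] (a b c : Finset α) :
    (symmDiff a c).card ≤ (symmDiff a b).card + (symmDiff b c).card :=
  (Finset.card_le_card (symmDiff_triangle a b c)).trans (Finset.card_union_le _ _)

lemma exists_regular_of_card {d : ℕ} (N : ℕ) : ∀ t : Finset (Sym2 V), t ⊆ pairs V →
    2 * t.card = d * Fintype.card V → degreeDefect t d ≤ N →
    ∃ t₀ ⊆ pairs V, (∀ u, (nbr t₀ u).card = d) ∧ (symmDiff t₀ t).card ≤ N := by
  induction N using Nat.strong_induction_on with
  | _ N ih =>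
    intro t hts hcard hN
    have ht : ∀ e ∈ t, ¬ e.IsDiag := fun e he => mem_pairs.1 (hts he)
    by_cases hreg : ∀ u, (nbr t u).card = d
    · exact ⟨t, hts, hreg, by simp⟩
    push Not at hreg
    set f : V → ℤ := fun u => ((nbr t u).card : ℤ) - d with hf
    have hsum : ∑ u, f u = 0 := by
      simp only [hf, Finset.sum_sub_distrib, sum_card_nbr ht]
      rw [Finset.sum_const, Finset.card_univ, nsmul_eq_mul]
      have : (2 * t.card : ℤ) = d * Fintype.card V := by exact_mod_cast hcard
      rw [this]; ring
    obtain ⟨u₀, hu₀⟩ := hreg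
    have hne : ∃ u ∈ Finset.univ, f u ≠ 0 := ⟨u₀, Finset.mem_univ _, by simp only [hf]; omega⟩
    obtain ⟨u, _, hu⟩ := Finset.exists_pos_of_sum_zero_of_exists_nonzero f hsum hne
    obtain ⟨v, _, hv⟩ := Finset.exists_pos_of_sum_zero_of_exists_nonzero (fun u => -f u)
      (s := Finset.univ) (by simp only [Finset.sum_neg_distrib, hsum, neg_zero]) (by simpa using hne)
    have huv : u ≠ v := fun h => by rw [h] at hu; linarith
    obtain ⟨w, hw, hw', hvw, huw⟩ := exists_common_exchange (t := t) (u := u) (v := v)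
      (by simp only [hf] at hu hv; omega) ht
    set t' := insert s(v, w) (t.erase s(u, w)) with ht'
    have hdeg : ∀ x, ((nbr t' x).card : ℤ) =
        (nbr t x).card + (if x = v then 1 else 0) - (if x = u then 1 else 0) := fun x => by
      rw [card_nbr_eq_sum, card_nbr_eq_sum, ht', Finset.sum_insert (fun h => hw' (Finset.mem_of_mem_erase h)),
        Finset.sum_erase_eq_sub hw]
      simp only [Sym2.mem_iff]
      by_cases h1 : x = v <;> by_cases h2 : x = u <;> by_cases h3 : x = w <;> simp_all
      ring
    have hΦ : degreeDefect t' d = degreeDefect t d - 2 := by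
      have : ∀ x, |((nbr t' x).card : ℤ) - d| =
          |((nbr t x).card : ℤ) - d| - (if x = v then 1 else 0) - (if x = u then 1 else 0) := by
        intro x
        rw [hdeg x]
        simp only [hf] at hu hv
        by_cases h1 : x = v
        · have : x ≠ u := fun h => huv (h.symm.trans h1)
          simp only [h1, if_true, if_neg huv.symm]
          rw [abs_of_nonpos (by linarith), abs_of_nonpos (by linarith)]; ring
        · by_cases h2 : x = u
          · simp only [h2, if_true, if_neg huv]
            rw [abs_of_nonneg (by linarith), abs_of_nonneg (by linarith)]; ring
          · simp [h1, h2]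
      simp only [degreeDefect, this, Finset.sum_sub_distrib, Finset.sum_ite_eq', Finset.mem_univ,
        if_true]
      ring
    have h0 : 0 ≤ degreeDefect t' d := Finset.sum_nonneg fun _ _ => abs_nonneg _
    have hts' : t' ⊆ pairs V := Finset.insert_subset (mem_pairs.2 (by simpa using hvw))
      ((Finset.erase_subset _ _).trans hts)
    obtain ⟨t₀, h1, h2, h3⟩ := ih (N - 2) (by omega) t' hts' (by
      rw [← hcard, ht', Finset.card_insert_of_notMem (fun h => hw' (Finset.mem_of_mem_erase h)),
        Finset.card_erase_add_one hw]) (by omega)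
    refine ⟨t₀, h1, h2, (card_symmDiff_triangle t₀ t' t).trans ?_⟩
    have : (symmDiff t' t).card ≤ 2 := by
      refine (Finset.card_le_card (t := {s(v, w), s(u, w)}) fun e he => ?_).trans
        Finset.card_le_two
      rw [Finset.mem_symmDiff, ht'] at he
      simp only [Finset.mem_insert, Finset.mem_erase, Finset.mem_singleton] at he ⊢
      tauto
    omega

lemma degreeDefect_le_add {a b : Finset (Sym2 V)} (hab : a ⊆ b) (hb : ∀ e ∈ b, ¬ e.IsDiag) (d : ℕ) :
    degreeDefect a d ≤ degreeDefect b d + 2 * ((b.card : ℤ) - a.card) ∧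
      degreeDefect b d ≤ degreeDefect a d + 2 * ((b.card : ℤ) - a.card) := by
  have hmono : ∀ u, ((nbr a u).card : ℤ) ≤ (nbr b u).card := fun u => by
    exact_mod_cast Finset.card_le_card fun w hw => mem_nbr.2 (hab (mem_nbr.1 hw))
  have e : 2 * ((b.card : ℤ) - a.card) = ∑ u, (((nbr b u).card : ℤ) - (nbr a u).card) := by
    rw [Finset.sum_sub_distrib, sum_card_nbr hb, sum_card_nbr fun e he => hb e (hab he)]; ring
  rw [e, degreeDefect, degreeDefect, ← Finset.sum_add_distrib, ← Finset.sum_add_distrib]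
  constructor <;> refine Finset.sum_le_sum fun u _ => ?_
  · have h1 := hmono u
    have := abs_le.1 (le_refl |((nbr b u).card : ℤ) - d|)
    rw [abs_le]; constructor <;> linarith
  · have h1 := hmono u
    have := abs_le.1 (le_refl |((nbr a u).card : ℤ) - d|)
    rw [abs_le]; constructor <;> linarith

lemma two_mul_abs_card_sub_le {t : Finset (Sym2 V)} (ht : ∀ e ∈ t, ¬ e.IsDiag) (d : ℕ) {M : ℤ}
    (hM : 2 * M = d * Fintype.card V) : 2 * |(t.card : ℤ) - M| ≤ degreeDefect t d := by
  have : 2 * ((t.card : ℤ) - M) = ∑ u, (((nbr t u).card : ℤ) - d) := by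
    rw [Finset.sum_sub_distrib, sum_card_nbr ht, Finset.sum_const, Finset.card_univ, nsmul_eq_mul]
    linarith
  calc 2 * |(t.card : ℤ) - M| = |2 * ((t.card : ℤ) - M)| := by rw [abs_mul, abs_two]
    _ ≤ _ := by rw [this]; exact Finset.abs_sum_le_sum_abs _ _

/-- A graph with all degrees close to `d` is close to a `d`-regular graph. -/
lemma exists_regular_near {d D : ℕ} (hd : d + 1 ≤ Fintype.card V) (he : Even (d * Fintype.card V))
    {t : Finset (Sym2 V)} (hts : t ⊆ pairs V) (hD : ∀ u, |((nbr t u).card : ℤ) - d| ≤ D) :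
    ∃ t₀ ⊆ pairs V, (∀ u, (nbr t₀ u).card = d) ∧
      (symmDiff t₀ t).card ≤ 3 * (Fintype.card V * D) := by
  have ht : ∀ e ∈ t, ¬ e.IsDiag := fun e he => mem_pairs.1 (hts he)
  obtain ⟨M, hM⟩ := he
  have hM2 : 2 * (M : ℤ) = d * Fintype.card V := by exact_mod_cast (by omega)
  have hΦ : degreeDefect t d ≤ Fintype.card V * D := by
    rw [degreeDefect, ← Finset.card_univ, ← nsmul_eq_mul]
    exact Finset.sum_le_card_nsmul _ _ _ fun u _ => hD u
  have hMs : M ≤ (pairs V).card := by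
    have h := sum_card_nbr (t := pairs V) fun e he => mem_pairs.1 he
    simp only [card_nbr_pairs, Finset.sum_const, Finset.card_univ, nsmul_eq_mul] at h
    have h1 : (d : ℤ) * Fintype.card V ≤ Fintype.card V * (Fintype.card V - 1 : ℕ) := by
      rw [mul_comm]
      exact mul_le_mul_of_nonneg_left (by omega) (by positivity)
    have : 2 * (M : ℤ) ≤ 2 * (pairs V).card := by rw [← h, hM2]; exact h1
    omega
  have h2 := two_mul_abs_card_sub_le ht d hM2
  have key : ∃ t' ⊆ pairs V, t'.card = M ∧ degreeDefect t' d ≤ 2 * (Fintype.card V * D) ∧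
      (symmDiff t' t).card ≤ Fintype.card V * D := by
    rcases le_total M t.card with h | h
    · obtain ⟨t', h1, h1'⟩ := Finset.exists_subset_card_eq h
      refine ⟨t', h1.trans hts, h1', ?_, ?_⟩
      · have := (degreeDefect_le_add h1 ht d).1
        rw [h1'] at this
        rw [abs_of_nonneg (by omega)] at h2
        linarith
      · rw [symmDiff_of_le h1, Finset.card_sdiff_of_subset h1, h1']
        rw [abs_of_nonneg (by omega)] at h2
        zify [h]; omega
    · obtain ⟨t', h1, h1', h1''⟩ := Finset.exists_subsuperset_card_eq hts h hMs
      refine ⟨t', h1', h1'', ?_, ?_⟩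
      · have := (degreeDefect_le_add h1 (fun e he => mem_pairs.1 (h1' he)) d).2
        rw [h1''] at this
        rw [abs_of_nonpos (by omega)] at h2
        linarith
      · rw [symmDiff_of_ge h1, Finset.card_sdiff_of_subset h1, h1'']
        rw [abs_of_nonpos (by omega)] at h2
        zify [h]; omega
  obtain ⟨t', h1, h3, h4, h5⟩ := key
  obtain ⟨t₀, g1, g2, g3⟩ := exists_regular_of_card (d := d) (2 * (Fintype.card V * D)) t' h1
    (by omega) (by exact_mod_cast h4)
  refine ⟨t₀, g1, g2, (card_symmDiff_triangle t₀ t' t).trans (by omega)⟩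

end Repair

section RegularCount

variable {V : Type*} [Fintype V] [DecidableEq V]

/-- The edge sets of `d`-regular graphs. -/
def regularSets (V : Type*) [Fintype V] [DecidableEq V] (d : ℕ) : Finset (Finset (Sym2 V)) :=
  (pairs V).powerset.filter fun t => ∀ u, (nbr t u).card = d

lemma card_small_subsets_le {α : Type*} [DecidableEq α] (s : Finset α) (r : ℕ) :
    (s.powerset.filter fun D => D.card ≤ r).card ≤ (s.card + 1) ^ r := by
  have : s.powerset.filter (fun D => D.card ≤ r) ⊆
      (Finset.range (r + 1)).biUnion fun i => s.powersetCard i := fun D hD => by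
    rw [Finset.mem_filter, Finset.mem_powerset] at hD
    exact Finset.mem_biUnion.2 ⟨D.card, Finset.mem_range.2 (by omega),
      Finset.mem_powersetCard.2 ⟨hD.1, rfl⟩⟩
  refine (Finset.card_le_card this).trans (Finset.card_biUnion_le.trans ?_)
  rw [add_pow]
  refine Finset.sum_le_sum fun i hi => ?_
  have hi' : i ≤ r := by have := Finset.mem_range.1 hi; omega
  rw [Finset.card_powersetCard, one_pow, mul_one]
  exact (Nat.choose_le_pow _ _).trans (Nat.le_mul_of_pos_right _ (Nat.choose_pos hi'))

lemma weight_le {q X : ℝ} (h0 : 0 ≤ q) (h1 : q ≤ 1) (hX : 1 ≤ X) (hq : 1 ≤ X * q)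
    (hq' : 1 ≤ X * (1 - q)) {a b N r : ℕ} (ha : a ≤ N) (hb : b ≤ N) (hab : a ≤ b + r)
    (hba : b ≤ a + r) :
    q ^ a * (1 - q) ^ (N - a) ≤ X ^ r * (q ^ b * (1 - q) ^ (N - b)) := by
  have h1' : 0 ≤ 1 - q := by linarith
  have h1'' : 1 - q ≤ 1 := by linarith
  rcases le_total a b with h | h
  · obtain ⟨c, rfl⟩ := Nat.exists_eq_add_of_le h
    have e : N - a = (N - (a + c)) + c := by omega
    rw [e, pow_add, pow_add q]
    have : (1 - q) ^ c ≤ X ^ r * q ^ c := by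
      calc (1 - q) ^ c ≤ 1 := pow_le_one₀ h1' h1''
        _ ≤ (X * q) ^ c := one_le_pow₀ hq
        _ = X ^ c * q ^ c := mul_pow _ _ _
        _ ≤ _ := by gcongr; omega
    calc _ = (q ^ a * (1 - q) ^ (N - (a + c))) * (1 - q) ^ c := by ring
      _ ≤ (q ^ a * (1 - q) ^ (N - (a + c))) * (X ^ r * q ^ c) := by gcongr
      _ = _ := by ring
  · obtain ⟨c, rfl⟩ := Nat.exists_eq_add_of_le h
    have e : N - b = (N - (b + c)) + c := by omega
    rw [e, pow_add, pow_add (1 - q)]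
    have : q ^ c ≤ X ^ r * (1 - q) ^ c := by
      calc q ^ c ≤ 1 := pow_le_one₀ h0 h1
        _ ≤ (X * (1 - q)) ^ c := one_le_pow₀ hq'
        _ = X ^ c * (1 - q) ^ c := mul_pow _ _ _
        _ ≤ _ := by gcongr; omega
    calc _ = (q ^ b * (1 - q) ^ (N - (b + c))) * q ^ c := by ring
      _ ≤ (q ^ b * (1 - q) ^ (N - (b + c))) * (X ^ r * (1 - q) ^ c) := by gcongr
      _ = _ := by ring

lemma two_mul_card_of_regular {d : ℕ} {t : Finset (Sym2 V)} (ht : t ∈ regularSets V d) :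
    2 * t.card = d * Fintype.card V := by
  obtain ⟨h1, h2⟩ := Finset.mem_filter.1 ht
  have := sum_card_nbr (t := t) fun e he => mem_pairs.1 (Finset.mem_powerset.1 h1 he)
  simp only [h2, Finset.sum_const, Finset.card_univ, nsmul_eq_mul] at this
  rw [mul_comm d]
  exact_mod_cast this.symm

/-- Transfer from binomial random graphs to random regular graphs. -/
lemma card_regular_bad_le {d D M : ℕ} (hd : d + 1 ≤ Fintype.card V)
    (hM : d * Fintype.card V = 2 * M) {q X : ℝ} (h0 : 0 ≤ q) (h1 : q ≤ 1) (hX : 1 ≤ X)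
    (hq : 1 ≤ X * q) (hq' : 1 ≤ X * (1 - q)) (hXs : ((pairs V).card : ℝ) + 1 ≤ X ^ 2)
    (hnear : bernProb (pairs V) q (fun t => ∃ u, (D : ℤ) < |((nbr t u).card : ℤ) - d|) ≤ 1 / 2)
    (Q : Finset (Sym2 V) → Prop) :
    (((regularSets V d).filter Q).card : ℝ) ≤
      2 * X ^ (9 * (Fintype.card V * D)) * bernProb (pairs V) q Q * (regularSets V d).card := by
  set n := Fintype.card V with hn
  set s := pairs V with hs
  set r : ℕ := 3 * (n * D) with hr
  have h1' : 0 ≤ 1 - q := by linarith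
  have hX0 : 0 < X := by linarith
  have hq0 : 0 < q := by
    rcases h0.lt_or_eq with h | h
    · exact h
    · rw [← h, mul_zero] at hq; linarith
  have hq0' : 0 < 1 - q := by
    rcases h1'.lt_or_eq with h | h
    · exact h
    · rw [← h, mul_zero] at hq'; linarith
  set ω : ℝ := q ^ M * (1 - q) ^ (s.card - M) with hω
  have hω0 : 0 < ω := by positivity
  have hcard : ∀ t ∈ regularSets V d, t.card = M := fun t ht => by
    have := two_mul_card_of_regular ht; rw [← hn] at this; omega
  have hup : (((regularSets V d).filter Q).card : ℝ) * ω ≤ bernProb s q Q := by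
    rw [← nsmul_eq_mul, ← Finset.sum_const]
    simp only [bernProb, bernExp]
    rw [← Finset.sum_filter_add_sum_filter_not s.powerset (fun t => t ∈ regularSets V d ∧ Q t)]
    have hsub : (regularSets V d).filter Q = s.powerset.filter fun t => t ∈ regularSets V d ∧ Q t := by
      ext t
      simp only [Finset.mem_filter, regularSets, ← hs]
      tauto
    rw [← hsub]
    have h2 : ∑ t ∈ (regularSets V d).filter Q, ω = ∑ t ∈ (regularSets V d).filter Q,
        q ^ t.card * (1 - q) ^ (s.card - t.card) * (if Q t then 1 else 0) :=
      Finset.sum_congr rfl fun t ht => by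
        rw [if_pos (Finset.mem_filter.1 ht).2, mul_one, hcard t (Finset.mem_filter.1 ht).1]
    rw [h2]
    exact le_add_of_nonneg_right (Finset.sum_nonneg fun t _ => by split_ifs <;> positivity)
  have hlow : (1 : ℝ) / 2 ≤ (regularSets V d).card * X ^ (9 * (n * D)) * ω := by
    have hn' := bernProb_not (s := s) (p := q) fun t => ∃ u, (D : ℤ) < |((nbr t u).card : ℤ) - d|
    have h3 : (1 : ℝ) / 2 ≤ bernProb s q
        (fun t => ¬ ∃ u, (D : ℤ) < |((nbr t u).card : ℤ) - d|) := by rw [hn']; linarith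
    refine h3.trans ?_
    set S := (regularSets V d) ×ˢ (s.powerset.filter fun E => E.card ≤ r)
    have h4 : bernProb s q (fun t => ¬ ∃ u, (D : ℤ) < |((nbr t u).card : ℤ) - d|) ≤
        ∑ t ∈ s.powerset, ∑ z ∈ S, if symmDiff z.1 z.2 = t then X ^ r * ω else 0 := by
      simp only [bernProb, bernExp]
      refine Finset.sum_le_sum fun t ht => ?_
      have hts := Finset.mem_powerset.1 ht
      by_cases h : ∃ u, (D : ℤ) < |((nbr t u).card : ℤ) - d|
      · rw [if_neg (not_not.2 h), mul_zero]
        exact Finset.sum_nonneg fun z _ => by split_ifs <;> positivity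
      rw [if_pos h]
      push Not at h
      obtain ⟨t₀, g1, g2, g3⟩ := exists_regular_near hd ⟨M, by rw [← hn]; omega⟩ hts h
      have g3' : (symmDiff t₀ t).card ≤ r := g3
      have ht₀ : t₀ ∈ regularSets V d :=
        Finset.mem_filter.2 ⟨Finset.mem_powerset.2 g1, g2⟩
      have hz : (t₀, symmDiff t₀ t) ∈ S := by
        refine Finset.mem_product.2 ⟨ht₀, Finset.mem_filter.2 ⟨Finset.mem_powerset.2 ?_, g3⟩⟩
        exact symmDiff_le_sup.trans (sup_le g1 hts)
      have := Finset.single_le_sum (f := fun z : Finset (Sym2 V) × Finset (Sym2 V) =>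
        if symmDiff z.1 z.2 = t then X ^ r * ω else 0)
        (fun z _ => by split_ifs <;> positivity) hz
      simp only [symmDiff_symmDiff_cancel_left, if_true] at this
      refine le_trans ?_ this
      rw [mul_one, hω]
      have c1 : t.card ≤ t₀.card + (symmDiff t₀ t).card := by
        refine (Finset.card_le_card (t := t₀ ∪ symmDiff t₀ t) fun e he => ?_).trans
          (Finset.card_union_le _ _)
        rw [Finset.mem_union, Finset.mem_symmDiff]; tauto
      have c2 : t₀.card ≤ t.card + (symmDiff t₀ t).card := by
        refine (Finset.card_le_card (t := t ∪ symmDiff t₀ t) fun e he => ?_).trans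
          (Finset.card_union_le _ _)
        rw [Finset.mem_union, Finset.mem_symmDiff]; tauto
      have c3 := hcard t₀ ht₀
      have c4 : t₀.card ≤ s.card := Finset.card_le_card g1
      exact weight_le h0 h1 hX hq hq' (Finset.card_le_card hts) (by omega) (by omega) (by omega)
    refine h4.trans ?_
    rw [Finset.sum_comm]
    have h5 : ∀ z ∈ S, ∑ t ∈ s.powerset, (if symmDiff z.1 z.2 = t then X ^ r * ω else 0) ≤
        X ^ r * ω := fun z _ => by
      rw [Finset.sum_ite_eq]
      split_ifs
      · exact le_rfl
      · positivity
    refine (Finset.sum_le_sum h5).trans ?_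
    rw [Finset.sum_const, Finset.card_product, nsmul_eq_mul]
    have h6 : (((s.powerset.filter fun E => E.card ≤ r).card : ℕ) : ℝ) ≤ (X ^ 2) ^ r := by
      refine le_trans (b := ((s.card : ℝ) + 1) ^ r) ?_ (by gcongr)
      exact_mod_cast card_small_subsets_le s r
    push_cast
    calc _ ≤ ((regularSets V d).card : ℝ) * (X ^ 2) ^ r * (X ^ r * ω) := by gcongr
      _ = _ := by rw [hr, ← pow_mul]; ring
  set R : ℝ := ((regularSets V d).card : ℝ)
  set B : ℝ := (((regularSets V d).filter Q).card : ℝ)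
  have hP := bernProb_nonneg (s := s) h0 h1 Q
  have hB0 : 0 ≤ B := Nat.cast_nonneg _
  have k1 : B * (1 / 2) ≤ B * (R * X ^ (9 * (n * D)) * ω) := mul_le_mul_of_nonneg_left hlow hB0
  have k2 : B * ω * (R * X ^ (9 * (n * D))) ≤ bernProb s q Q * (R * X ^ (9 * (n * D))) :=
    mul_le_mul_of_nonneg_right hup (by positivity)
  calc B = 2 * (B * (1 / 2)) := by ring
    _ ≤ 2 * (bernProb s q Q * (R * X ^ (9 * (n * D)))) := by linarith
    _ = _ := by ring

end RegularCount

section Alternating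

open Matrix
open scoped Matrix.Norms.L2Operator

/-- The steps of an alternating walk: even steps use `E`, odd steps use `A`. -/
def altSteps {V : Type*} (E A : Matrix V V ℝ) (i : ℕ) : Matrix V V ℝ := if i % 2 = 0 then E else A

lemma walkProd_altSteps {V : Type*} [Fintype V] [DecidableEq V] (E A : Matrix V V ℝ) (k : ℕ) :
    walkProd (altSteps E A) (2 * k) = (E * A) ^ k := by
  induction k with
  | zero => rfl
  | succ k ih =>
    rw [show 2 * (k + 1) = 2 * k + 1 + 1 by ring, walkProd, walkProd, ih, pow_succ, mul_assoc]
    congr 2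
    · simp [altSteps]
    · simp [altSteps, Nat.add_mod]

/-- The part of an alternating walk count contributed by paths avoiding `Z` internally. -/
def altPathSum {V : Type*} [Fintype V] [DecidableEq V] (E A : Matrix V V ℝ) (m : ℕ) (x y : V)
    (Z : Finset V) : ℝ :=
  ∑ w : Fin (m + 1) → V, if w 0 = x ∧ w (Fin.last m) = y then
    (if Function.Injective w ∧ ∀ i, i ≠ 0 → i ≠ Fin.last m → w i ∉ Z then 1 else 0) *
      ∏ l : Fin m, altSteps E A l (w l.castSucc) (w l.succ) else 0

lemma altPathSum_sub_le {V : Type*} [Fintype V] [DecidableEq V] [Nonempty V] {E A : Matrix V V ℝ}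
    {κ θ : ℝ} (hθ0 : 0 ≤ θ) (hE0 : ∀ u v, 0 ≤ E u v) (hA0 : ∀ u v, 0 ≤ A u v)
    (hEs : E.IsSymm) (hAs : A.IsSymm) (hEκ : ∀ u v, E u v ≤ κ) (hAκ : ∀ u v, A u v ≤ κ)
    (hEr : ∀ u, |∑ v, E u v - 1| ≤ θ) (hAr : ∀ u, ∑ v, A u v = 1)
    (hS : ‖E * A - Matrix.of fun _ _ => (Fintype.card V : ℝ)⁻¹‖ ≤ θ) {k₁ k : ℕ} (hk₁ : 1 ≤ k₁)
    (hk : 3 * (2 * k₁ + 1) ≤ 2 * k) (hθk : θ ^ k₁ ≤ θ / Fintype.card V) (hθ : k * 8 ^ k * θ ≤ 1)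
    {x y : V} (hxy : x ≠ y) (Z : Finset V) :
    |altPathSum E A (2 * k) x y Z - (Fintype.card V : ℝ)⁻¹| ≤
      (k * 8 ^ k * θ + (2 * k * (Z.card + 2) + 4 * k ^ 2) * (128 ^ k * κ)) / Fintype.card V := by
  set n : ℝ := (Fintype.card V : ℝ) with hn
  have hnpos : 0 < n := by
    rw [hn]; exact_mod_cast Fintype.card_pos
  have hk1 : k₁ ≤ k := by omega
  have hk0 : 1 ≤ k := by omega
  have hpk : (1 : ℝ) ≤ k * 8 ^ k := by
    have : (1 : ℝ) ≤ k := by exact_mod_cast hk0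
    have h8 : (1 : ℝ) ≤ 8 ^ k := one_le_pow₀ (by norm_num)
    nlinarith
  have hθ1 : θ ≤ 1 := by nlinarith
  have hκ : 0 ≤ κ := (hE0 x x).trans (hEκ x x)
  have hEc : ∀ v, |∑ u, E u v - 1| ≤ θ := fun v => by
    have : ∑ u, E u v = ∑ u, E v u := Finset.sum_congr rfl fun u _ => (hEs.apply v u)
    rw [this]; exact hEr v
  have hAc : ∀ v, ∑ u, A u v = 1 := fun v => by
    have : ∑ u, A u v = ∑ u, A v u := Finset.sum_congr rfl fun u _ => (hAs.apply v u)
    rw [this]; exact hAr v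
  have hN0 : ∀ i j, 0 ≤ (E * A) i j := fun i j =>
    Finset.sum_nonneg fun v _ => mul_nonneg (hE0 _ _) (hA0 _ _)
  have hNr : ∀ i, |∑ j, (E * A) i j - 1| ≤ θ := fun i => by
    have : ∑ j, (E * A) i j = ∑ v, E i v := by
      simp only [Matrix.mul_apply]
      rw [Finset.sum_comm]
      refine Finset.sum_congr rfl fun v _ => ?_
      rw [← Finset.mul_sum, hAr, mul_one]
    rw [this]; exact hEr i
  have hNc : ∀ j, |∑ i, (E * A) i j - 1| ≤ θ := fun j => by
    have : ∑ i, (E * A) i j - 1 = ∑ v, (∑ i, E i v - 1) * A v j := by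
      simp only [Matrix.mul_apply, sub_mul, one_mul, Finset.sum_sub_distrib, hAc, Finset.sum_mul]
      rw [Finset.sum_comm]
    rw [this]
    refine (Finset.abs_sum_le_sum_abs _ _).trans ?_
    calc ∑ v, |(∑ i, E i v - 1) * A v j| ≤ ∑ v, θ * A v j := Finset.sum_le_sum fun v _ => by
          rw [abs_mul, abs_of_nonneg (hA0 v j)]
          exact mul_le_mul_of_nonneg_right (hEc v) (hA0 v j)
      _ = θ := by rw [← Finset.mul_sum, hAc, mul_one]
  have hB : BoundedSteps (altSteps E A) κ := by
    refine ⟨fun i u v => ?_, fun i u => ?_, fun i v => ?_, fun i u v => ?_⟩ <;>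
      by_cases h : i % 2 = 0 <;> simp only [altSteps, h, if_true, if_false]
    · exact hE0 u v
    · exact hA0 u v
    · linarith [(abs_le.1 (hEr u)).2]
    · rw [hAr]; norm_num
    · linarith [(abs_le.1 (hEc v)).2]
    · rw [hAc]; norm_num
    · exact hEκ u v
    · exact hAκ u v
  have hwalk : ∀ j, k₁ ≤ j → j ≤ k → ∀ u v,
      |walkProd (altSteps E A) (2 * j) u v - n⁻¹| ≤ k * 8 ^ k * θ / n := fun j hj1 hj2 u v => by
    rw [walkProd_altSteps]
    refine (abs_pow_entry_sub_le hθ1 hN0 hNr hNc hS j (by omega) ?_ u v).trans ?_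
    · exact (pow_le_pow_of_le_one hθ0 hθ1 hj1).trans hθk
    · gcongr; norm_num
  set G : ℝ := 4 ^ k * (2 / n) with hG
  have hmid : ∀ a r, 2 * k₁ + 1 ≤ r → r ≤ 2 * k → ∀ u v,
      walkProd (fun i => altSteps E A (a + i)) r u v ≤ G := fun a r h1 h2 u v => by
    have he : ∀ a', (a + a') % 2 = 0 →
        (fun i => altSteps E A (a + (a' + i))) = altSteps E A := fun a' ha' => by
      funext i
      have : (a + (a' + i)) % 2 = i % 2 := by omega
      simp only [altSteps, this]
    obtain ⟨b, hb⟩ : ∃ b, r = a % 2 + 2 * k₁ + b := ⟨r - (a % 2 + 2 * k₁), by omega⟩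
    rw [hb]
    refine (BoundedSteps.walk_entry_of_middle (hB.shift a) (G := 2 / n) (by positivity)
      (fun u v => ?_) u v).trans ?_
    · have h3 := (abs_le.1 (hwalk k₁ le_rfl hk1 u v)).2
      rw [he (a % 2) (by omega)]
      have : (k : ℝ) * 8 ^ k * θ / n ≤ 1 / n := by gcongr
      rw [inv_eq_one_div] at h3
      have : 2 / n = 1 / n + 1 / n := by ring
      linarith
    · rw [hG, show (4 : ℝ) ^ k = 2 ^ (2 * k) by rw [pow_mul]; norm_num]
      gcongr
      · norm_num
      · omega
  have hlow := hB.walk_sub_path_le (m := 2 * k) (by positivity : 0 ≤ G) hmid hk hxy Z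
  change walkProd (altSteps E A) (2 * k) x y - altPathSum E A (2 * k) x y Z ≤ _ at hlow
  have hup : altPathSum E A (2 * k) x y Z ≤ walkProd (altSteps E A) (2 * k) x y := by
    rw [walkProd_apply]
    refine Finset.sum_le_sum fun w _ => ?_
    have h0 : 0 ≤ ∏ l : Fin (2 * k), altSteps E A l (w l.castSucc) (w l.succ) :=
      Finset.prod_nonneg fun l _ => hB.nonneg _ _ _
    by_cases hw : w 0 = x ∧ w (Fin.last (2 * k)) = y
    · rw [if_pos hw, if_pos hw]
      refine mul_le_of_le_one_left h0 ?_
      split_ifs <;> norm_num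
    · rw [if_neg hw, if_neg hw]
  have hmain := abs_le.1 (hwalk k hk1 le_rfl x y)
  have e1 : ((2 * k : ℕ) * ((Z.card : ℝ) + 2) + (2 * k : ℕ) * (2 * k : ℕ)) * (4 ^ (2 * k) * (κ * G)) ≤
      (2 * k * (Z.card + 2) + 4 * k ^ 2) * (128 ^ k * κ) / n := by
    have h4 : (4 : ℝ) ^ (2 * k) * (κ * G) = 2 * (64 ^ k * κ) / n := by
      rw [hG, pow_mul, show (64 : ℝ) = 4 ^ 2 * 4 by norm_num, mul_pow]; ring
    rw [h4, mul_div_assoc]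
    push_cast
    have h5 : (2 : ℝ) * 64 ^ k ≤ 128 ^ k := by
      rw [show (128 : ℝ) = 2 * 64 by norm_num, mul_pow]
      gcongr
      calc (2 : ℝ) = 2 ^ 1 := by norm_num
        _ ≤ 2 ^ k := pow_le_pow_right₀ (by norm_num) hk0
    calc _ = (2 * k * ((Z.card : ℝ) + 2) + 4 * k ^ 2) * (2 * 64 ^ k * κ / n) := by ring
      _ ≤ (2 * k * ((Z.card : ℝ) + 2) + 4 * k ^ 2) * (128 ^ k * κ / n) := by gcongr
      _ = _ := by ring
  have e2 : 0 ≤ (2 * k * ((Z.card : ℝ) + 2) + 4 * k ^ 2) * (128 ^ k * κ) / n := by positivity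
  rw [add_div, abs_le]
  constructor <;> linarith

lemma prod_alternating (a b : ℝ) (k : ℕ) :
    ∏ l : Fin (2 * k), (if (l : ℕ) % 2 = 0 then a else b) = a ^ k * b ^ k := by
  rw [Fin.prod_univ_eq_prod_range (fun l => if l % 2 = 0 then a else b)]
  induction k with
  | zero => simp
  | succ k ih =>
    rw [show 2 * (k + 1) = 2 * k + 1 + 1 by ring, Finset.prod_range_succ, Finset.prod_range_succ, ih]
    have h1 : 2 * k % 2 = 0 := by omega
    have h2 : ¬ (2 * k + 1) % 2 = 0 := by omega
    rw [if_pos h1, if_neg h2]; ring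

/-- The `0,1` adjacency matrix. -/
def adjMat {n : ℕ} (G : SimpleGraph (Fin n)) : Matrix (Fin n) (Fin n) ℝ :=
  Matrix.of fun u v => if G.Adj u v then 1 else 0

lemma altPathSum_eq_altPathCount {n : ℕ} (G₁ G₂ : SimpleGraph (Fin n)) (a b : ℝ) (k : ℕ)
    (x y : Fin n) (Z : Set (Fin n)) :
    altPathSum (a • adjMat G₁) (b • adjMat G₂) (2 * k) x y Z.toFinset =
      altPathCount G₁ G₂ (2 * k) x y Z * (a ^ k * b ^ k) := by
  have hprod : ∀ w : Fin (2 * k + 1) → Fin n,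
      ∏ l : Fin (2 * k), altSteps (a • adjMat G₁) (b • adjMat G₂) l (w l.castSucc) (w l.succ) =
        (if ∀ l : Fin (2 * k), if (l : ℕ) % 2 = 0 then G₁.Adj (w l.castSucc) (w l.succ)
          else G₂.Adj (w l.castSucc) (w l.succ) then 1 else 0) * (a ^ k * b ^ k) := fun w => by
    rw [← prod_alternating]
    by_cases h : ∀ l : Fin (2 * k), if (l : ℕ) % 2 = 0 then G₁.Adj (w l.castSucc) (w l.succ)
        else G₂.Adj (w l.castSucc) (w l.succ)
    · rw [if_pos h, one_mul]
      refine Finset.prod_congr rfl fun l _ => ?_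
      have hl := h l
      by_cases h2 : (l : ℕ) % 2 = 0 <;> simp only [h2, if_true, if_false] at hl <;>
        simp [altSteps, h2, adjMat, hl]
    · rw [if_neg h, zero_mul]
      push Not at h
      obtain ⟨l, hl⟩ := h
      refine Finset.prod_eq_zero (Finset.mem_univ l) ?_
      by_cases h2 : (l : ℕ) % 2 = 0 <;> simp only [h2, if_true, if_false] at hl <;>
        simp [altSteps, h2, adjMat, hl]
  have ite_mul_ite (p q r s : Prop) {_ : Decidable p} {_ : Decidable q}
      {_ : Decidable r} {_ : Decidable s} (D : ℝ) (h : s ↔ p ∧ q ∧ r) :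
      (if p then (if q then 1 else 0) * ((if r then 1 else 0) * D) else 0) =
        (if s then 1 else 0) * D := by
    by_cases p <;> by_cases q <;> by_cases r <;> simp_all
  rw [altPathCount, Nat.card_eq_fintype_card, Fintype.card_subtype, ← Finset.sum_boole,
    Finset.sum_mul, altPathSum]
  refine Finset.sum_congr rfl fun w _ => ?_
  rw [hprod, ite_mul_ite _ _ _ _ _ ?_]
  simp only [IsAltSeq, Set.mem_toFinset]
  tauto

end Alternating

section Deterministic

open Matrix
open scoped Matrix.Norms.L2Operator

/-- The finite set of edges of `G`. -/
def edges (G : SimpleGraph (Fin n)) : Finset (Sym2 (Fin n)) := Finset.univ.filter (· ∈ G.edgeSet)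

@[simp] lemma mem_edges {G : SimpleGraph (Fin n)} {e : Sym2 (Fin n)} :
    e ∈ edges G ↔ e ∈ G.edgeSet := by simp [edges]

lemma edgeCount_eq_card (G : SimpleGraph (Fin n)) : edgeCount G = (edges G).card := by
  rw [edgeCount, ← Set.ncard_coe_finset]
  congr 1; ext e; simp

lemma deg_eq_card_nbr (G : SimpleGraph (Fin n)) (u : Fin n) :
    deg G u = (nbr (edges G) u).card := by
  rw [deg, Nat.card_eq_fintype_card, ← Set.toFinset_card]
  congr 1
  ext w; simp

lemma sum_adjMat (G : SimpleGraph (Fin n)) (u : Fin n) : ∑ v, adjMat G u v = deg G u := by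
  rw [deg_eq_card_nbr]
  simp [adjMat, nbr]

lemma adjMat_isSymm (G : SimpleGraph (Fin n)) : (adjMat G).IsSymm := by
  ext u v; simp [adjMat, G.adj_comm]

lemma adjMat_nonneg (G : SimpleGraph (Fin n)) (u v : Fin n) : 0 ≤ adjMat G u v := by
  simp only [adjMat, Matrix.of_apply]; split_ifs <;> norm_num

lemma adjMat_le_one (G : SimpleGraph (Fin n)) (u v : Fin n) : adjMat G u v ≤ 1 := by
  simp only [adjMat, Matrix.of_apply]; split_ifs <;> norm_num

/-- The centred adjacency matrix of a `d`-regular graph. -/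
def centredAdj (K : SimpleGraph (Fin n)) (d : ℕ) : Matrix (Fin n) (Fin n) ℝ :=
  adjMat K - Matrix.of fun _ _ => (d : ℝ) / n

lemma norm_adjMat_le {K : SimpleGraph (Fin n)} {d : ℕ} (hK : IsRegularGraph K d) :
    ‖adjMat K‖ ≤ d := by
  refine l2_opNorm_le_of_sum_le (adjMat_nonneg K) (Nat.cast_nonneg d) (fun u => ?_) fun v => ?_
  · rw [sum_adjMat, hK u]
  · rw [Finset.sum_congr rfl fun u _ => (adjMat_isSymm K).apply v u, sum_adjMat, hK v]

lemma norm_const_le {c : ℝ} (hc : 0 ≤ c) :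
    ‖(Matrix.of fun _ _ => c : Matrix (Fin n) (Fin n) ℝ)‖ ≤ n * c := by
  refine l2_opNorm_le_of_sum_le (fun _ _ => hc) (by positivity) (fun u => ?_) fun v => ?_ <;> simp

lemma norm_centredAdj_le (hn : 0 < n) {K : SimpleGraph (Fin n)} {d : ℕ} (hK : IsRegularGraph K d) :
    ‖centredAdj K d‖ ≤ 2 * d := by
  have h1 := norm_sub_le (adjMat K) (Matrix.of fun _ _ => (d : ℝ) / n)
  have h2 := norm_adjMat_le hK
  have h3 := norm_const_le (n := n) (c := (d : ℝ) / n) (by positivity)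
  have hn' : (n : ℝ) ≠ 0 := by positivity
  have h4 : (n : ℝ) * (d / n) = d := by field_simp
  rw [centredAdj]
  linarith

lemma devMatrix_edges {K E : SimpleGraph (Fin n)} (hE : E ≤ K) (p : ℝ) :
    devMatrix (edges K) p (edges E) = adjMat E - p • adjMat K := by
  ext u v
  by_cases h : K.Adj u v
  · simp [devMatrix, adjMat, h]
  · simp [devMatrix, adjMat, h, mt (@hE u v) h]

lemma norm_centredAdj_le_devMatrix (hn : 0 < n) {K : SimpleGraph (Fin n)} {d : ℕ} (hd : d ≤ n) :
    ‖centredAdj K d‖ ≤ ‖devMatrix (pairs (Fin n)) ((d : ℝ) / n) (edges K)‖ + 1 := by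
  have e : centredAdj K d = devMatrix (pairs (Fin n)) ((d : ℝ) / n) (edges K) -
      ((d : ℝ) / n) • (1 : Matrix (Fin n) (Fin n) ℝ) := by
    ext u v
    by_cases h : u = v
    · subst h; simp [devMatrix, adjMat, centredAdj]
    · simp [devMatrix, adjMat, centredAdj, h]
  rw [e]
  refine (norm_sub_le _ _).trans (add_le_add le_rfl ?_)
  have : Nonempty (Fin n) := ⟨⟨0, hn⟩⟩
  rw [norm_smul, Real.norm_of_nonneg (by positivity)]
  have h1 : ‖(1 : Matrix (Fin n) (Fin n) ℝ)‖ ≤ 1 := by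
    refine l2_opNorm_le_of_sum_le (fun u v => ?_) zero_le_one (fun u => ?_) fun v => ?_
    · rw [Matrix.one_apply]; split_ifs <;> norm_num
    · simp [Matrix.one_apply]
    · simp [Matrix.one_apply]
  have h2 : (d : ℝ) / n ≤ 1 := by
    rw [div_le_one (by positivity)]; exact_mod_cast hd
  exact mul_le_one₀ h2 (norm_nonneg _) h1

lemma mul_centred_eq {K E : SimpleGraph (Fin n)} (hn : 0 < n) {d : ℕ} (hK : IsRegularGraph K d)
    {p δ : ℝ} (hδ : p * (n - 1 - d) = δ) :
    adjMat E * adjMat K - Matrix.of (fun _ _ => δ * d / n) =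
      (adjMat E - p • adjMat Kᶜ) * adjMat K -
        p • (centredAdj K d + centredAdj K d * centredAdj K d) := by
  have hn' : (n : ℝ) ≠ 0 := by positivity
  have hcol : ∀ v, ∑ u, adjMat K u v = d := fun v => by
    rw [Finset.sum_congr rfl fun u _ => (adjMat_isSymm K).apply v u, sum_adjMat, hK v]
  have hcompl : ∀ u v, adjMat Kᶜ u v = 1 - (1 : Matrix (Fin n) (Fin n) ℝ) u v - adjMat K u v := by
    intro u v
    by_cases h : u = v
    · subst h; simp [adjMat]
    · by_cases h' : K.Adj u v <;> simp [adjMat, h, h']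
  have h1 : adjMat Kᶜ * adjMat K =
      Matrix.of (fun _ _ => (d : ℝ)) - adjMat K - adjMat K * adjMat K := by
    ext u v
    simp only [Matrix.mul_apply, hcompl, sub_mul, one_mul, Finset.sum_sub_distrib, hcol,
      Matrix.sub_apply, Matrix.of_apply]
    congr 2
    simp [Matrix.one_apply]
  have h2 : centredAdj K d * centredAdj K d =
      adjMat K * adjMat K - Matrix.of fun _ _ => (d : ℝ) ^ 2 / n := by
    ext u v
    simp only [centredAdj, Matrix.mul_apply, Matrix.sub_apply, Matrix.of_apply, sub_mul, mul_sub,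
      Finset.sum_sub_distrib, ← Finset.mul_sum, ← Finset.sum_mul, hcol, sum_adjMat, hK u,
      Finset.sum_const, Finset.card_univ, Fintype.card_fin, nsmul_eq_mul]
    field_simp
    ring
  rw [sub_mul, smul_mul_assoc, h1, h2, centredAdj, ← hδ]
  ext u v
  simp only [Matrix.sub_apply, Matrix.smul_apply, Matrix.add_apply, Matrix.of_apply, smul_eq_mul]
  field_simp
  ring

lemma norm_mul_centred_le {K E : SimpleGraph (Fin n)} (hn : 0 < n) {d : ℕ} (hd : 0 < d)
    (hK : IsRegularGraph K d) {p δ θ : ℝ} (hp : 0 ≤ p) (hδ0 : 0 < δ) (hδ : p * (n - 1 - d) = δ)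
    (hR : ‖adjMat E - p • adjMat Kᶜ‖ ≤ δ * θ / 2)
    (hA : p * (‖centredAdj K d‖ * (1 + ‖centredAdj K d‖)) ≤ δ * d * θ / 2) :
    ‖(δ⁻¹ • adjMat E) * ((d : ℝ)⁻¹ • adjMat K) - Matrix.of (fun _ _ => (n : ℝ)⁻¹)‖ ≤ θ := by
  have hd' : (0 : ℝ) < d := by exact_mod_cast hd
  have e : (δ⁻¹ • adjMat E) * ((d : ℝ)⁻¹ • adjMat K) - Matrix.of (fun _ _ => (n : ℝ)⁻¹) =
      (δ * d)⁻¹ • (adjMat E * adjMat K - Matrix.of (fun _ _ => δ * d / n)) := by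
    rw [smul_mul_assoc, mul_smul_comm, smul_smul, smul_sub]
    ext u v
    simp only [Matrix.sub_apply, Matrix.smul_apply, Matrix.of_apply, smul_eq_mul]
    have hn' : (n : ℝ) ≠ 0 := by positivity
    field_simp
  rw [e, norm_smul, Real.norm_of_nonneg (by positivity), inv_mul_le_iff₀ (by positivity),
    mul_centred_eq hn hK hδ]
  refine (norm_sub_le _ _).trans ?_
  have h1 : ‖(adjMat E - p • adjMat Kᶜ) * adjMat K‖ ≤ δ * θ / 2 * d :=
    (norm_mul_le _ _).trans (mul_le_mul hR (norm_adjMat_le hK) (norm_nonneg _)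
      ((norm_nonneg _).trans hR))
  have h2 : ‖p • (centredAdj K d + centredAdj K d * centredAdj K d)‖ ≤ δ * d * θ / 2 := by
    refine le_trans ?_ hA
    rw [norm_smul, Real.norm_of_nonneg hp, mul_add, mul_one]
    gcongr
    exact (norm_add_le _ _).trans (add_le_add le_rfl (norm_mul_le _ _))
  linarith

/-- Path counts in a pair of graphs with good expansion. -/
lemma altPathCount_bounds {K F : SimpleGraph (Fin n)} {d : ℕ} (hd : 0 < d)
    (hK : IsRegularGraph K d) {p δ θ κ η : ℝ} (hp : 0 ≤ p) (hδ0 : 0 < δ) (hθ0 : 0 ≤ θ)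
    (hδ : p * (n - 1 - d) = δ) (hdeg : ∀ u, |(deg (F \ K) u : ℝ) - δ| ≤ θ * δ)
    (hR : ‖adjMat (F \ K) - p • adjMat Kᶜ‖ ≤ δ * θ / 2)
    (hA : p * (‖centredAdj K d‖ * (1 + ‖centredAdj K d‖)) ≤ δ * d * θ / 2)
    (hκδ : δ⁻¹ ≤ κ) (hκd : (d : ℝ)⁻¹ ≤ κ) {k₁ k : ℕ} (hk₁ : 1 ≤ k₁)
    (hk : 3 * (2 * k₁ + 1) ≤ 2 * k) (hθk : θ ^ k₁ ≤ θ / n) (hθ : k * 8 ^ k * θ ≤ 1)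
    (hη : k * 8 ^ k * θ + (2 * k * (4 * k + 2) + 4 * k ^ 2) * (128 ^ k * κ) ≤ η)
    {x y : Fin n} (hxy : x ≠ y) {Z : Set (Fin n)} (hZ : Z.ncard ≤ 4 * k) :
    (1 - η) * δ ^ k * (d : ℝ) ^ k / n ≤ (altPathCount (F \ K) K (2 * k) x y Z : ℝ) ∧
      (altPathCount (F \ K) K (2 * k) x y Z : ℝ) ≤ (1 + η) * δ ^ k * (d : ℝ) ^ k / n := by
  have hd' : (0 : ℝ) < d := by exact_mod_cast hd
  have hn : 0 < n := Fin.pos x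
  have hn' : (0 : ℝ) < n := by exact_mod_cast hn
  have : Nonempty (Fin n) := ⟨x⟩
  have hN := norm_mul_centred_le hn hd hK hp hδ0 hδ hR hA
  have hκ0 : 0 ≤ κ := le_trans (by positivity) hκδ
  have key := altPathSum_sub_le (E := δ⁻¹ • adjMat (F \ K)) (A := (d : ℝ)⁻¹ • adjMat K) (κ := κ)
    (θ := θ) hθ0
    (fun u v => mul_nonneg (by positivity) (adjMat_nonneg _ _ _))
    (fun u v => mul_nonneg (by positivity) (adjMat_nonneg _ _ _))
    ((adjMat_isSymm _).smul _) ((adjMat_isSymm _).smul _)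
    (fun u v => (mul_le_of_le_one_right (by positivity) (adjMat_le_one _ _ _)).trans hκδ)
    (fun u v => (mul_le_of_le_one_right (by positivity) (adjMat_le_one _ _ _)).trans hκd)
    (fun u => by
      simp only [Matrix.smul_apply, smul_eq_mul, ← Finset.mul_sum, sum_adjMat]
      have e : δ⁻¹ * (deg (F \ K) u : ℝ) - 1 = δ⁻¹ * ((deg (F \ K) u : ℝ) - δ) := by
        field_simp
      rw [e, abs_mul, abs_of_pos (by positivity : 0 < δ⁻¹), inv_mul_le_iff₀ hδ0, mul_comm δ]
      exact hdeg u)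
    (fun u => by
      simp only [Matrix.smul_apply, smul_eq_mul, ← Finset.mul_sum, sum_adjMat, hK u]
      field_simp)
    (by simpa using hN) hk₁ hk (by simpa using hθk) hθ hxy Z.toFinset
  rw [altPathSum_eq_altPathCount, Fintype.card_fin] at key
  have hZ' : (Z.toFinset.card : ℝ) ≤ 4 * k := by
    rw [← Set.ncard_eq_toFinset_card']; exact_mod_cast hZ
  have hη' : k * 8 ^ k * θ + (2 * k * ((Z.toFinset.card : ℝ) + 2) + 4 * k ^ 2) * (128 ^ k * κ) ≤ η :=
    le_trans (by gcongr) hη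
  have key' := abs_le.1 (key.trans (div_le_div_of_nonneg_right hη' hn'.le))
  set c : ℝ := (altPathCount (F \ K) K (2 * k) x y Z : ℝ)
  have hD : 0 < δ ^ k * (d : ℝ) ^ k := by positivity
  have hcD : c * (δ⁻¹ ^ k * (d : ℝ)⁻¹ ^ k) * (δ ^ k * (d : ℝ) ^ k) = c := by
    rw [inv_pow, inv_pow]; field_simp
  have l1 : (1 - η) / n ≤ c * (δ⁻¹ ^ k * (d : ℝ)⁻¹ ^ k) := by
    rw [sub_div, one_div]; linarith [key'.1]
  have l2 : c * (δ⁻¹ ^ k * (d : ℝ)⁻¹ ^ k) ≤ (1 + η) / n := by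
    rw [add_div, one_div]; linarith [key'.2]
  constructor
  · rw [← hcD]
    calc _ = (1 - η) / n * (δ ^ k * (d : ℝ) ^ k) := by ring
      _ ≤ _ := mul_le_mul_of_nonneg_right l1 hD.le
  · rw [← hcD]
    calc _ ≤ (1 + η) / n * (δ ^ k * (d : ℝ) ^ k) := mul_le_mul_of_nonneg_right l2 hD.le
      _ = _ := by ring

end Deterministic

section Assembly

lemma edges_sup (G H : SimpleGraph (Fin n)) : edges (G ⊔ H) = edges G ∪ edges H := by
  ext e; simp

lemma edges_sdiff (G H : SimpleGraph (Fin n)) : edges (G \ H) = edges G \ edges H := by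
  ext e; simp

lemma edges_subset_pairs (G : SimpleGraph (Fin n)) : edges G ⊆ pairs (Fin n) := fun e he => by
  rw [mem_edges] at he
  exact mem_pairs.2 (G.not_isDiag_of_mem_edgeSet he)

lemma edges_compl (G : SimpleGraph (Fin n)) : edges Gᶜ = pairs (Fin n) \ edges G := by
  ext e
  induction e with
  | _ u v => simp

lemma edges_fromEdgeSet {t : Finset (Sym2 (Fin n))} (ht : t ⊆ pairs (Fin n)) :
    edges (SimpleGraph.fromEdgeSet (t : Set (Sym2 (Fin n)))) = t := by
  ext e
  simp only [mem_edges, SimpleGraph.edgeSet_fromEdgeSet, Set.mem_sdiff, Finset.mem_coe]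
  exact ⟨fun h => h.1, fun h => ⟨h, mem_pairs.1 (ht h)⟩⟩

lemma fromEdgeSet_edges (G : SimpleGraph (Fin n)) :
    SimpleGraph.fromEdgeSet (edges G : Set (Sym2 (Fin n))) = G := by
  have : (edges G : Set (Sym2 (Fin n))) = G.edgeSet := by ext e; simp
  rw [this, SimpleGraph.fromEdgeSet_edgeSet]

lemma card_pairs : (pairs (Fin n)).card = n.choose 2 := by
  have := Sym2.card_subtype_not_diag (α := Fin n)
  rw [Fintype.card_fin, Fintype.card_subtype] at this
  rw [pairs, ← this]

lemma card_edges_compl (G : SimpleGraph (Fin n)) :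
    (edges Gᶜ).card = n.choose 2 - edgeCount G := by
  rw [edges_compl, Finset.card_sdiff_of_subset (edges_subset_pairs G), card_pairs,
    edgeCount_eq_card]

lemma edges_mem_regularSets {G : SimpleGraph (Fin n)} {d : ℕ} :
    edges G ∈ regularSets (Fin n) d ↔ IsRegularGraph G d := by
  simp [regularSets, IsRegularGraph, deg_eq_card_nbr, edges_subset_pairs]

lemma subset_pairs_of_mem_regularSets {V : Type*} [Fintype V] [DecidableEq V]
    {t : Finset (Sym2 V)} {d : ℕ} (ht : t ∈ regularSets V d) : t ⊆ pairs V :=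
  Finset.mem_powerset.1 (Finset.mem_filter.1 ht).1

lemma edges_addition {K : SimpleGraph (Fin n)} {t : Finset (Sym2 (Fin n))} (ht : t ⊆ edges Kᶜ) :
    edges ((K ⊔ SimpleGraph.fromEdgeSet (t : Set (Sym2 (Fin n)))) \ K) = t := by
  have ht' := ht
  rw [edges_compl] at ht'
  rw [edges_sdiff, edges_sup, edges_fromEdgeSet (ht.trans (edges_subset_pairs _)),
    Finset.union_sdiff_left, Finset.sdiff_eq_self_iff_disjoint]
  exact Finset.disjoint_of_subset_left ht' Finset.sdiff_disjoint

lemma edgeCount_addition {K : SimpleGraph (Fin n)} {t : Finset (Sym2 (Fin n))}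
    (ht : t ⊆ edges Kᶜ) :
    edgeCount (K ⊔ SimpleGraph.fromEdgeSet (t : Set (Sym2 (Fin n)))) = edgeCount K + t.card := by
  have ht' := ht
  rw [edges_compl] at ht'
  rw [edgeCount_eq_card, edgeCount_eq_card, edges_sup,
    edges_fromEdgeSet (ht.trans (edges_subset_pairs _)), Finset.card_union_of_disjoint]
  exact (Finset.disjoint_of_subset_left ht' Finset.sdiff_disjoint).symm

lemma sum_addition_eq (K : SimpleGraph (Fin n)) (p : ℝ) (Q : SimpleGraph (Fin n) → Prop)
    [DecidablePred Q] :
    ∑ F, (if K ≤ F ∧ Q F then p ^ (edgeCount F - edgeCount K) *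
        (1 - p) ^ (n.choose 2 - edgeCount F) else 0) =
      bernProb (edges Kᶜ) p
        fun t => Q (K ⊔ SimpleGraph.fromEdgeSet (t : Set (Sym2 (Fin n)))) := by
  have e : ∀ F, (if K ≤ F ∧ Q F then p ^ (edgeCount F - edgeCount K) *
        (1 - p) ^ (n.choose 2 - edgeCount F) else 0) =
      if K ≤ F then (if Q F then p ^ (edgeCount F - edgeCount K) *
        (1 - p) ^ (n.choose 2 - edgeCount F) else 0) else 0 := fun F => ite_and _ _ _ _
  rw [Finset.sum_congr rfl fun F _ => e F, ← Finset.sum_filter, bernProb, bernExp]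
  refine Finset.sum_nbij' (fun F => edges (F \ K))
    (fun t => K ⊔ SimpleGraph.fromEdgeSet (t : Set (Sym2 (Fin n)))) ?_ ?_ ?_ ?_ ?_
  · intro F _
    rw [Finset.mem_powerset, edges_sdiff, edges_compl]
    exact Finset.sdiff_subset_sdiff (edges_subset_pairs F) le_rfl
  · intro t _
    simp
  · intro F hF
    rw [fromEdgeSet_edges]
    exact sup_sdiff_cancel_right (Finset.mem_filter.1 hF).2
  · intro t ht
    exact edges_addition (Finset.mem_powerset.1 ht)
  · intro F hF
    have hF' := (Finset.mem_filter.1 hF).2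
    have ht : edges (F \ K) ⊆ edges Kᶜ := by
      rw [edges_sdiff, edges_compl]
      exact Finset.sdiff_subset_sdiff (edges_subset_pairs F) le_rfl
    have hs : K ⊔ SimpleGraph.fromEdgeSet (edges (F \ K) : Set (Sym2 (Fin n))) = F := by
      rw [fromEdgeSet_edges]; exact sup_sdiff_cancel_right hF'
    have hc := edgeCount_addition ht
    rw [hs] at hc
    rw [hs, card_edges_compl, hc, Nat.add_sub_cancel_left, Nat.sub_sub]
    split_ifs <;> simp

/-- A union bound over the random regular graph and the random edges added to it. -/
lemma le_prEvent_of_bernProb_le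
    {ν : PMF (SimpleGraph (Fin n) × SimpleGraph (Fin n))} {d : ℕ} {p : ℝ} (hν : IsRegAddGnp ν d p)
    (h0 : 0 ≤ p) (h1 : p ≤ 1) {good : SimpleGraph (Fin n) × SimpleGraph (Fin n) → Prop}
    {Bad : SimpleGraph (Fin n) → Prop} {b b' : ℝ} (hb : 0 ≤ b) (hb' : 0 ≤ b')
    (hE : ∀ K, IsRegularGraph K d → ¬ Bad K → bernProb (edges Kᶜ) p (fun t =>
      ¬ good (K, K ⊔ SimpleGraph.fromEdgeSet (t : Set (Sym2 (Fin n))))) ≤ b)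
    (hB : (((regularSets (Fin n) d).filter fun t : Finset (Sym2 (Fin n)) =>
      Bad (SimpleGraph.fromEdgeSet (t : Set (Sym2 (Fin n))))).card : ℝ) ≤
        b' * (regularSets (Fin n) d).card) :
    ENNReal.ofReal (1 - (b + b')) ≤ prEvent ν good := by
  set S := regularSets (Fin n) d
  have hR : {G : SimpleGraph (Fin n) | IsRegularGraph G d}.ncard = S.card := by
    rw [← Set.ncard_coe_finset]
    refine Set.ncard_congr (fun G _ => edges G) (fun G hG => edges_mem_regularSets.2 hG)
      (fun G H _ _ h => ?_) fun t ht => ?_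
    · rw [← fromEdgeSet_edges G, h, fromEdgeSet_edges]
    · have ht' := edges_fromEdgeSet (subset_pairs_of_mem_regularSets ht)
      exact ⟨_, edges_mem_regularSets.1 (ht'.symm ▸ ht), ht'⟩
  have hval : ∀ w, (ν w).toReal = if IsRegularGraph w.1 d ∧ w.1 ≤ w.2 then
      (S.card : ℝ)⁻¹ * (p ^ (edgeCount w.2 - edgeCount w.1) *
        (1 - p) ^ (n.choose 2 - edgeCount w.2)) else 0 := by
    intro w
    rw [hν w, hR]
    split_ifs
    · have : 0 ≤ 1 - p := by linarith
      rw [ENNReal.toReal_mul, ENNReal.toReal_inv, ENNReal.toReal_natCast,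
        ENNReal.toReal_ofReal (by positivity)]
    · rfl
  have hsum : ∑ w, (ν w).toReal = 1 := by
    have h := ν.tsum_coe
    rw [tsum_fintype] at h
    rw [← ENNReal.toReal_sum fun w _ => ν.apply_ne_top w, h, ENNReal.toReal_one]
  have hpr : prEvent ν good = ENNReal.ofReal (∑ w, if good w then (ν w).toReal else 0) := by
    rw [prEvent, tsum_fintype, ENNReal.ofReal_sum_of_nonneg]
    · refine Finset.sum_congr rfl fun w _ => ?_
      split_ifs
      · rw [ENNReal.ofReal_toReal (ν.apply_ne_top w)]
      · simp
    · intro w _; split_ifs <;> simp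
  rw [hpr]
  refine ENNReal.ofReal_le_ofReal ?_
  have hsplit : ∑ w, (ν w).toReal = (∑ w, if good w then (ν w).toReal else 0) +
      ∑ w, if ¬ good w then (ν w).toReal else 0 := by
    rw [← Finset.sum_add_distrib]
    refine Finset.sum_congr rfl fun w _ => ?_
    by_cases h : good w <;> simp [h]
  have hinner : ∀ K, ∑ F, (if ¬ good (K, F) then (ν (K, F)).toReal else 0) ≤
      if IsRegularGraph K d then (S.card : ℝ)⁻¹ * ((if Bad K then 1 else 0) + b) else 0 := by
    intro K
    by_cases hK : IsRegularGraph K d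
    · rw [if_pos hK]
      have e : ∀ F, (if ¬ good (K, F) then (ν (K, F)).toReal else 0) =
          (S.card : ℝ)⁻¹ * (if K ≤ F ∧ ¬ good (K, F) then p ^ (edgeCount F - edgeCount K) *
            (1 - p) ^ (n.choose 2 - edgeCount F) else 0) := by
        intro F
        rw [hval]
        by_cases h : K ≤ F <;> by_cases h' : good (K, F) <;> simp [h, h', hK]
      rw [Finset.sum_congr rfl fun F _ => e F, ← Finset.mul_sum,
        sum_addition_eq K p fun F => ¬ good (K, F)]
      refine mul_le_mul_of_nonneg_left ?_ (inv_nonneg.2 (Nat.cast_nonneg _))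
      by_cases h : Bad K
      · rw [if_pos h]
        linarith [bernProb_le_one (s := edges Kᶜ) h0 h1 fun t =>
          ¬ good (K, K ⊔ SimpleGraph.fromEdgeSet (t : Set (Sym2 (Fin n))))]
      · rw [if_neg h, zero_add]; exact hE K hK h
    · rw [if_neg hK]
      refine le_of_eq (Finset.sum_eq_zero fun F _ => ?_)
      rw [hval, if_neg (c := IsRegularGraph K d ∧ K ≤ F) fun h => hK h.1, ite_self]
  have hbad : ∑ w, (if ¬ good w then (ν w).toReal else 0) ≤ b + b' := by
    rw [Fintype.sum_prod_type]
    refine (Finset.sum_le_sum fun K _ => hinner K).trans ?_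
    have e : ∑ K : SimpleGraph (Fin n), (if IsRegularGraph K d then
          (S.card : ℝ)⁻¹ * ((if Bad K then 1 else 0) + b) else 0) =
        ∑ t ∈ S, (S.card : ℝ)⁻¹ *
          ((if Bad (SimpleGraph.fromEdgeSet (t : Set (Sym2 (Fin n)))) then 1 else 0) + b) := by
      rw [← Finset.sum_filter]
      refine Finset.sum_nbij' edges (fun t => SimpleGraph.fromEdgeSet (t : Set (Sym2 (Fin n))))
        ?_ ?_ ?_ ?_ ?_
      · intro G hG
        exact edges_mem_regularSets.2 (Finset.mem_filter.1 hG).2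
      · intro t ht
        have ht' := edges_fromEdgeSet (subset_pairs_of_mem_regularSets ht)
        exact Finset.mem_filter.2 ⟨Finset.mem_univ _, edges_mem_regularSets.1 (ht'.symm ▸ ht)⟩
      · exact fun G _ => fromEdgeSet_edges G
      · exact fun t ht => edges_fromEdgeSet (subset_pairs_of_mem_regularSets ht)
      · intro G _
        rw [fromEdgeSet_edges]
    rw [e, ← Finset.mul_sum, Finset.sum_add_distrib, Finset.sum_boole, Finset.sum_const,
      nsmul_eq_mul]
    rcases S.card.eq_zero_or_pos with h | h
    · rw [h, Nat.cast_zero, inv_zero, zero_mul]; exact add_nonneg hb hb'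
    · rw [inv_mul_le_iff₀ (by exact_mod_cast h)]
      linarith
  linarith

end Assembly

section PseudorandomRegular

open scoped Matrix.Norms.L2Operator

variable {d : ℕ} {s : ℝ}

lemma bernProb_near_regular_le (hs : 1 ≤ s) (hsn : s ^ 80 = n) (hd : d + 1 ≤ n)
    (hnear : 4 * s ^ 80 * Real.exp (-(s ^ 16 / 4)) ≤ 1) :
    bernProb (pairs (Fin n)) ((d : ℝ) / n) (fun t => ∃ u,
      ((⌊s ^ 48 + 1⌋₊ : ℕ) : ℤ) < |((nbr t u).card : ℤ) - d|) ≤ 1 / 2 := by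
  have hn : (0 : ℝ) < n := by rw [← hsn]; positivity
  have hdn : (d : ℝ) + 1 ≤ n := by exact_mod_cast hd
  have q0 : 0 ≤ (d : ℝ) / n := by positivity
  have q1 : (d : ℝ) / n ≤ 1 := by rw [div_le_one hn]; linarith
  have hS : ∀ u, ((nbr (pairs (Fin n)) u).card : ℝ) = n - 1 := fun u => by
    rw [card_nbr_pairs, Fintype.card_fin, Nat.cast_sub (by omega), Nat.cast_one]
  have hs32 : (0 : ℝ) < s ^ 32 := by positivity
  have hl : 1 / (2 * s ^ 32) ≤ 1 := by
    rw [div_le_one (by positivity)]; linarith [one_le_pow₀ hs (n := 32)]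
  refine ((bernProb_mono q0 q1 fun t _ ht => ?_).trans (bernProb_degree_le (s := pairs (Fin n))
    q0 q1 (l := 1 / (2 * s ^ 32)) (S := s ^ 80) (T := s ^ 48) (by positivity) hl fun u => ?_)).trans ?_
  · obtain ⟨u, hu⟩ := ht
    refine ⟨u, ?_⟩
    have h1 : s ^ 48 + 1 < |((nbr t u).card : ℝ) - d| := by
      refine (Nat.lt_floor_add_one _).trans_le ?_
      have : ((⌊s ^ 48 + 1⌋₊ : ℕ) : ℤ) + 1 ≤ |((nbr t u).card : ℤ) - d| := hu
      exact_mod_cast this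
    have h2 : (d : ℝ) / n * (n - 1) = d - d / n := by field_simp
    rw [hS, h2]
    have h3 := abs_sub_abs_le_abs_sub (((nbr t u).card : ℝ) - d) (-((d : ℝ) / n))
    rw [abs_neg, abs_of_nonneg q0, show ((nbr t u).card : ℝ) - d - -((d : ℝ) / n) =
      (nbr t u).card - (d - d / n) by ring] at h3
    linarith
  · rw [hS, hsn]; linarith
  · rw [Fintype.card_fin]
    have h1 : -(1 / (2 * s ^ 32) * s ^ 48) + (1 / (2 * s ^ 32)) ^ 2 * ((d : ℝ) / n * s ^ 80) ≤
        -(s ^ 16 / 4) := by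
      have e1 : 1 / (2 * s ^ 32) * s ^ 48 = s ^ 16 / 2 := by field_simp
      have e2 : (1 / (2 * s ^ 32)) ^ 2 * s ^ 80 = s ^ 16 / 4 := by field_simp; norm_num
      have e3 : (1 / (2 * s ^ 32)) ^ 2 * ((d : ℝ) / n * s ^ 80) ≤ s ^ 16 / 4 := by
        rw [← e2]
        gcongr
        exact mul_le_of_le_one_left (by positivity) q1
      linarith
    have h2 := mul_le_mul_of_nonneg_left (Real.exp_le_exp.2 h1) (by positivity : 0 ≤ 2 * s ^ 80)
    rw [hsn] at h2 hnear ⊢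
    linarith

/-- Almost every regular graph is pseudorandom. -/
lemma card_regular_norm_bad_le (hs : 1 ≤ s) (hsn : s ^ 80 = n) (hd0 : 1 ≤ d) (hd : d + 1 ≤ n)
    (he : Even (d * n)) (hnear : 4 * s ^ 80 * Real.exp (-(s ^ 16 / 4)) ≤ 1)
    (hlarge : 12000 ≤ s ^ 3) :
    (((regularSets (Fin n) d).filter fun t =>
      ¬ ‖devMatrix (pairs (Fin n)) ((d : ℝ) / n) t‖ ^ 4 ≤ 4 * s ^ 306).card : ℝ) ≤
        4 * Real.exp (-s) * (regularSets (Fin n) d).card := by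
  have hn : (0 : ℝ) < n := by rw [← hsn]; positivity
  have hdn : (d : ℝ) + 1 ≤ n := by exact_mod_cast hd
  have hd0' : (1 : ℝ) ≤ d := by exact_mod_cast hd0
  have q0 : 0 ≤ (d : ℝ) / n := by positivity
  have q1 : (d : ℝ) / n ≤ 1 := by rw [div_le_one hn]; linarith
  obtain ⟨M, hM⟩ := he
  have h1 := card_regular_bad_le (V := Fin n) (d := d) (D := ⌊s ^ 48 + 1⌋₊) (M := M)
    (q := (d : ℝ) / n) (X := n) (by simpa using hd) (by rw [Fintype.card_fin, hM]; ring) q0 q1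
    (by linarith) (by rw [mul_div_cancel₀ _ hn.ne']; exact hd0')
    (by rw [mul_sub, mul_div_cancel₀ _ hn.ne']; linarith)
    (by rw [card_pairs, Nat.cast_choose_two]; nlinarith)
    (bernProb_near_regular_le hs hsn hd hnear)
    (fun t => ¬ ‖devMatrix (pairs (Fin n)) ((d : ℝ) / n) t‖ ^ 4 ≤ 4 * s ^ 306)
  refine le_trans (le_of_eq (by congr!)) (h1.trans (mul_le_mul_of_nonneg_right ?_
    (Nat.cast_nonneg _)))
  have h2 := bernProb_norm_le_of_cut (V := Fin n) (s := pairs (Fin n)) q0 q1 (T := s ^ 146)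
    (l := 1 / (4 * s ^ 14)) (by positivity) (by
      rw [div_mul_eq_mul_div, one_mul, div_le_one (by positivity)]
      linarith [one_le_pow₀ hs (n := 14)])
  rw [Fintype.card_fin, ← hsn, show (s ^ 80) ^ 2 * (4 * s ^ 146) = 4 * s ^ 306 by ring, hsn] at h2
  have h3 : -(1 / (4 * s ^ 14) * s ^ 146) +
      (1 / (4 * s ^ 14)) ^ 2 * ((d : ℝ) / n * (2 * (s ^ 80) ^ 2)) ≤ -(s ^ 132 / 8) := by
    have e1 : 1 / (4 * s ^ 14) * s ^ 146 = s ^ 132 / 4 := by field_simp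
    have e2 : (1 / (4 * s ^ 14)) ^ 2 * (2 * (s ^ 80) ^ 2) = s ^ 132 / 8 := by field_simp; norm_num
    have e3 : (1 / (4 * s ^ 14)) ^ 2 * ((d : ℝ) / n * (2 * (s ^ 80) ^ 2)) ≤ s ^ 132 / 8 := by
      rw [← e2]
      exact mul_le_mul_of_nonneg_left (mul_le_of_le_one_left (by positivity) q1) (by positivity)
    linarith
  rw [hsn] at h3
  have h4 : (4 : ℝ) ^ n ≤ Real.exp (2 * s ^ 80) := by
    rw [hsn, show (2 : ℝ) * n = n * 2 by ring, Real.exp_nat_mul]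
    refine pow_le_pow_left₀ (by norm_num) ?_ _
    have := Real.exp_one_gt_d9
    rw [show (2 : ℝ) = 1 + 1 by norm_num, Real.exp_add]
    nlinarith
  have h5 : (n : ℝ) ^ (9 * (n * ⌊s ^ 48 + 1⌋₊)) ≤ Real.exp (1440 * s ^ 129) := by
    rw [← Real.exp_log (pow_pos hn _), Real.log_pow, Real.exp_le_exp]
    have hlog : Real.log n ≤ 80 * s := by
      rw [← hsn, Real.log_pow]
      have := Real.log_le_self (by linarith : 0 ≤ s)
      push_cast; linarith
    have hfl : ((⌊s ^ 48 + 1⌋₊ : ℕ) : ℝ) ≤ 2 * s ^ 48 := by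
      have := Nat.floor_le (by positivity : 0 ≤ s ^ 48 + 1)
      linarith [one_le_pow₀ hs (n := 48)]
    push_cast
    calc 9 * ((n : ℝ) * (⌊s ^ 48 + 1⌋₊ : ℕ)) * Real.log n ≤
        9 * ((n : ℝ) * (2 * s ^ 48)) * (80 * s) := by gcongr
      _ = _ := by rw [← hsn]; ring
  have h6 : 1440 * s ^ 129 + (2 * s ^ 80 + -(s ^ 132 / 8)) ≤ -s := by
    have i1 : s ^ 80 ≤ s ^ 129 := pow_le_pow_right₀ hs (by norm_num)
    have i2 : s ≤ s ^ 129 := by simpa using pow_le_pow_right₀ hs (show 1 ≤ 129 by norm_num)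
    have i3 : 12000 * s ^ 129 ≤ s ^ 132 := by
      rw [show s ^ 132 = s ^ 3 * s ^ 129 by ring]
      gcongr
    linarith
  have h2' := h2.trans (mul_le_mul h4 (mul_le_mul_of_nonneg_left (Real.exp_le_exp.2 h3) zero_le_two)
    (by positivity) (by positivity))
  calc _ ≤ 2 * Real.exp (1440 * s ^ 129) * (Real.exp (2 * s ^ 80) *
        (2 * Real.exp (-(s ^ 132 / 8)))) :=
        mul_le_mul (by rw [Fintype.card_fin]; gcongr) h2' (bernProb_nonneg q0 q1 _) (by positivity)
    _ = 4 * Real.exp (1440 * s ^ 129 + (2 * s ^ 80 + -(s ^ 132 / 8))) := by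
        rw [Real.exp_add, Real.exp_add]; ring
    _ ≤ _ := by gcongr

end PseudorandomRegular

section FixedSize

open scoped Matrix.Norms.L2Operator

variable {d m : ℕ} {ε δ p θ s : ℝ}

lemma card_nbr_edges_compl {K : SimpleGraph (Fin n)} (hK : IsRegularGraph K d) (u : Fin n) :
    ((nbr (edges Kᶜ) u).card : ℝ) = n - 1 - d := by
  have e : nbr (edges Kᶜ) u = nbr (pairs (Fin n)) u \ nbr (edges K) u := by
    ext w; simp [edges_compl]
  have hsub : nbr (edges K) u ⊆ nbr (pairs (Fin n)) u := fun w hw => by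
    rw [mem_nbr] at hw ⊢; exact edges_subset_pairs K hw
  have h := Finset.card_sdiff_add_card_eq_card hsub
  rw [← e, card_nbr_pairs, Fintype.card_fin, ← deg_eq_card_nbr K, hK u] at h
  have hn : 1 ≤ n := Fin.pos u
  have h' : ((nbr (edges Kᶜ) u).card : ℝ) + d = ((n - 1 : ℕ) : ℝ) := by exact_mod_cast h
  rw [Nat.cast_sub hn, Nat.cast_one] at h'
  linarith

lemma edge_probability_bounds (hε0 : 0 < ε) (hε1 : ε ≤ 1) (hm1 : ε * d * n / 2 ≤ (m : ℝ))
    (hm2 : (m : ℝ) ≤ (n.choose 2 : ℝ) - d * n / 2) (hδ : δ = 2 * (m : ℝ) / n) (hδ1 : 1 ≤ δ)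
    (hp : p = (m : ℝ) / ((n.choose 2 : ℝ) - d * n / 2)) :
    0 ≤ p ∧ p ≤ 1 ∧ p * (n - 1 - d) = δ ∧ d + 1 ≤ n ∧ n * p ≤ 4 * δ / ε ∧ 1 ≤ n * p := by
  have hn : (0 : ℝ) < n := by
    rcases (Nat.cast_nonneg n : (0 : ℝ) ≤ n).lt_or_eq with h | h
    · exact h
    · rw [← h, div_zero] at hδ; linarith
  have hm : (m : ℝ) = δ * n / 2 := by rw [hδ]; field_simp
  have hN : (n.choose 2 : ℝ) - d * n / 2 = n * (n - 1 - d) / 2 := by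
    rw [Nat.cast_choose_two]; ring
  rw [hN] at hm2 hp
  set y : ℝ := n - 1 - d with hy
  have hδy : δ ≤ y := by
    rw [hm] at hm2
    exact le_of_mul_le_mul_left (by linarith) hn
  have hy0 : 0 < y := by linarith
  have hdδ : ε * d ≤ δ := by
    rw [hm] at hm1
    exact le_of_mul_le_mul_left (by linarith) hn
  have hpy : p = δ / y := by rw [hp, hm]; field_simp
  have hpy' : p * y = δ := by rw [hpy]; field_simp
  have hp0 : 0 ≤ p := by rw [hpy]; positivity
  have hny : ε * n ≤ 4 * y := by
    have : (n : ℝ) = y + 1 + d := by rw [hy]; ring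
    rw [this]
    nlinarith
  refine ⟨hp0, by rw [hpy, div_le_one hy0]; exact hδy, hpy', ?_, ?_, ?_⟩
  · have : (d : ℝ) + 1 ≤ n := by linarith
    exact_mod_cast this
  · rw [le_div_iff₀ hε0, ← hpy']
    calc n * p * ε = p * (ε * n) := by ring
      _ ≤ p * (4 * y) := by gcongr
      _ = _ := by ring
  · have : p * y ≤ p * n := by
      gcongr; rw [hy]; linarith [(Nat.cast_nonneg d : (0 : ℝ) ≤ d)]
    linarith

lemma norm_dev_tail_le (hε0 : 0 < ε) (hδ0 : 0 < δ) (hθ0 : 0 < θ) (hp0 : 0 ≤ p)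
    (hnp : n * p ≤ 4 * δ / ε) (r : ℕ) (A : ℝ) (hA : 0 ≤ A) :
    A * (n * (n * p) ^ r) / (δ * θ / 2) ^ (2 * r) ≤ A * n * (16 / (ε * (δ * θ ^ 2))) ^ r := by
  have h1 : (n * p) ^ r ≤ (4 * δ / ε) ^ r := pow_le_pow_left₀ (by positivity) hnp r
  have h2 : (4 * δ / ε) / (δ * θ / 2) ^ 2 = 16 / (ε * (δ * θ ^ 2)) := by field_simp; norm_num
  calc A * (n * (n * p) ^ r) / (δ * θ / 2) ^ (2 * r)
      ≤ A * (n * (4 * δ / ε) ^ r) / (δ * θ / 2) ^ (2 * r) := by gcongr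
    _ = A * n * ((4 * δ / ε) ^ r / ((δ * θ / 2) ^ 2) ^ r) := by rw [← pow_mul]; ring
    _ = _ := by rw [← div_pow, h2]

lemma centred_error_le (hs : 1 ≤ s) (hsn : s ^ 80 = n) (hε0 : 0 < ε) (hδ0 : 0 < δ)
    (hsθ : 1 ≤ s * θ) (hnp : n * p ≤ 4 * δ / ε) (hsε : 288 ≤ ε * s ^ 2) (hd : 1 ≤ d)
    (hdn : d + 1 ≤ n) {K : SimpleGraph (Fin n)} (hK : IsRegularGraph K d)
    (hdense : s ^ 76 ≤ d → ‖devMatrix (pairs (Fin n)) ((d : ℝ) / n) (edges K)‖ ^ 4 ≤ 4 * s ^ 306) :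
    p * (‖centredAdj K d‖ * (1 + ‖centredAdj K d‖)) ≤ δ * d * θ / 2 := by
  have hn : (0 : ℝ) < n := by rw [← hsn]; positivity
  have hd1 : (1 : ℝ) ≤ d := by exact_mod_cast hd
  set a := ‖centredAdj K d‖
  have ha0 : 0 ≤ a := norm_nonneg _
  suffices h : 8 * (a * (1 + a)) ≤ ε * (n * d * θ) by
    have h1 : n * p * ε ≤ 4 * δ := (le_div_iff₀ hε0).1 hnp
    have h2 : ε * n * (p * (a * (1 + a))) ≤ ε * n * (δ * d * θ / 2) := by
      calc ε * n * (p * (a * (1 + a))) = (n * p * ε) * (a * (1 + a)) := by ring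
        _ ≤ 4 * δ * (a * (1 + a)) := by gcongr
        _ = δ / 2 * (8 * (a * (1 + a))) := by ring
        _ ≤ δ / 2 * (ε * (n * d * θ)) := by gcongr
        _ = _ := by ring
    exact le_of_mul_le_mul_left h2 (by positivity)
  have hθ : s ^ 79 ≤ n * θ := by
    rw [← hsn]
    calc s ^ 79 = s ^ 79 * 1 := by ring
      _ ≤ s ^ 79 * (s * θ) := by gcongr
      _ = _ := by ring
  rcases lt_or_ge (d : ℝ) (s ^ 76) with h | h
  · have ha : a ≤ 2 * d := norm_centredAdj_le (by omega) hK
    calc 8 * (a * (1 + a)) ≤ 8 * (2 * d * (d + 2 * d)) := by gcongr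
      _ = 48 * d * d := by ring
      _ ≤ 48 * s ^ 76 * d := by gcongr
      _ ≤ (ε * s ^ 2) * s ^ 77 * d := by
          gcongr
          · linarith
          · norm_num
      _ = ε * s ^ 79 * d := by ring
      _ ≤ ε * (n * θ) * d := by gcongr
      _ = _ := by ring
  · have hA4 := hdense h
    have ha := norm_centredAdj_le_devMatrix (n := n) (by omega) (K := K) (d := d) (by omega)
    set A := ‖devMatrix (pairs (Fin n)) ((d : ℝ) / n) (edges K)‖
    have hA0 : 0 ≤ A := norm_nonneg _
    have hA2 : A ^ 2 ≤ 2 * s ^ 153 := by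
      refine le_of_sq_le_sq ?_ (by positivity)
      calc (A ^ 2) ^ 2 = A ^ 4 := by ring
        _ ≤ 4 * s ^ 306 := hA4
        _ = _ := by ring
    have h1 : 1 ≤ s ^ 153 := one_le_pow₀ hs
    calc 8 * (a * (1 + a)) ≤ 8 * ((A + 1) * (1 + (A + 1))) := by gcongr
      _ ≤ 144 * s ^ 153 := by nlinarith [sq_nonneg (A - 1)]
      _ ≤ (ε * s ^ 2) * s ^ 153 := by gcongr; linarith
      _ = ε * (s ^ 79 * s ^ 76) := by ring
      _ ≤ ε * (n * θ * d) :=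
          mul_le_mul_of_nonneg_left (mul_le_mul hθ h (by positivity)
            ((by positivity : 0 ≤ s ^ 79).trans hθ)) hε0.le
      _ = _ := by ring

/-- The switching-path estimate for a fixed number of vertices, with all error terms explicit. -/
lemma switching_paths_of_bounds {k k₁ j : ℕ} {κ η β : ℝ} (hs : 1 ≤ s) (hsn : s ^ 80 = n)
    (hε0 : 0 < ε) (hε1 : ε ≤ 1) (hd : 1 ≤ d) (he : Even (d * n))
    (hm1 : ε * d * n / 2 ≤ (m : ℝ)) (hm2 : (m : ℝ) ≤ (n.choose 2 : ℝ) - d * n / 2)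
    (hδ : δ = 2 * (m : ℝ) / n) (hδ1 : 1 ≤ δ)
    (hp : p = (m : ℝ) / ((n.choose 2 : ℝ) - d * n / 2))
    (hθ0 : 0 < θ) (hθ1 : θ ≤ 1) (hsθ : 1 ≤ s * θ)
    (hκδ : δ⁻¹ ≤ κ) (hκd : (d : ℝ)⁻¹ ≤ κ) (hk₁ : 1 ≤ k₁) (hk : 3 * (2 * k₁ + 1) ≤ 2 * k)
    (hθk : θ ^ k₁ ≤ θ / n) (hθ : k * 8 ^ k * θ ≤ 1)
    (hη : k * 8 ^ k * θ + (2 * k * (4 * k + 2) + 4 * k ^ 2) * (128 ^ k * κ) ≤ η)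
    (hsε : 288 ≤ ε * s ^ 2) (hnear : 4 * s ^ 80 * Real.exp (-(s ^ 16 / 4)) ≤ 1)
    (hlarge : 12000 ≤ s ^ 3)
    (hβ : n * (2 * Real.exp (-(θ ^ 2 * δ / 4))) + (2 * 2 ^ j + 1) ^ (2 * 2 ^ j + 2) * n *
      (16 / (ε * (δ * θ ^ 2))) ^ 2 ^ j + 4 * Real.exp (-s) ≤ β)
    {ν : PMF (SimpleGraph (Fin n) × SimpleGraph (Fin n))} (hν : IsRegAddGnp ν d p) :
    ENNReal.ofReal (1 - β) ≤ prEvent ν (fun w => ∀ x y : Fin n, x ≠ y →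
      ∀ Z : Set (Fin n), Z.ncard ≤ 4 * k →
        (1 - η) * δ ^ k * (d : ℝ) ^ k / n ≤ (altPathCount (w.2 \ w.1) w.1 (2 * k) x y Z : ℝ) ∧
          (altPathCount (w.2 \ w.1) w.1 (2 * k) x y Z : ℝ) ≤
            (1 + η) * δ ^ k * (d : ℝ) ^ k / n) := by
  obtain ⟨hp0, hp1, hpδ, hdn, hnp, hnp1⟩ := edge_probability_bounds hε0 hε1 hm1 hm2 hδ hδ1 hp
  have hδ0 : 0 < δ := by linarith
  have : Nonempty (Fin n) := ⟨⟨0, by omega⟩⟩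
  refine (ENNReal.ofReal_le_ofReal (sub_le_sub_left hβ 1)).trans
    (le_prEvent_of_bernProb_le hν hp0 hp1 (Bad := fun K => s ^ 76 ≤ d ∧
      ¬ ‖devMatrix (pairs (Fin n)) ((d : ℝ) / n) (edges K)‖ ^ 4 ≤ 4 * s ^ 306)
    (by positivity) (by positivity) (fun K hK hbad => ?_) ?_)
  · have hA := centred_error_le hs hsn hε0 hδ0 hsθ hnp hsε hd hdn hK
      fun h => not_not.1 fun h' => hbad ⟨h, h'⟩
    have hdeg := bernProb_degree_le (s := edges Kᶜ) hp0 hp1 (l := θ / 2) (S := n - 1 - d)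
      (T := θ * δ) (by positivity) (by linarith) fun u => (card_nbr_edges_compl hK u).le
    have hnorm := bernProb_norm_le (s := edges Kᶜ) hp0 hp1 (by rwa [Fintype.card_fin]) j
      (T := δ * θ / 2) (by positivity)
    rw [Fintype.card_fin, hpδ, show -(θ / 2 * (θ * δ)) + (θ / 2) ^ 2 * δ = -(θ ^ 2 * δ / 4) by ring]
      at hdeg
    rw [Fintype.card_fin] at hnorm
    refine ((bernProb_mono hp0 hp1 fun t ht hbad' => ?_).trans (bernProb_or_le hp0 hp1 _ _)).trans
      (add_le_add hdeg (hnorm.trans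
        (norm_dev_tail_le hε0 hδ0 hθ0 hp0 hnp (2 ^ j) _ (by positivity))))
    by_contra! hgood
    refine hbad' fun x y hxy Z hZ => ?_
    have hle : (K ⊔ SimpleGraph.fromEdgeSet (t : Set (Sym2 (Fin n)))) \ K ≤ Kᶜ := fun u v h => by
      rw [SimpleGraph.sdiff_adj] at h; exact (SimpleGraph.compl_adj _ _ _).2 ⟨h.1.ne, h.2⟩
    have hdev := devMatrix_edges hle p
    rw [edges_addition ht] at hdev
    refine altPathCount_bounds hd hK hp0 hδ0 hθ0.le hpδ (fun u => ?_) ?_ hA hκδ hκd hk₁ hk hθk hθ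
      hη hxy hZ
    · have := (hgood.1 u).le
      rwa [card_nbr_edges_compl hK, hpδ, ← edges_addition ht, ← deg_eq_card_nbr] at this
    · rw [← hdev]; exact hgood.2.le
  · by_cases h : s ^ 76 ≤ (d : ℝ)
    · refine le_trans ?_ (card_regular_norm_bad_le hs hsn hd hdn he hnear hlarge)
      norm_cast
      refine Finset.card_le_card fun t ht => ?_
      rw [Finset.mem_filter] at ht ⊢
      refine ⟨ht.1, ?_⟩
      have := ht.2.2
      rwa [edges_fromEdgeSet (subset_pairs_of_mem_regularSets ht.1)] at this
    · simp only [h, false_and, Finset.filter_false, Finset.card_empty, Nat.cast_zero]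
      positivity

end FixedSize

section Asymptotics

open Filter Topology

lemma tendsto_pow_mul_exp_neg_rpow {a b : ℝ} (ha : 0 < a) (hb : 0 < b) (K : ℕ) :
    Tendsto (fun n : ℕ => (n : ℝ) ^ K * Real.exp (-(b * (n : ℝ) ^ a))) atTop (𝓝 0) := by
  refine ((tendsto_rpow_mul_exp_neg_mul_atTop_nhds_zero (K / a) b hb).comp
    ((tendsto_rpow_atTop ha).comp tendsto_natCast_atTop_atTop)).congr fun n => ?_
  simp only [Function.comp_apply, neg_mul]
  rw [← Real.rpow_mul (Nat.cast_nonneg n), mul_div_cancel₀ _ ha.ne', Real.rpow_natCast]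

lemma eventually_mul_log_le_rpow {a : ℝ} (ha : 0 < a) (B : ℝ) :
    ∀ᶠ n : ℕ in atTop, B * Real.log n ≤ (n : ℝ) ^ a := by
  have h := ((isLittleO_log_rpow_atTop ha).const_mul_left B).bound zero_lt_one
  filter_upwards [tendsto_natCast_atTop_atTop.eventually h] with n hn
  rw [one_mul, Real.norm_eq_abs, Real.norm_of_nonneg (by positivity)] at hn
  exact (le_abs_self _).trans hn

lemma eventually_failure_le {σ ε c A : ℝ} (hσ : 0 < σ) (hε : 0 < ε) (hc : 0 < c) (hA : 0 ≤ A)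
    {r : ℕ} (hr : 13 ≤ σ * r) :
    ∀ᶠ n : ℕ in atTop, ∀ δ : ℝ, (n : ℝ) ^ σ ≤ δ →
      n * (2 * Real.exp (-(((n : ℝ) ^ (-(σ / 100))) ^ 2 * δ / 4))) +
        A * n * (16 / (ε * (δ * ((n : ℝ) ^ (-(σ / 100))) ^ 2))) ^ r +
        4 * Real.exp (-((n : ℝ) ^ (1 / 80 : ℝ))) ≤ c / (n : ℝ) ^ 10 := by
  have t1 := (tendsto_pow_mul_exp_neg_rpow (a := 98 * σ / 100) (b := 1 / 4) (by positivity)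
    (by norm_num) 11).eventually_lt_const (u := c / 6) (by positivity)
  have t2 := (tendsto_pow_mul_exp_neg_rpow (a := 1 / 80) (b := 1) (by norm_num)
    one_pos 10).eventually_lt_const (u := c / 12) (by positivity)
  have t3 := tendsto_natCast_atTop_atTop.eventually_ge_atTop (A * (16 / ε) ^ r * 3 / c)
  filter_upwards [t1, t2, t3, eventually_ge_atTop 1] with n h1 h2 h3 hn δ hδ
  have hn0 : (0 : ℝ) < n := by exact_mod_cast hn
  have hn1 : (1 : ℝ) ≤ n := by exact_mod_cast hn
  set θ : ℝ := (n : ℝ) ^ (-(σ / 100))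
  set w : ℝ := (n : ℝ) ^ (98 * σ / 100) with hw
  have hw0 : 0 < w := by positivity
  have hwδ : w ≤ δ * θ ^ 2 := by
    have : w = (n : ℝ) ^ σ * θ ^ 2 := by
      rw [← Real.rpow_natCast, ← Real.rpow_mul hn0.le, ← Real.rpow_add hn0, hw]
      congr 1
      push_cast
      ring
    rw [this]
    gcongr
  have e1 : n * (2 * Real.exp (-(θ ^ 2 * δ / 4))) * (n : ℝ) ^ 10 ≤ c / 3 := by
    have : Real.exp (-(θ ^ 2 * δ / 4)) ≤ Real.exp (-(1 / 4 * w)) := by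
      rw [Real.exp_le_exp]; linarith
    calc _ = 2 * ((n : ℝ) ^ 11 * Real.exp (-(θ ^ 2 * δ / 4))) := by ring
      _ ≤ 2 * ((n : ℝ) ^ 11 * Real.exp (-(1 / 4 * w))) := by gcongr
      _ ≤ _ := by linarith
  have e3 : 4 * Real.exp (-((n : ℝ) ^ (1 / 80 : ℝ))) * (n : ℝ) ^ 10 ≤ c / 3 := by
    rw [one_mul] at h2; linarith
  have e2 : A * n * (16 / (ε * (δ * θ ^ 2))) ^ r * (n : ℝ) ^ 10 ≤ c / 3 := by
    have hwr : (n : ℝ) ^ 12 ≤ w ^ r := by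
      rw [hw, ← Real.rpow_natCast _ r, ← Real.rpow_mul hn0.le, ← Real.rpow_natCast]
      refine Real.rpow_le_rpow_of_exponent_le hn1 ?_
      push_cast; linarith
    have h0 : 0 ≤ 16 / (ε * (δ * θ ^ 2)) := by have := hw0.trans_le hwδ; positivity
    have : (16 / (ε * (δ * θ ^ 2))) ^ r ≤ (16 / ε) ^ r / (n : ℝ) ^ 12 := by
      calc (16 / (ε * (δ * θ ^ 2))) ^ r ≤ (16 / (ε * w)) ^ r := by gcongr
        _ = (16 / ε) ^ r / w ^ r := by rw [← div_pow, div_div]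
        _ ≤ _ := by gcongr
    calc _ ≤ A * n * ((16 / ε) ^ r / (n : ℝ) ^ 12) * (n : ℝ) ^ 10 := by gcongr
      _ = A * (16 / ε) ^ r / n := by field_simp
      _ ≤ _ := by
        rw [div_le_iff₀ hn0]
        rw [div_le_iff₀ hc] at h3
        linarith
  rw [le_div_iff₀ (by positivity), add_mul, add_mul]
  linarith

end Asymptotics

/-- **Lemma 8.1.** For every `σ ∈ (0,1]` there is `k₀` such that for every `k ≥ k₀`, all
`ε, μ ∈ (0,1]` and every `C₀ ≥ 1` there is `C > 0` such that for every `c > 0` and all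
sufficiently large `n`: with `d ∈ [n]`, `d ≥ C log n`, `dn` even,
`ε d n/2 ≤ m ≤ binom(n,2) − dn/2`, `δ = 2m/n ≥ n^σ`, `p = m(binom(n,2) − dn/2)⁻¹`,
`η = C₀μ/log n`, and `(K,F)` with `K ~ G_d(n)`, `F = K + E`, with probability at least
`1 − c n⁻¹⁰`: for all distinct `x, y` and every `Z ⊆ [n]` with `|Z| ≤ 4k`, the number of
`(F∖K,K)`-alternating `x,y`-paths of length `2k` avoiding `Z` internally is
`(1 ± η)·δ^k d^k/n`. -/
theorem switching_paths_noncritical :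
    ∀ σ : ℝ, 0 < σ → σ ≤ 1 →
      ∃ k₀ : ℕ, ∀ k : ℕ, k₀ ≤ k →
        ∀ ε μ : ℝ, 0 < ε → ε ≤ 1 → 0 < μ → μ ≤ 1 →
          ∀ C₀ : ℝ, 1 ≤ C₀ →
            ∃ C : ℝ, 0 < C ∧
              ∀ c : ℝ, 0 < c →
                ∃ n₀ : ℕ, ∀ n : ℕ, n₀ ≤ n →
                  ∀ d m : ℕ, 1 ≤ d → d ≤ n → C * Real.log n ≤ (d : ℝ) → Even (d * n) →
                    ε * d * n / 2 ≤ (m : ℝ) → (m : ℝ) ≤ (n.choose 2 : ℝ) - d * n / 2 →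
                    ∀ δ p η : ℝ, δ = 2 * (m : ℝ) / n → (n : ℝ) ^ σ ≤ δ →
                      p = (m : ℝ) / ((n.choose 2 : ℝ) - d * n / 2) →
                      η = C₀ * μ / Real.log n →
                      ∀ ν : PMF (SimpleGraph (Fin n) × SimpleGraph (Fin n)),
                        IsRegAddGnp ν d p →
                        ENNReal.ofReal (1 - c / (n : ℝ) ^ 10) ≤
                          prEvent ν (fun w =>
                            ∀ x y : Fin n, x ≠ y →
                              ∀ Z : Set (Fin n), Z.ncard ≤ 4 * k →
                                (1 - η) * δ ^ k * (d : ℝ) ^ k / n ≤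
                                    (altPathCount (w.2 \ w.1) w.1 (2 * k) x y Z : ℝ) ∧
                                  (altPathCount (w.2 \ w.1) w.1 (2 * k) x y Z : ℝ) ≤
                                    (1 + η) * δ ^ k * (d : ℝ) ^ k / n) := by
  intro σ hσ0 hσ1
  set k₁ : ℕ := ⌈100 / σ⌉₊ + 1 with hk₁
  refine ⟨3 * (2 * k₁ + 1), fun k hk ε μ hε0 hε1 hμ0 hμ1 C₀ hC₀ => ?_⟩
  have hk' : 3 * (2 * k₁ + 1) ≤ 2 * k := by omega
  set W : ℝ := (2 * k * (4 * k + 2) + 4 * k ^ 2) * 128 ^ k with hW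
  have hW0 : 0 ≤ W := by positivity
  set C : ℝ := 2 * W / μ + 1 with hC
  have hC0 : 0 < C := by positivity
  refine ⟨C, hC0, fun c hc => ?_⟩
  obtain ⟨j, hj⟩ : ∃ j : ℕ, 13 ≤ σ * (2 ^ j : ℕ) := by
    refine ⟨⌈13 / σ⌉₊, ?_⟩
    have h1 := Nat.le_ceil (13 / σ)
    have h2 : (⌈13 / σ⌉₊ : ℝ) ≤ (2 ^ ⌈13 / σ⌉₊ : ℕ) := by exact_mod_cast Nat.lt_two_pow_self.le
    rw [div_le_iff₀ hσ0] at h1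
    linarith [mul_le_mul_of_nonneg_left h2 hσ0.le]
  have htend : Filter.Tendsto (fun n : ℕ => (n : ℝ) ^ (1 / 80 : ℝ)) Filter.atTop Filter.atTop :=
    (tendsto_rpow_atTop (by norm_num)).comp tendsto_natCast_atTop_atTop
  have htend' : Filter.Tendsto (fun n : ℕ => (n : ℝ) ^ (σ / 100)) Filter.atTop Filter.atTop :=
    (tendsto_rpow_atTop (by positivity)).comp tendsto_natCast_atTop_atTop
  have H := (((Filter.eventually_ge_atTop 2).and (eventually_mul_log_le_rpow hσ0 C)).and
    ((htend'.eventually_ge_atTop (k * 8 ^ k)).and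
      (eventually_mul_log_le_rpow (a := σ / 100) (by positivity) (k * 8 ^ k * 2 / μ)))).and
    (((htend.eventually_ge_atTop (288 / ε)).and (htend.eventually_ge_atTop 12000)).and
      (((tendsto_pow_mul_exp_neg_rpow (a := 1 / 5) (b := 1 / 4) (by norm_num) (by norm_num)
        1).eventually_lt_const (u := 1 / 4) (by norm_num)).and
      (eventually_failure_le (A := (2 * 2 ^ j + 1) ^ (2 * 2 ^ j + 2)) hσ0 hε0 hc (by positivity)
        hj)))
  obtain ⟨n₀, hn₀⟩ := Filter.eventually_atTop.1 H
  refine ⟨n₀, fun n hn d m hd _ hCd he hm1 hm2 δ p η hδ hnδ hp hη ν hν => ?_⟩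
  obtain ⟨⟨⟨hn2, hlogδ⟩, hθ1, hθ2⟩, ⟨hsε, hs12⟩, hnear, hfail⟩ := hn₀ n hn
  have hn0 : (0 : ℝ) < n := by exact_mod_cast (show 0 < n by omega)
  have hn1 : (1 : ℝ) ≤ n := by exact_mod_cast (show 1 ≤ n by omega)
  have hlog : 0 < Real.log n := Real.log_pos (by exact_mod_cast hn2)
  set s : ℝ := (n : ℝ) ^ (1 / 80 : ℝ) with hs
  have hs1 : 1 ≤ s := by linarith
  have hθinv : (n : ℝ) ^ (-(σ / 100)) = ((n : ℝ) ^ (σ / 100))⁻¹ := Real.rpow_neg hn0.le _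
  have hδ1 : 1 ≤ δ := (Real.one_le_rpow hn1 hσ0.le).trans hnδ
  have hspow : ∀ i : ℕ, s ^ i = (n : ℝ) ^ ((i : ℝ) / 80) := fun i => by
    rw [hs, ← Real.rpow_natCast, ← Real.rpow_mul hn0.le]; congr 1; ring
  have hs80 : s ^ 80 = n := by rw [hspow]; norm_num
  refine (ENNReal.ofReal_le_ofReal (sub_le_sub_left (hfail δ hnδ) 1)).trans ?_
  refine switching_paths_of_bounds (k₁ := k₁) (j := j) (κ := (C * Real.log n)⁻¹)
    hs1 hs80 hε0 hε1 hd he hm1 hm2 hδ hδ1 hp (by positivity) ?_ ?_ ?_ ?_ (by omega) hk' ?_ ?_ ?_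
    ?_ ?_ ?_ le_rfl hν
  · exact Real.rpow_le_one_of_one_le_of_nonpos hn1 (by linarith)
  · rw [hs, ← Real.rpow_add hn0]
    exact Real.one_le_rpow hn1 (by linarith)
  · exact inv_anti₀ (by positivity) (hlogδ.trans hnδ)
  · exact inv_anti₀ (by positivity) hCd
  · have h1 := Nat.le_ceil (100 / σ)
    rw [div_le_iff₀ hσ0] at h1
    rw [le_div_iff₀ hn0, ← Real.rpow_natCast, ← Real.rpow_mul hn0.le]
    nth_rw 2 [← Real.rpow_one (n : ℝ)]
    rw [← Real.rpow_add hn0]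
    refine Real.rpow_le_rpow_of_exponent_le hn1 ?_
    rw [hk₁]
    push_cast
    linarith
  · rw [hθinv, ← div_eq_mul_inv, div_le_one (by positivity)]
    exact hθ1
  · have h1 : k * 8 ^ k * (n : ℝ) ^ (-(σ / 100)) ≤ μ / (2 * Real.log n) := by
      rw [div_mul_eq_mul_div, div_le_iff₀ hμ0] at hθ2
      rw [hθinv, ← div_eq_mul_inv, div_le_div_iff₀ (by positivity) (by positivity)]
      linarith
    have h2 : (2 * k * (4 * k + 2) + 4 * k ^ 2) * (128 ^ k * (C * Real.log n)⁻¹) ≤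
        μ / (2 * Real.log n) := by
      rw [← mul_assoc, ← hW, ← div_eq_mul_inv, div_le_div_iff₀ (by positivity) (by positivity)]
      have : 2 * W ≤ μ * C := by rw [hC, mul_add, mul_div_cancel₀ _ hμ0.ne']; linarith
      linarith [mul_le_mul_of_nonneg_right this hlog.le]
    have h3 : μ / (2 * Real.log n) + μ / (2 * Real.log n) = μ / Real.log n := by
      field_simp; norm_num
    have h4 : μ / Real.log n ≤ η := by
      rw [hη]; gcongr; exact le_mul_of_one_le_left hμ0.le hC₀
    linarith
  · rw [div_le_iff₀ hε0] at hsε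
    calc (288 : ℝ) ≤ s * ε := hsε
      _ ≤ s * ε * s := le_mul_of_one_le_right (by positivity) hs1
      _ = ε * s ^ 2 := by ring
  · rw [hs80, hspow]
    have e : ((16 : ℕ) : ℝ) / 80 = 1 / 5 := by norm_num
    rw [e]
    rw [pow_one, one_div_mul_eq_div] at hnear
    linarith
  · exact hs12.trans (le_self_pow₀ hs1 (by norm_num))

end Sandwich
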